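/- Let M and N be real analytic manifolds, f : M → N a real analytic map, V a subanalytic open subset of N, and U = f⁻¹(V). If ψ is a smooth function with polynomial growth on V, then ψ ∘ f has polynomial growth on U. -/

import Mathlib

open scoped Topology
open Set

/-- A subset of a real normed space is *semianalytic* if, locally, it is a finite union of
finite intersections of zero sets and positivity sets of real-analytic functions. -/
def Semianalytic {E : Type*} [NormedAddCommGroup E] [NormedSpace ℝ E] (A : Set E) : Prop :=
  ∀ x : E, ∃ U ∈ 𝓝 x, ∃ (p q : ℕ) (f g : Fin p → Fin q → E → ℝ),
    (∀ i j, AnalyticOnNhd ℝ (f i j) U) ∧ (∀ i j, AnalyticOnNhd ℝ (g i j) U) ∧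
    A ∩ U = (⋃ i, ⋂ j, {y | f i j y = 0} ∩ {y | 0 < g i j y}) ∩ U

/-- A subset of a real normed space is *subanalytic* if, locally, it is the projection of a
relatively compact semianalytic subset of a product with some `ℝ^m`. -/
def Subanalytic {E : Type*} [NormedAddCommGroup E] [NormedSpace ℝ E] (A : Set E) : Prop :=
  ∀ x : E, ∃ U ∈ 𝓝 x, ∃ (m : ℕ) (B : Set (E × (Fin m → ℝ))),
    Semianalytic B ∧ IsCompact (closure B) ∧ A ∩ U = (Prod.fst '' B) ∩ U

/-- A function `f`, considered on the open set `U`, has *polynomial growth* at a point `p`: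
there are a compact neighbourhood `K` of `p` and a positive integer `N` with
`sup_{x ∈ K ∩ U} dist(x, K \ U)^N ‖f x‖ < ∞`. -/
def HasPolyGrowthAt {E F : Type*} [NormedAddCommGroup E] [NormedSpace ℝ E]
    [NormedAddCommGroup F] (f : E → F) (U : Set E) (p : E) : Prop :=
  ∃ K : Set E, IsCompact K ∧ K ∈ 𝓝 p ∧ ∃ N : ℕ, 0 < N ∧ ∃ C : ℝ,
    ∀ x ∈ K ∩ U, Metric.infDist x (K \ U) ^ N * ‖f x‖ ≤ C

/-- A smooth function on the open set `U` is *tempered* if all of its (iterated) derivatives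
have polynomial growth at every point. -/
def IsTemperedOn {E : Type*} [NormedAddCommGroup E] [NormedSpace ℝ E]
    (f : E → ℂ) (U : Set E) : Prop :=
  ∀ (k : ℕ) (p : E),
    HasPolyGrowthAt (fun x => ‖iteratedFDerivWithin ℝ k f U x‖) U p

/-! ### Determined functions and division-closed classes -/

/-- `S` depends only on the signs of finitely many members of `A`. -/
def DetBy {Y : Type*} {α : Type*} (A : Set (Y → ℝ)) (S : Y → α) : Prop :=
  ∃ T : Set (Y → ℝ), T.Finite ∧ T ⊆ A ∧
    ∀ y₁ y₂, (∀ a ∈ T, SignType.sign (a y₁) = SignType.sign (a y₂)) → S y₁ = S y₂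

namespace DetBy

variable {Y : Type*} {α β γ : Type*} {A : Set (Y → ℝ)}

theorem const (c : α) : DetBy A (fun _ => c) :=
  ⟨∅, Set.finite_empty, Set.empty_subset _, fun _ _ _ => rfl⟩

theorem map {S : Y → α} (h : DetBy A S) (F : α → β) : DetBy A (fun y => F (S y)) := by
  obtain ⟨T, hT, hTA, h⟩ := h
  exact ⟨T, hT, hTA, fun y₁ y₂ hy => congrArg F (h y₁ y₂ hy)⟩

theorem prodMk {S : Y → α} {S' : Y → β} (h : DetBy A S) (h' : DetBy A S') :
    DetBy A (fun y => (S y, S' y)) := by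
  obtain ⟨T, hT, hTA, h⟩ := h
  obtain ⟨T', hT', hTA', h'⟩ := h'
  refine ⟨T ∪ T', hT.union hT', Set.union_subset hTA hTA', fun y₁ y₂ hy => ?_⟩
  exact Prod.ext (h y₁ y₂ (fun a ha => hy a (Or.inl ha))) (h' y₁ y₂ (fun a ha => hy a (Or.inr ha)))

theorem map₂ {S : Y → α} {S' : Y → β} (h : DetBy A S) (h' : DetBy A S') (F : α → β → γ) :
    DetBy A (fun y => F (S y) (S' y)) :=
  (h.prodMk h').map (fun p => F p.1 p.2)

theorem sign {a : Y → ℝ} (ha : a ∈ A) : DetBy A (fun y => SignType.sign (a y)) :=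
  ⟨{a}, Set.finite_singleton a, by simpa using ha, fun _ _ h => h a rfl⟩

theorem pi {ι : Type*} [Finite ι] {β : ι → Type*} {S : ∀ i, Y → β i} (h : ∀ i, DetBy A (S i)) :
    DetBy A (fun y i => S i y) := by
  choose T hT hTA h using h
  refine ⟨⋃ i, T i, Set.finite_iUnion hT, Set.iUnion_subset hTA, fun y₁ y₂ hy => ?_⟩
  funext i
  exact h i y₁ y₂ (fun a ha => hy a (Set.mem_iUnion.2 ⟨i, ha⟩))

theorem congr {S S' : Y → α} (h : DetBy A S) (e : ∀ y, S' y = S y) : DetBy A S' := by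
  have : S' = S := funext e
  rwa [this]

theorem and {S S' : Y → Prop} (h : DetBy A S) (h' : DetBy A S') :
    DetBy A (fun y => S y ∧ S' y) := h.map₂ h' And

theorem not {S : Y → Prop} (h : DetBy A S) : DetBy A (fun y => ¬ S y) := h.map Not

theorem exists_finite {ι : Type*} [Finite ι] {S : ι → Y → Prop} (h : ∀ i, DetBy A (S i)) :
    DetBy A (fun y => ∃ i, S i y) := (pi h).map (fun f => ∃ i, f i)

theorem forall_finite {ι : Type*} [Finite ι] {S : ι → Y → Prop} (h : ∀ i, DetBy A (S i)) :
    DetBy A (fun y => ∀ i, S i y) := (pi h).map (fun f => ∀ i, f i)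

theorem sum {ι : Type*} [AddCommMonoid β] (s : Finset ι) {S : ι → Y → β}
    (h : ∀ i, DetBy A (S i)) : DetBy A (fun y => ∑ i ∈ s, S i y) := by
  classical
  induction s using Finset.induction_on with
  | empty => simpa using const (0 : β)
  | insert a s ha ih =>
    simp only [Finset.sum_insert ha]
    exact (h a).map₂ ih (· + ·)

theorem pos {a : Y → ℝ} (ha : a ∈ A) : DetBy A (fun y => 0 < a y) :=
  ((sign ha).map (fun s => s = 1)).congr (fun y => by simp [sign_eq_one_iff])

theorem eq_zero {a : Y → ℝ} (ha : a ∈ A) : DetBy A (fun y => a y = 0) :=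
  ((sign ha).map (fun s => s = 0)).congr (fun y => by simp [sign_eq_zero_iff])

/-- case distinction. -/
theorem ite {c : Y → Prop} {S S₁ S₂ : Y → α} (hc : DetBy A c) (h₁ : DetBy A S₁)
    (h₂ : DetBy A S₂) (e₁ : ∀ y, c y → S y = S₁ y) (e₂ : ∀ y, ¬ c y → S y = S₂ y) :
    DetBy A S := by
  classical
  refine ((hc.prodMk (h₁.prodMk h₂)).map (fun p => if p.1 then p.2.1 else p.2.2)).congr ?_
  intro y
  by_cases h : c y
  · simp [h, e₁ y h]
  · simp [h, e₂ y h]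

/-- A determined function factors through a finite sign vector. -/
theorem exists_factor {Y : Type} {A : Set (Y → ℝ)} {S : Y → α} (h : DetBy A S) :
    ∃ (κ : Type) (_ : Finite κ) (T : κ → Y → ℝ), (∀ i, T i ∈ A) ∧
      ∀ y₁ y₂, (∀ i, SignType.sign (T i y₁) = SignType.sign (T i y₂)) → S y₁ = S y₂ := by
  obtain ⟨T, hT, hTA, h⟩ := h
  exact ⟨T, hT, fun i => i.1, fun i => hTA i.2, fun y₁ y₂ hy =>
    h y₁ y₂ (fun a ha => hy ⟨a, ha⟩)⟩

end DetBy

theorem analyticAt_proj {κ : Type} [Fintype κ] (i : κ) (p : κ → ℝ) :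
    AnalyticAt ℝ (fun q : κ → ℝ => q i) p :=
  (ContinuousLinearMap.proj (R := ℝ) (φ := fun _ : κ => ℝ) i).analyticAt p

/-- A class of bounded functions closed under restricted analytic functions, case
distinctions and bounded division. -/
structure DClosed {X : Type} (D : Set (X → ℝ)) : Prop where
  bdd : ∀ a ∈ D, ∃ C : ℝ, ∀ x, |a x| ≤ C
  ana : ∀ (κ : Type) [Fintype κ] (τ : κ → X → ℝ) (g : (κ → ℝ) → ℝ) (K : Set (κ → ℝ)),
    (∀ i, τ i ∈ D) → IsCompact K → (∀ x, (fun i => τ i x) ∈ K) → AnalyticOnNhd ℝ g K →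
    (fun x => g (fun i => τ i x)) ∈ D
  ite : ∀ a ∈ D, ∀ b ∈ D, ∀ c ∈ D, (fun x => if 0 < a x then b x else c x) ∈ D
  div : ∀ a ∈ D, ∀ b ∈ D, (fun x => if |a x| ≤ |b x| then a x / b x else 0) ∈ D

namespace DClosed

variable {X : Type} {D : Set (X → ℝ)}

theorem bdd_pi (hD : DClosed D) {κ : Type} [Fintype κ] {τ : κ → X → ℝ} (hτ : ∀ i, τ i ∈ D) :
    ∃ C : ℝ, ∀ x, (fun i => τ i x) ∈ Set.Icc (fun _ : κ => -C) (fun _ => C) := by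
  choose C hC using fun i => hD.bdd (τ i) (hτ i)
  refine ⟨∑ i, |C i|, fun x => ?_⟩
  have h : ∀ i, |τ i x| ≤ ∑ i, |C i| := fun i =>
    ((hC i x).trans (le_abs_self _)).trans
      (Finset.single_le_sum (f := fun i => |C i|) (fun _ _ => abs_nonneg _) (Finset.mem_univ i))
  exact ⟨fun i => (abs_le.1 (h i)).1, fun i => (abs_le.1 (h i)).2⟩

/-- composition with an everywhere analytic function. -/
theorem comp (hD : DClosed D) {κ : Type} [Fintype κ] {τ : κ → X → ℝ} (hτ : ∀ i, τ i ∈ D) (g : (κ → ℝ) → ℝ)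
    (hg : ∀ p, AnalyticAt ℝ g p) : (fun x => g (fun i => τ i x)) ∈ D := by
  obtain ⟨C, hC⟩ := hD.bdd_pi hτ
  exact hD.ana κ τ g _ hτ isCompact_Icc hC (fun p _ => hg p)

theorem const (hD : DClosed D) (c : ℝ) : (fun _ => c) ∈ D :=
  hD.comp (κ := Empty) (τ := fun i => i.elim) (fun i => i.elim) (fun _ => c)
    (fun _ => analyticAt_const)

theorem comp₂ (hD : DClosed D) {a b : X → ℝ} (ha : a ∈ D) (hb : b ∈ D) (g : ℝ → ℝ → ℝ)
    (hg : ∀ p : Bool → ℝ, AnalyticAt ℝ (fun p : Bool → ℝ => g (p false) (p true)) p) :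
    (fun x => g (a x) (b x)) ∈ D :=
  hD.comp (κ := Bool) (τ := fun i => bif i then b else a)
    (fun i => by cases i <;> simpa) (fun p => g (p false) (p true)) hg

theorem add (hD : DClosed D) {a b : X → ℝ} (ha : a ∈ D) (hb : b ∈ D) : (fun x => a x + b x) ∈ D :=
  hD.comp₂ ha hb (· + ·) (fun p => (analyticAt_proj _ p).add (analyticAt_proj _ p))

theorem sub (hD : DClosed D) {a b : X → ℝ} (ha : a ∈ D) (hb : b ∈ D) : (fun x => a x - b x) ∈ D :=
  hD.comp₂ ha hb (· - ·) (fun p => (analyticAt_proj _ p).sub (analyticAt_proj _ p))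

theorem mul (hD : DClosed D) {a b : X → ℝ} (ha : a ∈ D) (hb : b ∈ D) : (fun x => a x * b x) ∈ D :=
  hD.comp₂ ha hb (· * ·) (fun p => (analyticAt_proj _ p).mul (analyticAt_proj _ p))

/-- definition by cases along a determined predicate. -/
theorem ite_le (hD : DClosed D) {a b c d : X → ℝ} (ha : a ∈ D) (hb : b ∈ D) (hc : c ∈ D) (hd : d ∈ D) :
    (fun x => if a x ≤ b x then c x else d x) ∈ D := by
  have := hD.ite _ (hD.sub ha hb) _ hd _ hc
  convert this using 2 with x
  by_cases h : a x ≤ b x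
  · simp [h]
  · simp [h, not_le.1 h]

theorem det_le (hD : DClosed D) {a b : X → ℝ} (ha : a ∈ D) (hb : b ∈ D) : DetBy D (fun x => a x ≤ b x) :=
  ((DetBy.pos (hD.sub ha hb)).not).congr (fun x => by simp)

theorem det_abs_le (hD : DClosed D) {a b : X → ℝ} (ha : a ∈ D) (hb : b ∈ D) :
    DetBy D (fun x => |a x| ≤ |b x|) :=
  (hD.det_le (hD.mul ha ha) (hD.mul hb hb)).congr
    (fun x => by simp only [← pow_two, sq_le_sq])

end DClosed

/-! ### Word functional calculus and Weierstrass division -/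

section FC
set_option linter.unusedSectionVars false

variable {κ : Type} [Fintype κ] [DecidableEq κ]

/-- The extension of a power series on `κ → ℝ` to a (non commutative) Banach algebra. -/
noncomputable def wordSeries (p : FormalMultilinearSeries ℝ (κ → ℝ) ℝ)
    (A : Type) [NormedRing A] [NormedAlgebra ℝ A] : FormalMultilinearSeries ℝ (κ → A) A :=
  fun n => ∑ w : Fin n → κ, p n (fun i => Pi.single (w i) 1) •
    (ContinuousMultilinearMap.mkPiAlgebraFin ℝ n A).compContinuousLinearMap
      (fun i => ContinuousLinearMap.proj (w i))

theorem wordSeries_apply (p : FormalMultilinearSeries ℝ (κ → ℝ) ℝ)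
    (A : Type) [NormedRing A] [NormedAlgebra ℝ A] (n : ℕ) (ξ : κ → A) :
    wordSeries p A n (fun _ => ξ) =
      ∑ w : Fin n → κ, p n (fun i => Pi.single (w i) 1) • (List.ofFn fun i => ξ (w i)).prod := by
  simp [wordSeries]

theorem wordSeries_norm (p : FormalMultilinearSeries ℝ (κ → ℝ) ℝ)
    (A : Type) [NormedRing A] [NormedAlgebra ℝ A] [NormOneClass A] (n : ℕ) :
    ‖wordSeries p A n‖ ≤ (Fintype.card κ : ℝ) ^ n * ‖p n‖ := by
  refine ContinuousMultilinearMap.opNorm_le_bound (by positivity) (fun m => ?_)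
  have e : wordSeries p A n m =
      ∑ w : Fin n → κ, p n (fun i => Pi.single (w i) 1) • (List.ofFn fun i => m i (w i)).prod := by
    simp [wordSeries]
  rw [e]
  have h : ∀ w : Fin n → κ, ‖p n (fun i => (Pi.single (w i) 1 : κ → ℝ)) •
      (List.ofFn fun i => m i (w i)).prod‖ ≤ ‖p n‖ * ∏ i, ‖m i‖ := by
    intro w
    rw [norm_smul]
    have h1 : ‖p n (fun i => (Pi.single (w i) 1 : κ → ℝ))‖ ≤ ‖p n‖ := by
      refine ((p n).le_opNorm _).trans ?_
      refine mul_le_of_le_one_right (norm_nonneg _) ?_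
      refine Finset.prod_le_one (fun _ _ => norm_nonneg _) (fun i _ => ?_)
      rw [pi_norm_le_iff_of_nonneg zero_le_one]
      intro j
      by_cases hj : j = w i
      · subst hj; simp
      · simp [Pi.single_eq_of_ne hj]
    have h2 : ‖(List.ofFn fun i => m i (w i)).prod‖ ≤ ∏ i, ‖m i‖ := by
      refine (List.norm_prod_le _).trans ?_
      rw [List.map_ofFn, List.prod_ofFn]
      exact Finset.prod_le_prod (fun _ _ => norm_nonneg _) (fun i _ => norm_le_pi_norm (m i) (w i))
    exact mul_le_mul h1 h2 (norm_nonneg _) (norm_nonneg _)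
  refine (norm_sum_le _ _).trans ((Finset.sum_le_sum (fun w _ => h w)).trans ?_)
  simp [mul_assoc]

theorem wordSeries_radius (p : FormalMultilinearSeries ℝ (κ → ℝ) ℝ) (hp : 0 < p.radius)
    (A : Type) [NormedRing A] [NormedAlgebra ℝ A] [NormOneClass A] :
    ∃ r : NNReal, 0 < r ∧ (r : ENNReal) ≤ (wordSeries p A).radius ∧ (r : ENNReal) ≤ p.radius := by
  obtain ⟨r, hr0, hr⟩ := ENNReal.lt_iff_exists_nnreal_btwn.1 hp
  obtain ⟨C, hC, hb⟩ := p.norm_mul_pow_le_of_lt_radius hr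
  have hr0' : 0 < r := by simpa using hr0
  set N : NNReal := (Fintype.card κ : NNReal) + 1
  have hN : (1 : NNReal) ≤ N := by simp [N]
  have hN0 : 0 < N := lt_of_lt_of_le one_pos hN
  refine ⟨r / N, div_pos hr0' hN0, ?_, ?_⟩
  · refine (wordSeries p A).le_radius_of_bound C (fun n => ?_)
    calc ‖wordSeries p A n‖ * ((r / N : NNReal) : ℝ) ^ n
        ≤ ((Fintype.card κ : ℝ) ^ n * ‖p n‖) * ((r / N : NNReal) : ℝ) ^ n :=
          mul_le_mul_of_nonneg_right (wordSeries_norm p A n) (by positivity)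
      _ = (‖p n‖ * (r : ℝ) ^ n) * ((Fintype.card κ : ℝ) / (N : ℝ)) ^ n := by
          push_cast
          rw [div_pow, div_pow]; ring
      _ ≤ (‖p n‖ * (r : ℝ) ^ n) * 1 := by
          refine mul_le_mul_of_nonneg_left ?_ (by positivity)
          refine pow_le_one₀ (by positivity) ?_
          rw [div_le_one (by exact_mod_cast hN0)]
          simp [N]
      _ ≤ C := by rw [mul_one]; exact hb n
  · refine le_trans ?_ hr.le
    exact_mod_cast div_le_self (zero_le) hN

theorem word_intertwine {W : Type} [NormedAddCommGroup W] [NormedSpace ℝ W]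
    (ξ : κ → (W →L[ℝ] W)) (x : κ → ℝ) (l : W →L[ℝ] ℝ)
    (h : ∀ j a, l (ξ j a) = x j * l a) (L : List κ) (a : W) :
    l ((L.map ξ).prod a) = (L.map x).prod * l a := by
  induction L generalizing a with
  | nil => simp
  | cons j L ih =>
    rw [List.map_cons, List.prod_cons, List.map_cons, List.prod_cons]
    show l (ξ j ((L.map ξ).prod a)) = _
    rw [h, ih]
    ring

theorem multilinear_words (p : FormalMultilinearSeries ℝ (κ → ℝ) ℝ) (n : ℕ) (x : κ → ℝ) :
    p n (fun _ => x) =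
      ∑ w : Fin n → κ, p n (fun i => Pi.single (w i) 1) * ∏ i, x (w i) := by
  have hx : x = ∑ j, x j • (Pi.single j 1 : κ → ℝ) := by
    ext i; simp [Finset.sum_apply, Pi.single_apply]
  conv_lhs => rw [hx]
  rw [ContinuousMultilinearMap.map_sum (p n) (fun (_ : Fin n) j => x j • (Pi.single j 1 : κ → ℝ))]
  refine Finset.sum_congr rfl (fun w _ => ?_)
  rw [ContinuousMultilinearMap.map_smul_univ (p n) (fun i => x (w i))
    (fun i => (Pi.single (w i) 1 : κ → ℝ)), smul_eq_mul, mul_comm]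

theorem wordSeries_intertwine (p : FormalMultilinearSeries ℝ (κ → ℝ) ℝ)
    {W : Type} [NormedAddCommGroup W] [NormedSpace ℝ W]
    (ξ : κ → (W →L[ℝ] W)) (x : κ → ℝ) (l : W →L[ℝ] ℝ)
    (h : ∀ j a, l (ξ j a) = x j * l a) (n : ℕ) (a : W) :
    l (wordSeries p (W →L[ℝ] W) n (fun _ => ξ) a) = p n (fun _ => x) * l a := by
  rw [wordSeries_apply, multilinear_words, sum_apply, map_sum, Finset.sum_mul]
  refine Finset.sum_congr rfl (fun w _ => ?_)
  have := word_intertwine ξ x l h (List.ofFn w) a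
  rw [List.map_ofFn, List.map_ofFn] at this
  rw [smul_apply, map_smul, smul_eq_mul]
  have h2 : (List.ofFn fun i => ξ (w i)) = List.ofFn (ξ ∘ w) := rfl
  rw [h2, this, List.prod_ofFn]
  simp only [Function.comp]
  ring

end FC

section Shift

theorem exists_shift : ∃ (R L : (BoundedContinuousFunction ℕ ℝ) →L[ℝ] (BoundedContinuousFunction ℕ ℝ))
    (e0 : BoundedContinuousFunction ℕ ℝ) (ev0 : (BoundedContinuousFunction ℕ ℝ) →L[ℝ] ℝ),
    ‖R‖ ≤ 1 ∧ ‖L‖ ≤ 1 ∧ (∀ h, L (R h) = h) ∧ (∀ h, ev0 (R h) = 0) ∧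
    (∀ h, h = ev0 h • e0 + R (L h)) ∧ ev0 e0 = 1 := by
  let sh : ∀ h : BoundedContinuousFunction ℕ ℝ, ∀ n : ℕ, ‖(Nat.casesOn n 0 (fun k => h k) : ℝ)‖ ≤ ‖h‖ := by
    intro h n
    cases n with
    | zero => simp
    | succ k => exact h.norm_coe_le_norm k
  let R : (BoundedContinuousFunction ℕ ℝ) →L[ℝ] (BoundedContinuousFunction ℕ ℝ) :=
    LinearMap.mkContinuous
      { toFun := fun h => BoundedContinuousFunction.ofNormedAddCommGroupDiscrete _ ‖h‖ (sh h)
        map_add' := fun a b => by ext n; cases n <;> simp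
        map_smul' := fun c b => by ext n; cases n <;> simp } 1 (fun h => by
          rw [one_mul]
          exact (BoundedContinuousFunction.norm_le (norm_nonneg _)).2 (sh h))
  let L : (BoundedContinuousFunction ℕ ℝ) →L[ℝ] (BoundedContinuousFunction ℕ ℝ) :=
    LinearMap.mkContinuous
      { toFun := fun h => h.compContinuous ⟨Nat.succ, continuous_of_discreteTopology⟩
        map_add' := fun a b => by ext n; simp
        map_smul' := fun c b => by ext n; simp } 1 (fun h => by
          rw [one_mul]
          exact (BoundedContinuousFunction.norm_le (norm_nonneg _)).2
            (fun n => h.norm_coe_le_norm (n + 1)))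
  have hR0 : ∀ h, R h 0 = 0 := fun h => rfl
  have hRs : ∀ h n, R h (n + 1) = h n := fun h n => rfl
  have hL : ∀ h n, L h n = h (n + 1) := fun h n => rfl
  let e0 : BoundedContinuousFunction ℕ ℝ :=
    BoundedContinuousFunction.ofNormedAddCommGroupDiscrete (fun n => if n = 0 then 1 else 0) 1
      (fun n => by by_cases h : n = 0 <;> simp [h])
  have he0 : ∀ n, e0 n = if n = 0 then 1 else 0 := fun n => rfl
  refine ⟨R, L, e0, BoundedContinuousFunction.evalCLM ℝ 0, ?_, ?_, ?_, ?_, ?_, ?_⟩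
  · exact LinearMap.mkContinuous_norm_le _ zero_le_one _
  · exact LinearMap.mkContinuous_norm_le _ zero_le_one _
  · intro h; ext n; rw [hL, hRs]
  · intro h; exact hR0 h
  · intro h; ext n
    cases n with
    | zero => simp [hR0, he0]
    | succ k => simp [hRs, he0, hL]
  · simp [he0]

theorem exists_shift' : ∃ (W : Type) (_ : NormedAddCommGroup W) (_ : NormedSpace ℝ W)
    (_ : CompleteSpace W) (R L : W →L[ℝ] W) (e0 : W) (ev0 : W →L[ℝ] ℝ),
    ‖R‖ ≤ 1 ∧ ‖L‖ ≤ 1 ∧ (∀ h, L (R h) = h) ∧ (∀ h, ev0 (R h) = 0) ∧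
    (∀ h, h = ev0 h • e0 + R (L h)) ∧ ev0 e0 = 1 :=
  ⟨BoundedContinuousFunction ℕ ℝ, inferInstance, inferInstance, inferInstance, exists_shift⟩

theorem analyticAt_ringInverse {A : Type} [NormedRing A] [NormedAlgebra ℝ A] [CompleteSpace A]
    {P : Type} [NormedAddCommGroup P] [NormedSpace ℝ P] {M : P → A} {x : P}
    (hM : AnalyticAt ℝ M x) (hu : IsUnit (M x)) :
    AnalyticAt ℝ (fun y => Ring.inverse (M y)) x := by
  obtain ⟨u, hu⟩ := hu
  have := analyticAt_inverse (𝕜 := ℝ) u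
  rw [hu] at this
  exact this.comp hM

end Shift

section WD

theorem exists_fcalc {P : Type} [NormedAddCommGroup P] [NormedSpace ℝ P] [FiniteDimensional ℝ P]
    (W : Type) [NormedAddCommGroup W] [NormedSpace ℝ W] [CompleteSpace W] [Nontrivial W]
    (f : P × ℝ → ℝ) (hf : AnalyticAt ℝ f 0) :
    ∃ (r : ℝ) (p : FormalMultilinearSeries ℝ ℝ ℝ) (C : ℝ), 0 < r ∧
      HasFPowerSeriesAt (fun z => f (0, z)) p 0 ∧ (∀ n, |p.coeff n| * r ^ n ≤ C) ∧
      ∀ S : W →L[ℝ] W, ‖S‖ < r → ∃ F : P → (W →L[ℝ] W), AnalyticAt ℝ F 0 ∧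
        HasSum (fun n => p.coeff n • S ^ n) (F 0) ∧
        ∀ᶠ x in 𝓝 (0 : P), ∀ z : ℝ, |z| < r → ∀ l : W →L[ℝ] ℝ, (∀ a, l (S a) = z * l a) →
          ∀ a, l (F x a) = f (x, z) * l a := by
  classical
  let e : P ≃L[ℝ] (Fin (Module.finrank ℝ P) → ℝ) :=
    ContinuousLinearEquiv.ofFinrankEq (by simp)
  let κ := Option (Fin (Module.finrank ℝ P))
  let u : (κ → ℝ) →L[ℝ] P × ℝ :=
    ((e.symm : _ →L[ℝ] P).comp (ContinuousLinearMap.pi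
      (fun j => ContinuousLinearMap.proj (some j)))).prod (ContinuousLinearMap.proj none)
  let v : P × ℝ → (κ → ℝ) := fun q i => Option.casesOn i q.2 (fun j => e q.1 j)
  have huv : ∀ q, u (v q) = q := fun q => by
    refine Prod.ext ?_ rfl
    exact e.symm_apply_apply q.1
  have hu0 : u 0 = 0 := map_zero u
  have hfu : AnalyticAt ℝ (f ∘ u) 0 := by
    refine AnalyticAt.comp ?_ (u.analyticAt 0)
    rwa [hu0]
  obtain ⟨p, R, hp⟩ := hfu
  obtain ⟨r₀, hr₀, hr1, hr2⟩ := wordSeries_radius p (hp.r_pos.trans_le hp.r_le) (W →L[ℝ] W)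
  obtain ⟨R', hR'0, hR'⟩ := ENNReal.lt_iff_exists_nnreal_btwn.1 hp.r_pos
  have hRpos : 0 < R' := by simpa using hR'0
  set r : NNReal := min r₀ R' / 2 with hr
  have hrpos : 0 < r := by
    have : 0 < min r₀ R' := lt_min hr₀ hRpos
    positivity
  have hrr₀ : r < r₀ := (NNReal.half_lt_self (lt_min hr₀ hRpos).ne').trans_le (min_le_left _ _)
  have hrR' : r < R' := (NNReal.half_lt_self (lt_min hr₀ hRpos).ne').trans_le (min_le_right _ _)
  let line : ℝ →L[ℝ] (κ → ℝ) := ContinuousLinearMap.pi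
    (fun i => Option.casesOn i (ContinuousLinearMap.id ℝ ℝ) (fun _ => 0))
  have hline : ∀ z, line z = v (0, z) := fun z => by
    funext i
    cases i with
    | none => rfl
    | some j => simp [line, v]
  have hline1 : line 1 = Pi.single none 1 := by
    funext i
    cases i with
    | none => simp [line]
    | some j => simp [line]
  have hcoef : ∀ n, (p.compContinuousLinearMap line).coeff n =
      p n (fun _ => Pi.single none 1) := by
    intro n
    rw [FormalMultilinearSeries.coeff, ← hline1]
    rfl
  obtain ⟨C, hC0, hC⟩ := p.norm_mul_pow_le_of_lt_radius
    (lt_of_lt_of_le (ENNReal.coe_lt_coe.2 hrr₀) hr2)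
  refine ⟨r, p.compContinuousLinearMap line, C, by exact_mod_cast hrpos, ?_, ?_, ?_⟩
  · have h1 : HasFPowerSeriesAt (f ∘ u) p (line 0) := by
      rw [map_zero]; exact ⟨R, hp⟩
    have h2 := h1.compContinuousLinearMap
    convert h2 using 1
    funext z
    simp only [Function.comp, hline, huv]
  · intro n
    rw [hcoef]
    refine le_trans ?_ (hC n)
    refine mul_le_mul_of_nonneg_right ?_ (by positivity)
    have := (p n).le_opNorm (fun _ => (Pi.single none 1 : κ → ℝ))
    have h1 : ‖(Pi.single none 1 : κ → ℝ)‖ ≤ 1 := by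
      rw [pi_norm_le_iff_of_nonneg zero_le_one]
      intro i
      cases i <;> simp
    refine this.trans (mul_le_of_le_one_right (norm_nonneg _) ?_)
    exact Finset.prod_le_one (fun _ _ => norm_nonneg _) (fun _ _ => h1)
  · intro S hS
    let ξ : P → (κ → (W →L[ℝ] W)) := fun x i =>
      Option.casesOn i S (fun j => (e x j) • (1 : W →L[ℝ] W))
    have hξ : AnalyticAt ℝ ξ 0 := by
      refine AnalyticAt.pi (fun i => ?_)
      cases i with
      | none => exact analyticAt_const
      | some j =>
        refine AnalyticAt.fun_smul (f := fun x => e x j) (g := fun _ => (1 : W →L[ℝ] W))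
          ?_ analyticAt_const
        exact (analyticAt_proj j (e 0)).comp
          ((e : P →L[ℝ] (Fin (Module.finrank ℝ P) → ℝ)).analyticAt 0)
    have hξ0 : ‖ξ 0‖ < r := by
      rw [pi_norm_lt_iff (by exact_mod_cast hrpos)]
      intro i
      cases i with
      | none => exact hS
      | some j => simpa [ξ] using hrpos
    have hWs := (wordSeries p (W →L[ℝ] W)).hasFPowerSeriesOnBall
      ((ENNReal.coe_pos.2 hr₀).trans_le hr1)
    have hmem : ∀ η : κ → (W →L[ℝ] W), ‖η‖ < r →
        η ∈ Metric.eball (0 : κ → (W →L[ℝ] W)) (wordSeries p (W →L[ℝ] W)).radius := by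
      intro η hη
      rw [mem_eball_zero_iff]
      refine lt_of_lt_of_le ?_ hr1
      refine lt_trans ?_ (ENNReal.coe_lt_coe.2 hrr₀)
      rw [enorm_eq_nnnorm]
      exact_mod_cast hη
    have hsum : ∀ η : κ → (W →L[ℝ] W), ‖η‖ < r →
        HasSum (fun n => wordSeries p (W →L[ℝ] W) n (fun _ => η))
          ((wordSeries p (W →L[ℝ] W)).sum η) := by
      intro η hη
      simpa using hWs.hasSum (hmem η hη)
    refine ⟨fun x => (wordSeries p (W →L[ℝ] W)).sum (ξ x), ?_, ?_, ?_⟩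
    · refine AnalyticAt.fun_comp ?_ hξ
      exact hWs.analyticAt_of_mem (hmem _ hξ0)
    · have := hsum (ξ 0) hξ0
      convert this using 2 with n
      rw [hcoef, wordSeries_apply]
      rw [Finset.sum_eq_single (fun _ => none)]
      · simp [ξ, List.ofFn_const]
      · intro w _ hw
        have : ∃ i, w i ≠ none := by
          by_contra hcon
          push Not at hcon
          exact hw (funext hcon)
        obtain ⟨i, hi⟩ := this
        obtain ⟨j, hj⟩ := Option.ne_none_iff_exists'.1 hi
        rw [List.prod_eq_zero, smul_zero]
        rw [List.mem_ofFn]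
        exact ⟨i, by simp [ξ, hj]⟩
      · simp
    · have h1 : ∀ᶠ x in 𝓝 (0 : P), ‖ξ x‖ < r :=
        hξ.continuousAt.norm.eventually (gt_mem_nhds hξ0)
      have h2 : ∀ᶠ x in 𝓝 (0 : P), ‖e x‖ < r := by
        have : ContinuousAt (fun x => ‖e x‖) 0 := (e.continuous.norm).continuousAt
        refine this.eventually (gt_mem_nhds ?_)
        simpa using hrpos
      filter_upwards [h1, h2] with x hx1 hx2 z hz l hl a
      have hs := hsum (ξ x) hx1
      have hs2 : HasSum (fun n => l (wordSeries p (W →L[ℝ] W) n (fun _ => ξ x) a))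
          (l ((wordSeries p (W →L[ℝ] W)).sum (ξ x) a)) :=
        ((l.comp (ContinuousLinearMap.apply ℝ W a)).hasSum hs)
      have hv : ‖v (x, z)‖ < r := by
        rw [pi_norm_lt_iff (by exact_mod_cast hrpos)]
        intro i
        cases i with
        | none => exact hz
        | some j => exact (norm_le_pi_norm (e x) j).trans_lt hx2
      have hs3 : HasSum (fun n => p n (fun _ => v (x, z))) (f (x, z)) := by
        have := hp.hasSum (y := v (x, z)) (by
          rw [mem_eball_zero_iff]
          refine lt_trans ?_ hR'
          refine lt_trans ?_ (ENNReal.coe_lt_coe.2 hrR')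
          rw [enorm_eq_nnnorm]
          exact_mod_cast hv)
        simpa [huv] using this
      have hs4 := hs3.mul_right (l a)
      refine hs2.unique ?_
      have hw : (fun n => l (wordSeries p (W →L[ℝ] W) n (fun _ => ξ x) a)) =
          fun n => p n (fun _ => v (x, z)) * l a := by
        funext n
        refine wordSeries_intertwine p (ξ x) (v (x, z)) l ?_ n a
        intro j a
        cases j with
        | none => exact hl a
        | some j => simp [ξ, v]
      rw [hw]
      exact hs4

end WD

section WD2

theorem analyticAt_clm_apply {P V W : Type} [NormedAddCommGroup P] [NormedSpace ℝ P]
    [NormedAddCommGroup V] [NormedSpace ℝ V] [NormedAddCommGroup W] [NormedSpace ℝ W]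
    {F : P → (V →L[ℝ] W)} {q : P → V} {x : P} (hF : AnalyticAt ℝ F x) (hq : AnalyticAt ℝ q x) :
    AnalyticAt ℝ (fun x => F x (q x)) x :=
  ((ContinuousLinearMap.id ℝ (V →L[ℝ] W)).analyticAt_bilinear (F x, q x)).comp₂ hF hq

theorem isUnit_of_norm_sub_smul_lt {A : Type} [NormedRing A] [NormedAlgebra ℝ A] [CompleteSpace A]
    (M : A) (c : ℝ) (h : ‖M - c • (1 : A)‖ < |c|) : IsUnit M := by
  have hc : 0 < |c| := (norm_nonneg _).trans_lt h
  have hc0 : c ≠ 0 := abs_pos.1 hc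
  have h1 : IsUnit (c⁻¹ • M) := by
    by_contra hcon
    refine nonunits.subset_compl_ball hcon ?_
    rw [mem_ball_iff_norm]
    have : c⁻¹ • M - 1 = c⁻¹ • (M - c • (1 : A)) := by
      rw [smul_sub, smul_smul, inv_mul_cancel₀ hc0, one_smul]
    rw [this, norm_smul, norm_inv, Real.norm_eq_abs, inv_mul_lt_iff₀ hc, mul_one]
    exact h
  have h2 : M = algebraMap ℝ A c * (c⁻¹ • M) := by
    rw [← Algebra.smul_def, smul_smul, mul_inv_cancel₀ hc0, one_smul]
  rw [h2]
  exact ((IsUnit.mk0 c hc0).map (algebraMap ℝ A)).mul h1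

theorem weierstrass_division {P : Type} [NormedAddCommGroup P] [NormedSpace ℝ P]
    [FiniteDimensional ℝ P] (g : P × ℝ → ℝ) (hg : AnalyticAt ℝ g 0)
    (hreg : ¬ ∀ᶠ z in 𝓝 (0 : ℝ), g (0, z) = 0) :
    ∃ d : ℕ, (∃ u : ℝ → ℝ, ContinuousAt u 0 ∧ u 0 ≠ 0 ∧ ∀ z, g (0, z) = z ^ d * u z) ∧
      ∀ f : P × ℝ → ℝ, AnalyticAt ℝ f 0 →
      ∃ (q : P × ℝ → ℝ) (r : Fin d → P → ℝ), AnalyticAt ℝ q 0 ∧ (∀ j, AnalyticAt ℝ (r j) 0) ∧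
        ∀ᶠ p in 𝓝 (0 : P × ℝ), f p = g p * q p + ∑ j, r j p.1 * p.2 ^ (j : ℕ) := by
  obtain ⟨W, _, _, _, R, L, e0, ev0, hR, hL, hLR, hevR, hdec, hev1⟩ := exists_shift'
  have hnt : Nontrivial W := ⟨e0, 0, fun h => by rw [h, map_zero] at hev1; exact zero_ne_one hev1⟩
  obtain ⟨rg, p, C, hrg, hp, hC, hG⟩ := exists_fcalc W g hg
  have hp0 : p ≠ 0 := fun h => hreg (hp.locally_zero_iff.2 h)
  refine ⟨p.order, ⟨_, (hp.has_fpower_series_iterate_dslope_fslope p.order).continuousAt,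
    hp.iterate_dslope_fslope_ne_zero hp0, fun z => ?_⟩, ?_⟩
  · have := hp.eq_pow_order_mul_iterate_dslope z
    simpa using this
  intro f hf
  set d := p.order with hd
  obtain ⟨rf, _, _, hrf, _, _, hF⟩ := exists_fcalc W f hf
  have hcd : p.coeff d ≠ 0 := by
    rw [Ne, FormalMultilinearSeries.coeff_eq_zero]
    exact FormalMultilinearSeries.apply_order_ne_zero hp0
  have hclt : ∀ n < d, p.coeff n = 0 := fun n hn =>
    FormalMultilinearSeries.coeff_eq_zero.2 (FormalMultilinearSeries.apply_eq_zero_of_lt_order hn)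
  have hC0 : 0 ≤ C := le_trans (by positivity) (hC 0)
  -- choice of the radius
  obtain ⟨η, hη0, hη4, hηC⟩ : ∃ η : ℝ, 0 < η ∧ η ≤ 1 / 4 ∧ C / rg ^ d * (2 * η) < |p.coeff d| := by
    have hpos : 0 < |p.coeff d| := abs_pos.2 hcd
    have hCr : 0 ≤ C / rg ^ d := by positivity
    refine ⟨min (1 / 4) (|p.coeff d| / (4 * (C / rg ^ d + 1))), by positivity, min_le_left _ _, ?_⟩
    have h1 := min_le_right (1 / 4) (|p.coeff d| / (4 * (C / rg ^ d + 1)))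
    rw [le_div_iff₀ (by positivity)] at h1
    have h2 : 0 < min (1 / 4) (|p.coeff d| / (4 * (C / rg ^ d + 1))) := by positivity
    nlinarith
  obtain ⟨ρ, hρ0, hρη, hρf⟩ : ∃ ρ : ℝ, 0 < ρ ∧ ρ ≤ η * rg ∧ ρ < rf :=
    ⟨min (η * rg) (rf / 2), by positivity, min_le_left _ _, (min_le_right _ _).trans_lt (by linarith)⟩
  have hρg : ρ < rg := by nlinarith
  set S : W →L[ℝ] W := ρ • R with hS
  set B : W →L[ℝ] W := ρ⁻¹ • L with hB
  have hSn : ‖S‖ ≤ ρ := by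
    rw [hS, norm_smul, Real.norm_of_nonneg hρ0.le]
    exact mul_le_of_le_one_right hρ0.le hR
  have hBn : ‖B‖ ≤ ρ⁻¹ := by
    rw [hB, norm_smul, Real.norm_of_nonneg (inv_pos.2 hρ0).le]
    exact mul_le_of_le_one_right (inv_pos.2 hρ0).le hL
  have hBS : B * S = 1 := by
    ext1 h
    show B (S h) = h
    simp only [hS, hB, smul_apply, map_smul, hLR, smul_smul]
    rw [mul_comm, inv_mul_cancel₀ hρ0.ne', one_smul]
  have hevS : ∀ h, ev0 (S h) = 0 := fun h => by simp [hS, hevR]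
  have hdec' : ∀ h, h = ev0 h • e0 + S (B h) := fun h => by
    have : S (B h) = R (L h) := by
      simp only [hS, hB, smul_apply, map_smul, smul_smul]
      rw [inv_mul_cancel₀ hρ0.ne', one_smul]
    rw [this]; exact hdec h
  have hBe : B e0 = 0 := by
    have h1 := hdec' e0
    rw [hev1, one_smul] at h1
    have h2 : S (B e0) = 0 := by simpa using h1
    have h3 : (B * S) (B e0) = B (S (B e0)) := rfl
    rw [hBS, h2, map_zero] at h3
    exact h3
  obtain ⟨G, hGan, hG0, hGl⟩ := hG S (hSn.trans_lt hρg)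
  obtain ⟨F, hFan, -, hFl⟩ := hF S (hSn.trans_lt hρf)
  -- the operator to be inverted
  have hM0 : IsUnit (B ^ d * G 0) := by
    have h1 : HasSum (fun n => p.coeff n • (B ^ d * S ^ n)) (B ^ d * G 0) := by
      have := hG0.mul_left (B ^ d)
      simpa only [mul_smul_comm] using this
    have h2 : HasSum (fun n => p.coeff (n + (d + 1)) • S ^ (n + 1))
        (B ^ d * G 0 - p.coeff d • (1 : W →L[ℝ] W)) := by
      have := (hasSum_nat_add_iff' (d + 1)).2 h1
      rw [Finset.sum_range_succ, Finset.sum_eq_zero, zero_add, pow_mul_pow_eq_one d hBS] at this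
      · have hfe : (fun n => p.coeff (n + (d + 1)) • S ^ (n + 1)) =
            fun n => p.coeff (n + (d + 1)) • (B ^ d * S ^ (n + (d + 1))) := by
          funext n
          have : B ^ d * S ^ (n + (d + 1)) = S ^ (n + 1) := by
            rw [show n + (d + 1) = d + (n + 1) by ring, pow_add, ← mul_assoc,
              pow_mul_pow_eq_one d hBS, one_mul]
          rw [this]
        rw [hfe]
        exact this
      · intro i hi
        rw [hclt i (Finset.mem_range.1 hi), zero_smul]
    refine isUnit_of_norm_sub_smul_lt _ (p.coeff d) (lt_of_le_of_lt ?_ hηC)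
    rw [← h2.tsum_eq]
    have hgeo : HasSum (fun n : ℕ => C / rg ^ d * η * η ^ n) (C / rg ^ d * η * (1 - η)⁻¹) :=
      (hasSum_geometric_of_lt_one hη0.le (by linarith)).mul_left _
    refine (tsum_of_norm_bounded hgeo (fun n => ?_)).trans ?_
    · rw [norm_smul, Real.norm_eq_abs]
      have h3 : ‖S ^ (n + 1)‖ ≤ (η * rg) ^ (n + 1) :=
        (norm_pow_le' S (Nat.succ_pos n)).trans
          (pow_le_pow_left₀ (norm_nonneg _) (hSn.trans hρη) _)
      have h4 := hC (n + (d + 1))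
      rw [← le_div_iff₀ (by positivity)] at h4
      calc _ ≤ C / rg ^ (n + (d + 1)) * (η * rg) ^ (n + 1) :=
            mul_le_mul h4 h3 (norm_nonneg _) (by positivity)
        _ = _ := by
            rw [mul_pow, show n + (d + 1) = d + (n + 1) by ring, pow_add]
            field_simp
            ring
    · have : (1 - η)⁻¹ ≤ 2 := by
        rw [inv_le_comm₀ (by linarith) (by norm_num)]
        linarith
      have h5 : 0 ≤ C / rg ^ d * η := by positivity
      nlinarith
  have hMan : AnalyticAt ℝ (fun x => B ^ d * G x) 0 := analyticAt_const.mul hGan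
  have hMu : ∀ᶠ x in 𝓝 (0 : P), IsUnit (B ^ d * G x) :=
    hMan.continuousAt.eventually (Units.isOpen.mem_nhds hM0)
  let qW : P → W := fun x => Ring.inverse (B ^ d * G x) ((B ^ d * F x) e0)
  have hqW : AnalyticAt ℝ qW 0 := by
    refine analyticAt_clm_apply (analyticAt_ringInverse hMan hM0) ?_
    exact analyticAt_clm_apply (analyticAt_const.mul hFan) analyticAt_const
  let H : P → W := fun x => F x e0 - G x (qW x)
  have hHan : AnalyticAt ℝ H 0 :=
    (analyticAt_clm_apply hFan analyticAt_const).sub (analyticAt_clm_apply hGan hqW)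
  have hH : ∀ᶠ x in 𝓝 (0 : P), (B ^ d) (H x) = 0 := by
    filter_upwards [hMu] with x hx
    have h1 : (B ^ d * G x) (qW x) = (B ^ d * F x) e0 := by
      show ((B ^ d * G x) * Ring.inverse (B ^ d * G x)) ((B ^ d * F x) e0) = _
      rw [Ring.mul_inverse_cancel _ hx]
      rfl
    show (B ^ d) (F x e0 - G x (qW x)) = 0
    rw [map_sub, sub_eq_zero]
    exact h1.symm
  have hexp : ∀ (n : ℕ) (h : W), h = ∑ k ∈ Finset.range n, ev0 ((B ^ k) h) • (S ^ k) e0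
      + (S ^ n) ((B ^ n) h) := by
    intro n
    induction n with
    | zero => intro h; simp
    | succ n ih =>
      intro h
      have h1 := ih h
      have h2 : (S ^ n) ((B ^ n) h) = ev0 ((B ^ n) h) • (S ^ n) e0 + (S ^ (n + 1)) ((B ^ (n + 1)) h) := by
        conv_lhs => rw [hdec' ((B ^ n) h), map_add, map_smul]
        rw [pow_succ S n, pow_succ' B n]
        rfl
      rw [h2, ← add_assoc] at h1
      rw [Finset.sum_range_succ]
      exact h1
  -- evaluation functionals
  let evz : ℝ → (W →L[ℝ] ℝ) := fun z => ev0.comp (Ring.inverse (1 - z • B))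
  have hTan : AnalyticAt ℝ (fun z : ℝ => Ring.inverse (1 - z • B)) 0 := by
    refine analyticAt_ringInverse ?_ ?_
    · exact analyticAt_const.fun_sub (analyticAt_id.fun_smul analyticAt_const)
    · simp
  have hevan : AnalyticAt ℝ evz 0 := by
    exact AnalyticAt.fun_comp (g := ContinuousLinearMap.compL ℝ W W ℝ ev0)
      (f := fun z : ℝ => Ring.inverse (1 - z • B))
      ((ContinuousLinearMap.compL ℝ W W ℝ ev0).analyticAt _) hTan
  have hTu : ∀ z : ℝ, |z| < ρ → IsUnit (1 - z • B) := by
    intro z hz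
    refine (Units.oneSub (z • B) ?_).isUnit
    rw [norm_smul, Real.norm_eq_abs]
    calc |z| * ‖B‖ ≤ |z| * ρ⁻¹ := mul_le_mul_of_nonneg_left hBn (abs_nonneg _)
      _ < ρ * ρ⁻¹ := mul_lt_mul_of_pos_right hz (inv_pos.2 hρ0)
      _ = 1 := mul_inv_cancel₀ hρ0.ne'
  have hevzS : ∀ z : ℝ, |z| < ρ → ∀ a, evz z (S a) = z * evz z a := by
    intro z hz a
    have h1 : S a = (1 - z • B) (S a) + z • a := by
      have : B (S a) = a := congrArg (fun T : W →L[ℝ] W => T a) hBS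
      simp [sub_apply, this]
    have h2 : (Ring.inverse (1 - z • B)) (S a) = S a + z • (Ring.inverse (1 - z • B)) a := by
      conv_lhs => rw [h1, map_add, map_smul]
      have : (Ring.inverse (1 - z • B)) ((1 - z • B) (S a)) =
        (Ring.inverse (1 - z • B) * (1 - z • B)) (S a) := rfl
      rw [this, Ring.inverse_mul_cancel _ (hTu z hz)]
      rfl
    show ev0 ((Ring.inverse (1 - z • B)) (S a)) = z * ev0 ((Ring.inverse (1 - z • B)) a)
    rw [h2, map_add, map_smul, hevS, zero_add, smul_eq_mul]
  have hevze : ∀ z : ℝ, |z| < ρ → evz z e0 = 1 := by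
    intro z hz
    have h1 : (1 - z • B) e0 = e0 := by simp [sub_apply, hBe]
    have h2 : (Ring.inverse (1 - z • B)) ((1 - z • B) e0) =
        (Ring.inverse (1 - z • B) * (1 - z • B)) e0 := rfl
    rw [Ring.inverse_mul_cancel _ (hTu z hz), h1] at h2
    show ev0 ((Ring.inverse (1 - z • B)) e0) = 1
    rw [h2]
    exact hev1
  have hevzp : ∀ z : ℝ, |z| < ρ → ∀ k : ℕ, evz z ((S ^ k) e0) = z ^ k := by
    intro z hz k
    induction k with
    | zero => simpa using hevze z hz
    | succ k ih =>
      rw [pow_succ' S k]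
      show evz z (S ((S ^ k) e0)) = _
      rw [hevzS z hz, ih, pow_succ']
  refine ⟨fun p => evz p.2 (qW p.1), fun j x => ev0 ((B ^ (j : ℕ)) (H x)), ?_, ?_, ?_⟩
  · refine analyticAt_clm_apply (F := fun p : P × ℝ => evz p.2) (q := fun p => qW p.1) ?_ ?_
    · exact AnalyticAt.fun_comp (f := fun p : P × ℝ => p.2) (g := evz) hevan analyticAt_snd
    · exact AnalyticAt.fun_comp (f := fun p : P × ℝ => p.1) (g := qW) hqW analyticAt_fst
  · intro j
    exact ((ev0.comp (B ^ (j : ℕ))).analyticAt (H 0)).comp hHan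
  · have hx : Filter.Tendsto (fun p : P × ℝ => p.1) (𝓝 0) (𝓝 0) := continuous_fst.tendsto 0
    have hz : ∀ᶠ p : P × ℝ in 𝓝 0, |p.2| < ρ := by
      have : ContinuousAt (fun p : P × ℝ => |p.2|) 0 := by fun_prop
      exact this.eventually (gt_mem_nhds (by simpa using hρ0))
    filter_upwards [hx.eventually hFl, hx.eventually hGl, hx.eventually hH, hz] with p h1 h2 h3 h4
    have h5 := hexp d (H p.1)
    rw [h3, map_zero, add_zero] at h5
    have h6 := congrArg (evz p.2) h5
    rw [map_sum] at h6
    have h7 : evz p.2 (H p.1) = f p - g p * evz p.2 (qW p.1) := by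
      show evz p.2 (F p.1 e0 - G p.1 (qW p.1)) = _
      rw [map_sub, h1 p.2 (h4.trans hρf) _ (hevzS _ h4), h2 p.2 (h4.trans hρg) _ (hevzS _ h4),
        hevze _ h4, mul_one]
    rw [h7] at h6
    rw [← Fin.sum_univ_eq_sum_range (fun k => evz p.2 (ev0 ((B ^ k) (H p.1)) • (S ^ k) e0))] at h6
    rw [sub_eq_iff_eq_add] at h6
    rw [h6, add_comm]
    congr 1
    refine Finset.sum_congr rfl (fun k _ => ?_)
    rw [map_smul, hevzp _ h4, smul_eq_mul]

end WD2

section WP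

theorem poly_eq_zero_of_eq_pow_mul (Q : Polynomial ℝ) (d : ℕ) (hQ : Q.degree < d) (w : ℝ → ℝ)
    (hw : ContinuousAt w 0) (h : ∀ᶠ z in 𝓝 (0 : ℝ), Q.eval z = z ^ d * w z) : Q = 0 := by
  by_contra hQ0
  obtain ⟨T, hT, hTd⟩ := Polynomial.exists_eq_pow_rootMultiplicity_mul_and_not_dvd Q hQ0 0
  set k := Q.rootMultiplicity 0
  rw [Polynomial.C_0, sub_zero] at hT hTd
  have hkd : k < d := by
    have h1 : Q.natDegree < d := (Polynomial.natDegree_lt_iff_degree_lt hQ0).2 hQ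
    have h2 := Polynomial.natDegree_le_of_dvd (Dvd.intro T hT.symm) hQ0
    rw [Polynomial.natDegree_X_pow] at h2
    omega
  have hT0 : T.eval 0 ≠ 0 := by
    intro h0
    exact hTd (by rw [Polynomial.X_dvd_iff, Polynomial.coeff_zero_eq_eval_zero, h0])
  have h1 : Filter.Tendsto (fun z => T.eval z) (𝓝[≠] (0 : ℝ)) (𝓝 (T.eval 0)) :=
    (T.continuous.tendsto 0).mono_left nhdsWithin_le_nhds
  have h2 : Filter.Tendsto (fun z : ℝ => z ^ (d - k) * w z) (𝓝[≠] (0 : ℝ)) (𝓝 0) := by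
    have : Filter.Tendsto (fun z : ℝ => z ^ (d - k) * w z) (𝓝 (0 : ℝ)) (𝓝 (0 ^ (d - k) * w 0)) :=
      ((continuous_pow (d - k)).continuousAt.mul hw)
    rw [zero_pow (by omega), zero_mul] at this
    exact this.mono_left nhdsWithin_le_nhds
  have h3 : ∀ᶠ z in 𝓝[≠] (0 : ℝ), T.eval z = z ^ (d - k) * w z := by
    filter_upwards [h.filter_mono nhdsWithin_le_nhds, self_mem_nhdsWithin] with z hz hz0
    rw [hT, Polynomial.eval_mul, Polynomial.eval_pow, Polynomial.eval_X] at hz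
    have : z ^ d = z ^ k * z ^ (d - k) := by rw [← pow_add]; congr 1; omega
    rw [this, mul_assoc] at hz
    exact mul_left_cancel₀ (pow_ne_zero k hz0) hz
  exact hT0 (tendsto_nhds_unique (h1.congr' h3) h2)

theorem weierstrass_prep {P : Type} [NormedAddCommGroup P] [NormedSpace ℝ P]
    [FiniteDimensional ℝ P] (g : P × ℝ → ℝ) (hg : AnalyticAt ℝ g 0)
    (hreg : ¬ ∀ᶠ z in 𝓝 (0 : ℝ), g (0, z) = 0) :
    ∃ (d : ℕ) (q : P × ℝ → ℝ) (r : Fin d → P → ℝ), AnalyticAt ℝ q 0 ∧ q 0 ≠ 0 ∧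
      (∀ j, AnalyticAt ℝ (r j) 0) ∧
        ∀ᶠ p in 𝓝 (0 : P × ℝ), g p * q p = p.2 ^ d + ∑ j, r j p.1 * p.2 ^ (j : ℕ) := by
  obtain ⟨d, ⟨u, hu, hu0, hgu⟩, hdiv⟩ := weierstrass_division g hg hreg
  obtain ⟨q, r, hq, hr, h⟩ := hdiv (fun p => p.2 ^ d) (analyticAt_snd.pow d)
  refine ⟨d, q, fun j x => - r j x, hq, ?_, fun j => (hr j).neg, ?_⟩
  · have hline : Filter.Tendsto (fun z : ℝ => ((0 : P), z)) (𝓝 0) (𝓝 0) := by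
      have : Continuous (fun z : ℝ => ((0 : P), z)) := by fun_prop
      exact this.tendsto 0
    have hqc : ContinuousAt (fun z : ℝ => q (0, z)) 0 := by
      have : Filter.Tendsto (fun z : ℝ => q (0, z)) (𝓝 0) (𝓝 (q 0)) :=
        hq.continuousAt.tendsto.comp hline
      exact this
    have hwc : ContinuousAt (fun z : ℝ => 1 - u z * q (0, z)) 0 :=
      continuousAt_const.sub (hu.mul hqc)
    have h' := hline.eventually h
    have hQ : (∑ j : Fin d, Polynomial.C (r j 0) * Polynomial.X ^ (j : ℕ)) = 0 := by
      refine poly_eq_zero_of_eq_pow_mul _ d (Polynomial.degree_sum_fin_lt _) _ hwc ?_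
      filter_upwards [h'] with z hz
      simp only [hgu] at hz
      rw [Polynomial.eval_finsetSum]
      simp only [Polynomial.eval_mul, Polynomial.eval_C, Polynomial.eval_pow, Polynomial.eval_X]
      linarith
    have h1 : ∀ᶠ z in 𝓝[≠] (0 : ℝ), u z * q (0, z) = 1 := by
      filter_upwards [h'.filter_mono nhdsWithin_le_nhds, self_mem_nhdsWithin] with z hz hz0
      have h2 := congrArg (Polynomial.eval z) hQ
      rw [Polynomial.eval_finsetSum] at h2
      simp only [Polynomial.eval_mul, Polynomial.eval_C, Polynomial.eval_pow, Polynomial.eval_X,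
        Polynomial.eval_zero] at h2
      simp only [hgu, h2, add_zero, mul_assoc] at hz
      exact (mul_left_cancel₀ (pow_ne_zero d hz0) (by rw [mul_one]; exact hz)).symm
    have h3 : Filter.Tendsto (fun z => u z * q (0, z)) (𝓝[≠] (0 : ℝ)) (𝓝 (u 0 * q (0, 0))) :=
      (hu.mul hqc).tendsto.mono_left nhdsWithin_le_nhds
    have h4 : u 0 * q (0, 0) = 1 :=
      tendsto_nhds_unique (h3.congr' h1) tendsto_const_nhds
    intro h0
    have h0' : q (0, 0) = 0 := h0
    rw [h0', mul_zero] at h4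
    exact zero_ne_one h4
  · filter_upwards [h] with p hp
    simp only [neg_mul, Finset.sum_neg_distrib]
    linarith

end WP

section Dv
set_option linter.unusedSectionVars false

variable {E G F F' : Type} [NormedAddCommGroup E] [NormedSpace ℝ E] [NormedAddCommGroup G]
  [NormedSpace ℝ G] [NormedAddCommGroup F] [NormedSpace ℝ F]
  [NormedAddCommGroup F'] [NormedSpace ℝ F']

/-- derivative in the direction `v` of the second variable -/
noncomputable def Dv (v : G) (f : E × G → F) : E × G → F := fun p => fderiv ℝ f p (0, v)

theorem Dv_analyticAt [CompleteSpace F] {v : G} {f : E × G → F} {p : E × G} (hf : AnalyticAt ℝ f p) :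
    AnalyticAt ℝ (Dv v f) p :=
  analyticAt_clm_apply hf.fderiv analyticAt_const

theorem DvN_analyticAt [CompleteSpace F] {v : G} {f : E × G → F} {p : E × G} (hf : AnalyticAt ℝ f p) (k : ℕ) :
    AnalyticAt ℝ ((Dv v)^[k] f) p := by
  induction k with
  | zero => exact hf
  | succ k ih => rw [Function.iterate_succ_apply']; exact Dv_analyticAt ih

theorem Dv_congr {v : G} {f g : E × G → F} {p : E × G} (h : f =ᶠ[𝓝 p] g) :
    Dv v f =ᶠ[𝓝 p] Dv v g := by
  filter_upwards [h.fderiv (𝕜 := ℝ)] with q hq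
  simp [Dv, hq]

theorem DvN_congr {v : G} {f g : E × G → F} {p : E × G} (h : f =ᶠ[𝓝 p] g) (k : ℕ) :
    (Dv v)^[k] f =ᶠ[𝓝 p] (Dv v)^[k] g := by
  induction k with
  | zero => exact h
  | succ k ih => rw [Function.iterate_succ_apply', Function.iterate_succ_apply']; exact Dv_congr ih

theorem DvN_add [CompleteSpace F] {v : G} {f g : E × G → F} {p : E × G} (hf : AnalyticAt ℝ f p)
    (hg : AnalyticAt ℝ g p) (k : ℕ) :
    (Dv v)^[k] (fun q => f q + g q) =ᶠ[𝓝 p] fun q => (Dv v)^[k] f q + (Dv v)^[k] g q := by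
  induction k with
  | zero => rfl
  | succ k ih =>
    simp only [Function.iterate_succ_apply']
    refine (Dv_congr ih).trans ?_
    filter_upwards [(DvN_analyticAt (v := v) hf k).eventually_analyticAt,
      (DvN_analyticAt (v := v) hg k).eventually_analyticAt] with q h1 h2
    simp only [Dv]
    rw [fderiv_fun_add h1.differentiableAt h2.differentiableAt]
    rfl

/-- compatibility with continuous linear maps on the target -/
theorem DvN_clm [CompleteSpace F] [CompleteSpace F'] {v : G} {f : E × G → F} {p : E × G}
    (hf : AnalyticAt ℝ f p) (l : F →L[ℝ] F') (k : ℕ) :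
    (Dv v)^[k] (fun q => l (f q)) =ᶠ[𝓝 p] fun q => l ((Dv v)^[k] f q) := by
  induction k with
  | zero => rfl
  | succ k ih =>
    simp only [Function.iterate_succ_apply']
    refine (Dv_congr ih).trans ?_
    filter_upwards [(DvN_analyticAt (v := v) hf k).eventually_analyticAt] with q h1
    simp only [Dv]
    have h5 : fderiv ℝ (fun q => l ((Dv v)^[k] f q)) q = _ :=
      (l.hasFDerivAt.comp q h1.differentiableAt.hasFDerivAt).fderiv
    rw [h5]
    rfl

theorem eventually_fst {p : E × G} {P : E → Prop} (h : ∀ᶠ x in 𝓝 p.1, P x) :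
    ∀ᶠ q : E × G in 𝓝 p, P q.1 := (continuous_fst.tendsto p).eventually h

/-- multiplication by a function of the first variable -/
theorem DvN_smul [CompleteSpace F] {v : G} {h : E × G → ℝ} {b : E → F} {p : E × G}
    (hh : AnalyticAt ℝ h p) (hb : AnalyticAt ℝ b p.1) (k : ℕ) :
    (Dv v)^[k] (fun q => h q • b q.1) =ᶠ[𝓝 p] fun q => (Dv v)^[k] h q • b q.1 := by
  induction k with
  | zero => rfl
  | succ k ih =>
    simp only [Function.iterate_succ_apply']
    refine (Dv_congr ih).trans ?_
    filter_upwards [(DvN_analyticAt (v := v) hh k).eventually_analyticAt,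
      eventually_fst hb.eventually_analyticAt] with q h1 h2
    simp only [Dv]
    have h3 : HasFDerivAt (fun q : E × G => b q.1) ((fderiv ℝ b q.1).comp (ContinuousLinearMap.fst ℝ E G)) q :=
      h2.differentiableAt.hasFDerivAt.comp q (hasFDerivAt_fst)
    have h4 := h1.differentiableAt.hasFDerivAt.fun_smul h3
    rw [h4.fderiv]
    simp

theorem DvN_sum [CompleteSpace F] {ι : Type} (s : Finset ι) {v : G} {f : ι → E × G → F} {p : E × G}
    (hf : ∀ i, AnalyticAt ℝ (f i) p) (k : ℕ) :
    (Dv v)^[k] (fun q => ∑ i ∈ s, f i q) =ᶠ[𝓝 p] fun q => ∑ i ∈ s, (Dv v)^[k] (f i) q := by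
  classical
  induction s using Finset.induction_on with
  | empty =>
    simp only [Finset.sum_empty]
    induction k with
    | zero => rfl
    | succ k ih =>
      rw [Function.iterate_succ_apply']
      refine (Dv_congr ih).trans ?_
      filter_upwards with q
      simp [Dv]
  | insert a s ha ih =>
    simp only [Finset.sum_insert ha]
    refine (DvN_add (hf a) (Finset.analyticAt_fun_sum _ (fun i _ => hf i)) k).trans ?_
    filter_upwards [ih] with q hq
    rw [hq]

/-- change of the base by a linear map -/
theorem DvN_base [CompleteSpace F] {E' : Type} [NormedAddCommGroup E'] [NormedSpace ℝ E'] {v : G}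
    {f : E' × G → F} (σ : E →L[ℝ] E') {p : E × G}
    (hf : AnalyticAt ℝ f (σ p.1, p.2)) (k : ℕ) :
    (Dv v)^[k] (fun q : E × G => f (σ q.1, q.2)) =ᶠ[𝓝 p] fun q => (Dv v)^[k] f (σ q.1, q.2) := by
  induction k with
  | zero => rfl
  | succ k ih =>
    simp only [Function.iterate_succ_apply']
    refine (Dv_congr ih).trans ?_
    have hc : Filter.Tendsto (fun q : E × G => (σ q.1, q.2)) (𝓝 p) (𝓝 (σ p.1, p.2)) := by
      have : Continuous (fun q : E × G => (σ q.1, q.2)) := by fun_prop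
      exact this.tendsto p
    filter_upwards [hc.eventually (DvN_analyticAt (v := v) hf k).eventually_analyticAt] with q h1
    simp only [Dv]
    have h3 : HasFDerivAt (fun q : E × G => (σ q.1, q.2))
      (σ.prodMap (ContinuousLinearMap.id ℝ G)) q := (σ.prodMap (ContinuousLinearMap.id ℝ G)).hasFDerivAt
    have h4 := h1.differentiableAt.hasFDerivAt.comp q h3
    have h5 : fderiv ℝ (fun q : E × G => (Dv v)^[k] f (σ q.1, q.2)) q = _ := h4.fderiv
    rw [h5]
    simp

/-- vanishing on the fibre over `0` is inherited by derivatives along the fibre -/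
theorem DvN_fibre [CompleteSpace F] {v : G} {h : E × G → F} (hh : AnalyticAt ℝ h 0)
    (h0 : ∀ᶠ y in 𝓝 (0 : G), h (0, y) = 0) (k : ℕ) :
    ∀ᶠ y in 𝓝 (0 : G), (Dv v)^[k] h (0, y) = 0 := by
  induction k with
  | zero => exact h0
  | succ k ih =>
    rw [Function.iterate_succ_apply']
    have hc : Filter.Tendsto (fun y : G => ((0 : E), y)) (𝓝 0) (𝓝 0) := by
      have : Continuous (fun y : G => ((0 : E), y)) := by fun_prop
      exact this.tendsto 0
    filter_upwards [ih.eventually_nhds, hc.eventually (DvN_analyticAt (v := v) hh k).eventually_analyticAt]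
      with y h1 h2
    have h3 : HasFDerivAt (fun y : G => ((0 : E), y)) (ContinuousLinearMap.inr ℝ E G) y :=
      (ContinuousLinearMap.inr ℝ E G).hasFDerivAt
    have h4 : HasFDerivAt (fun y : G => (Dv v)^[k] h (0, y)) _ y :=
      h2.differentiableAt.hasFDerivAt.comp y h3
    have h5 : HasFDerivAt (fun y : G => (Dv v)^[k] h (0, y)) (0 : G →L[ℝ] F) y :=
      (hasFDerivAt_const (0 : F) y).congr_of_eventuallyEq h1
    have h6 := h4.unique h5
    have h7 := congrArg (fun T : G →L[ℝ] F => T v) h6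
    exact h7

end Dv

section ModTens

variable {E G F F' : Type} [NormedAddCommGroup E] [NormedSpace ℝ E] [NormedAddCommGroup G]
  [NormedSpace ℝ G] [NormedAddCommGroup F] [NormedSpace ℝ F]
  [NormedAddCommGroup F'] [NormedSpace ℝ F']

/-- the module of germs generated by the Taylor coefficients of `f` along the fibres -/
inductive TMod (f : E × G → F) : (E → F) → Prop
  | gen (k : ℕ) (v : G) : TMod f (fun x => (Dv v)^[k] f (x, 0))
  | zero : TMod f (fun _ => 0)
  | add {a b : E → F} : TMod f a → TMod f b → TMod f (fun x => a x + b x)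
  | smul {c : E → ℝ} {a : E → F} : AnalyticAt ℝ c 0 → TMod f a → TMod f (fun x => c x • a x)
  | congr {a b : E → F} : TMod f a → b =ᶠ[𝓝 0] a → TMod f b

/-- combinations of members of `TMod f` with coefficients in all variables -/
inductive Tens (f : E × G → F) : (E × G → F) → Prop
  | of {h : E × G → ℝ} {a : E → F} : AnalyticAt ℝ h 0 → TMod f a → Tens f (fun p => h p • a p.1)
  | zero : Tens f (fun _ => 0)
  | add {g g' : E × G → F} : Tens f g → Tens f g' → Tens f (fun p => g p + g' p)
  | congr {g g' : E × G → F} : Tens f g → g' =ᶠ[𝓝 0] g → Tens f g'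

theorem slice_tendsto : Filter.Tendsto (fun x : E => (x, (0 : G))) (𝓝 0) (𝓝 0) := by
  have : Continuous (fun x : E => (x, (0 : G))) := by fun_prop
  exact this.tendsto 0

theorem slice_analyticAt {f : E × G → F} (hf : AnalyticAt ℝ f 0) :
    AnalyticAt ℝ (fun x : E => f (x, 0)) 0 :=
  AnalyticAt.fun_comp (g := f) (f := fun x : E => (x, (0 : G))) hf
    (analyticAt_id.prod analyticAt_const)

theorem fst_analyticAt {b : E → F} (hb : AnalyticAt ℝ b 0) :
    AnalyticAt ℝ (fun p : E × G => b p.1) 0 :=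
  AnalyticAt.fun_comp (g := b) (f := fun p : E × G => p.1) hb analyticAt_fst

theorem TMod.analyticAt [CompleteSpace F] {f : E × G → F} (hf : AnalyticAt ℝ f 0) {a : E → F}
    (ha : TMod f a) : AnalyticAt ℝ a 0 := by
  induction ha with
  | gen k v => exact slice_analyticAt (DvN_analyticAt hf k)
  | zero => exact analyticAt_const
  | add _ _ h1 h2 => exact h1.fun_add h2
  | smul hc _ h => exact hc.fun_smul h
  | congr _ h ih => exact ih.congr h.symm

/-- `Mod g ⊆ Mod f` as soon as generators are -/
theorem TMod.mono {f g : E × G → F}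
    (h : ∀ k v, TMod f (fun x => (Dv v)^[k] g (x, 0))) {a : E → F} (ha : TMod g a) : TMod f a := by
  induction ha with
  | gen k v => exact h k v
  | zero => exact .zero
  | add _ _ h1 h2 => exact .add h1 h2
  | smul hc _ h => exact .smul hc h
  | congr _ h ih => exact .congr ih h

theorem Tens.analyticAt [CompleteSpace F] {f : E × G → F} (hf : AnalyticAt ℝ f 0) {a : E × G → F}
    (ha : Tens f a) : AnalyticAt ℝ a 0 := by
  induction ha with
  | of hh ha => exact hh.fun_smul (fst_analyticAt (ha.analyticAt hf))
  | zero => exact analyticAt_const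
  | add _ _ h1 h2 => exact h1.fun_add h2
  | congr _ h ih => exact ih.congr h.symm

theorem DvN_zero {v : G} (k : ℕ) :
    (Dv v)^[k] (fun _ : E × G => (0 : F)) = fun _ => 0 := by
  induction k with
  | zero => rfl
  | succ k ih =>
    rw [Function.iterate_succ_apply', ih]
    funext q
    simp [Dv]

theorem Tens.gen [CompleteSpace F] {f : E × G → F} (hf : AnalyticAt ℝ f 0) {g : E × G → F}
    (hg : Tens f g) (k : ℕ) (v : G) : TMod f (fun x => (Dv v)^[k] g (x, 0)) := by
  induction hg with
  | of hh ha =>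
    refine .congr (.smul (slice_analyticAt (DvN_analyticAt (v := v) hh k)) ha) ?_
    exact slice_tendsto.eventually (DvN_smul hh (ha.analyticAt hf) k)
  | zero => rw [DvN_zero]; exact .zero
  | add ha hb h1 h2 =>
    refine .congr (.add h1 h2) ?_
    exact slice_tendsto.eventually (DvN_add (ha.analyticAt hf) (hb.analyticAt hf) k)
  | congr _ h ih =>
    exact .congr ih (slice_tendsto.eventually (DvN_congr h k))

theorem Tens.sum {ι : Type} (s : Finset ι) {f : E × G → F} {g : ι → E × G → F}
    (hg : ∀ i, Tens f (g i)) : Tens f (fun p => ∑ i ∈ s, g i p) := by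
  classical
  induction s using Finset.induction_on with
  | empty => simpa using Tens.zero
  | insert a s ha ih =>
    simp only [Finset.sum_insert ha]
    exact .add (hg a) ih

theorem Tens.neg {f : E × G → F} {g : E × G → F} (hg : Tens f g) : Tens f (fun p => - g p) := by
  induction hg with
  | of hh ha => exact .congr (.of hh.fun_neg ha) (.of_forall fun p => by simp)
  | zero => exact .congr .zero (.of_forall fun p => by simp)
  | add ha hb h1 h2 => exact .congr (.add h1 h2) (.of_forall fun p => by simp [add_comm])
  | congr _ h ih =>
    refine .congr ih ?_
    filter_upwards [h] with p hp
    rw [hp]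

/-- if `g = f - t` with `t ∈ Tens f`, then `Mod g ⊆ Mod f`. -/
theorem TMod.of_sub [CompleteSpace F] {f g t : E × G → F} (hf : AnalyticAt ℝ f 0) (ht : Tens f t)
    (h : g =ᶠ[𝓝 0] fun p => f p - t p) {a : E → F} (ha : TMod g a) : TMod f a := by
  refine ha.mono (fun k v => ?_)
  refine .congr (.add (.gen k v) (ht.neg.gen hf k v)) ?_
  have key : (Dv v)^[k] g =ᶠ[𝓝 0]
      fun p => (Dv v)^[k] f p + (Dv v)^[k] (fun p => - t p) p :=
    (DvN_congr h k).trans (by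
      simp only [sub_eq_add_neg]
      exact DvN_add hf (ht.analyticAt hf).fun_neg k)
  exact slice_tendsto.eventually key

theorem Tens.mono {f g : E × G → F} (h : ∀ a, TMod g a → TMod f a) {t : E × G → F} (ht : Tens g t) :
    Tens f t := by
  induction ht with
  | of hh ha => exact .of hh (h _ ha)
  | zero => exact .zero
  | add _ _ h1 h2 => exact .add h1 h2
  | congr _ h ih => exact .congr ih h

/-- images under linear maps -/
theorem TMod.clm [CompleteSpace F] [CompleteSpace F'] {f : E × G → F} (hf : AnalyticAt ℝ f 0)
    (l : F →L[ℝ] F') {a : E → F} (ha : TMod f a) : TMod (fun p => l (f p)) (fun x => l (a x)) := by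
  induction ha with
  | gen k v =>
    refine .congr (.gen k v) ?_
    exact slice_tendsto.eventually (DvN_clm hf l k).symm
  | zero => simpa using TMod.zero
  | add _ _ h1 h2 => simpa using TMod.add h1 h2
  | smul hc _ h => simpa using TMod.smul hc h
  | congr _ h ih =>
    refine .congr ih ?_
    filter_upwards [h] with x hx
    rw [hx]

theorem Tens.clm [CompleteSpace F] [CompleteSpace F'] {f : E × G → F} (hf : AnalyticAt ℝ f 0)
    (l : F →L[ℝ] F') {t : E × G → F} (ht : Tens f t) :
    Tens (fun p => l (f p)) (fun p => l (t p)) := by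
  induction ht with
  | of hh ha => simpa using Tens.of hh (ha.clm hf l)
  | zero => simpa using Tens.zero
  | add _ _ h1 h2 => simpa using Tens.add h1 h2
  | congr _ h ih =>
    refine .congr ih ?_
    filter_upwards [h] with x hx
    rw [hx]

theorem TMod.congr_fun {f g : E × G → F} (h : f =ᶠ[𝓝 0] g) {a : E → F} (ha : TMod f a) :
    TMod g a :=
  ha.mono (fun k v => .congr (.gen k v) (slice_tendsto.eventually (DvN_congr h k)))

/-- explicit form of members of `Tens f` -/
theorem Tens.exists_sum {f : E × G → F} {t : E × G → F} (ht : Tens f t) :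
    ∃ (κ : Type) (_ : Fintype κ) (h : κ → E × G → ℝ) (a : κ → E → F),
      (∀ i, AnalyticAt ℝ (h i) 0) ∧ (∀ i, TMod f (a i)) ∧
      t =ᶠ[𝓝 0] fun p => ∑ i, h i p • a i p.1 := by
  induction ht with
  | @of h a hh ha => exact ⟨Unit, inferInstance, fun _ => h, fun _ => a, fun _ => hh, fun _ => ha,
      .of_forall fun p => by simp⟩
  | zero => exact ⟨Empty, inferInstance, fun i => i.elim, fun i => i.elim, fun i => i.elim,
      fun i => i.elim, .of_forall fun p => by simp⟩
  | add _ _ h1 h2 =>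
    obtain ⟨κ, _, h, a, hh, ha, e⟩ := h1
    obtain ⟨κ', _, h', a', hh', ha', e'⟩ := h2
    refine ⟨κ ⊕ κ', inferInstance, Sum.elim h h', Sum.elim a a', ?_, ?_, ?_⟩
    · rintro (i | i)
      · exact hh i
      · exact hh' i
    · rintro (i | i)
      · exact ha i
      · exact ha' i
    · filter_upwards [e, e'] with p h1 h2
      simp [h1, h2]
  | congr _ h ih =>
    obtain ⟨κ, i, h', a, hh, ha, e⟩ := ih
    exact ⟨κ, i, h', a, hh, ha, h.trans e⟩

end ModTens

set_option linter.unusedSectionVars false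

section Vanish

variable {E G : Type} [NormedAddCommGroup E] [NormedSpace ℝ E] [NormedAddCommGroup G]
  [NormedSpace ℝ G]

theorem vanish_of_DvN {g : E × G → ℝ} (hg : AnalyticAt ℝ g 0)
    (h : ∀ v k, ∀ᶠ x in 𝓝 (0 : E), (Dv v)^[k] g (x, (0 : G)) = 0) : g =ᶠ[𝓝 0] 0 := by
  obtain ⟨r, hr, hball⟩ := Metric.eventually_nhds_iff_ball.1 hg.eventually_analyticAt
  have hD : ∀ (v : G) k x, x ∈ Metric.ball (0 : E) r → (Dv v)^[k] g (x, 0) = 0 := by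
    intro v k
    have han : AnalyticOnNhd ℝ (fun x : E => (Dv v)^[k] g (x, (0 : G))) (Metric.ball 0 r) := by
      intro x hx
      refine AnalyticAt.fun_comp (g := (Dv v)^[k] g) (f := fun x : E => (x, (0 : G))) ?_
        (analyticAt_id.prod analyticAt_const)
      refine DvN_analyticAt (hball _ ?_) k
      simpa [Prod.norm_def] using hx
    exact han.eqOn_zero_of_preconnected_of_eventuallyEq_zero
      (convex_ball (0 : E) r).isPreconnected (Metric.mem_ball_self hr) (h v k)
  refine Metric.eventually_nhds_iff_ball.2 ⟨r, hr, ?_⟩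
  rintro ⟨x, y⟩ hxy
  rw [mem_ball_zero_iff] at hxy
  have hmem : ∀ s ∈ Icc (0 : ℝ) 1, (x, s • y) ∈ Metric.ball (0 : E × G) r := by
    intro s hs
    rw [mem_ball_zero_iff]
    refine lt_of_le_of_lt ?_ hxy
    refine max_le_max le_rfl ?_
    simp only [norm_smul, Real.norm_eq_abs, abs_of_nonneg hs.1]
    exact mul_le_of_le_one_left (norm_nonneg _) hs.2
  have hs_an : ∀ s : ℝ, AnalyticAt ℝ (fun s : ℝ => (x, s • y)) s := fun s =>
    analyticAt_const.prod (analyticAt_id.smul analyticAt_const)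
  have han : AnalyticOnNhd ℝ (fun s : ℝ => g (x, s • y)) (Icc 0 1) := fun s hs =>
    AnalyticAt.fun_comp (g := g) (f := fun s : ℝ => (x, s • y)) (hball _ (hmem s hs)) (hs_an s)
  have hit : ∀ k, ∀ᶠ s in 𝓝 (0 : ℝ), iteratedDeriv k (fun s : ℝ => g (x, s • y)) s
      = (Dv y)^[k] g (x, s • y) := by
    intro k
    induction k with
    | zero => exact .of_forall fun s => by simp
    | succ k ih =>
      have h0 : ∀ᶠ s in 𝓝 (0 : ℝ), AnalyticAt ℝ ((Dv y)^[k] g) (x, s • y) := by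
        have := (DvN_analyticAt (v := y) (hball _ (hmem 0 (by simp))) k).eventually_analyticAt
        exact (hs_an 0).continuousAt.tendsto.eventually this
      filter_upwards [ih.eventually_nhds, h0] with s hs hs0
      rw [iteratedDeriv_succ, Filter.EventuallyEq.deriv_eq hs, Function.iterate_succ_apply']
      have hd : HasDerivAt (fun s : ℝ => (x, s • y)) ((0 : E), y) s := by
        have := (hasDerivAt_id s).smul_const y
        simpa using (hasDerivAt_const s x).prodMk this
      exact (hs0.differentiableAt.hasFDerivAt.comp_hasDerivAt s hd).deriv
  have hz : (fun s : ℝ => g (x, s • y)) =ᶠ[𝓝 0] 0 := by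
    have h0 := han 0 (by simp)
    refine analyticOrderAt_eq_top.1 ?_
    refine ENat.eq_top_iff_forall_ge.2 fun n => ?_
    rw [natCast_le_analyticOrderAt_iff_iteratedDeriv_eq_zero h0]
    intro i _
    rw [(hit i).self_of_nhds, zero_smul]
    refine hD y i x ?_
    rw [mem_ball_zero_iff]
    exact lt_of_le_of_lt (le_max_left _ _) hxy
  have := han.eqOn_zero_of_preconnected_of_eventuallyEq_zero isPreconnected_Icc
    (by simp) hz (x := 1) (by simp)
  simpa using this


/-- a nonzero germ is nonzero along some line -/
theorem exists_direction {b : E → ℝ} (hb : AnalyticAt ℝ b 0) (h : ¬ b =ᶠ[𝓝 0] 0) :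
    ∃ w : E, ¬ ∀ᶠ t in 𝓝 (0 : ℝ), b (t • w) = 0 := by
  by_contra hcon
  push Not at hcon
  apply h
  obtain ⟨r, hr, hball⟩ := Metric.eventually_nhds_iff_ball.1 hb.eventually_analyticAt
  refine Metric.eventually_nhds_iff_ball.2 ⟨r, hr, fun x hx => ?_⟩
  rw [mem_ball_zero_iff] at hx
  have han : AnalyticOnNhd ℝ (fun s : ℝ => b (s • x)) (Icc 0 1) := fun s hs =>
    AnalyticAt.fun_comp (g := b) (f := fun s : ℝ => s • x) (hball _ (by
      rw [mem_ball_zero_iff, norm_smul, Real.norm_eq_abs, abs_of_nonneg hs.1]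
      exact lt_of_le_of_lt (mul_le_of_le_one_left (norm_nonneg _) hs.2) hx))
      (analyticAt_id.smul analyticAt_const)
  have := han.eqOn_zero_of_preconnected_of_eventuallyEq_zero isPreconnected_Icc
    (by simp) (hcon x) (x := 1) (by simp)
  simpa using this

end Vanish

section ClaimB

variable {E G : Type} [NormedAddCommGroup E] [NormedSpace ℝ E] [NormedAddCommGroup G]
  [NormedSpace ℝ G]

theorem Tens.red {F : Type} [NormedAddCommGroup F] [NormedSpace ℝ F] [CompleteSpace F]
    {f g t : E × G → F} (hf : AnalyticAt ℝ f 0) (ht : Tens f t)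
    (h : g =ᶠ[𝓝 0] fun p => f p - t p) (hg : Tens g g) : Tens f f := by
  have h1 : Tens f g := hg.mono (fun a ha => ha.of_sub hf ht h)
  refine .congr (.add h1 ht) ?_
  filter_upwards [h] with p hp
  rw [hp]; abel

theorem Tens.comp_zero {e : ℕ}
    (ih : ∀ g : E × G → (Fin e → ℝ), AnalyticAt ℝ g 0 → Tens g g)
    {f : E × G → (Fin (e + 1) → ℝ)} (hf : AnalyticAt ℝ f 0) (h0 : ∀ᶠ p in 𝓝 0, f p 0 = 0) :
    Tens f f := by
  let tl : (Fin (e + 1) → ℝ) →L[ℝ] (Fin e → ℝ) :=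
    ContinuousLinearMap.pi fun i => ContinuousLinearMap.proj i.succ
  let l : (Fin e → ℝ) →L[ℝ] (Fin (e + 1) → ℝ) :=
    ContinuousLinearMap.pi (Fin.cons 0 fun i => ContinuousLinearMap.proj i)
  have hg : AnalyticAt ℝ (fun p => tl (f p)) 0 := (tl.analyticAt _).fun_comp hf
  have h1 := (ih _ hg).clm hg l
  have he : (fun p => l (tl (f p))) =ᶠ[𝓝 0] f := by
    filter_upwards [h0] with p hp
    funext i
    refine Fin.cases ?_ (fun i => ?_) i
    · simp [l, hp]
    · simp [l, tl]
  exact .congr (h1.mono fun a ha => ha.congr_fun he) he.symm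

theorem TMod.lift {E' : Type} [NormedAddCommGroup E'] [NormedSpace ℝ E'] {d e : ℕ}
    {r : E' × G → (Fin d → ℝ)} (hr : AnalyticAt ℝ r 0) {f : E × G → (Fin (e + 1) → ℝ)}
    (hf : AnalyticAt ℝ f 0) (σ : E →L[ℝ] E') (ψ : E →L[ℝ] ℝ)
    (h : ∀ᶠ p : E × G in 𝓝 0, f p 0 = ∑ l : Fin d, r (σ p.1, p.2) l * ψ p.1 ^ (l : ℕ))
    {c : E' → (Fin d → ℝ)} (hc : TMod r c) :
    ∃ B, TMod f B ∧ ∀ᶠ x in 𝓝 0, B x 0 = ∑ l : Fin d, c (σ x) l * ψ x ^ (l : ℕ) := by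
  have hσ : Filter.Tendsto (fun x : E => σ x) (𝓝 0) (𝓝 0) := by
    simpa using σ.continuous.tendsto 0
  have hψ : AnalyticAt ℝ (fun x => ψ x) 0 := ψ.analyticAt 0
  induction hc with
  | gen k v =>
    refine ⟨_, .gen k v, ?_⟩
    have hrl : ∀ l, AnalyticAt ℝ (fun p => r p l) 0 := fun l =>
      ((ContinuousLinearMap.proj (R := ℝ) (φ := fun _ : Fin d => ℝ) l).analyticAt _).fun_comp hr
    have hrl' : ∀ l, AnalyticAt ℝ (fun p => r p l) (σ (0 : E × G).1, (0 : E × G).2) := fun l => by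
      have e0 : (σ (0 : E × G).1, (0 : E × G).2) = 0 := by simp
      rw [e0]; exact hrl l
    have hrσ : ∀ l, AnalyticAt ℝ (fun p : E × G => r (σ p.1, p.2) l) 0 := fun l =>
      AnalyticAt.fun_comp (g := fun p => r p l) (f := fun p : E × G => (σ p.1, p.2)) (hrl' l)
        (((σ.analyticAt _).fun_comp analyticAt_fst).prod analyticAt_snd)
    have hψl : ∀ l : Fin d, AnalyticAt ℝ (fun x => ψ x ^ (l : ℕ)) 0 := fun l => hψ.fun_pow _
    have e1 := (DvN_clm (v := v) hf
      (ContinuousLinearMap.proj (R := ℝ) (φ := fun _ : Fin (e + 1) => ℝ) 0) k).symm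
    have e2 := DvN_congr (v := v) (f := fun p => f p 0) (g := fun p : E × G =>
      ∑ l : Fin d, r (σ p.1, p.2) l • ψ p.1 ^ (l : ℕ)) (p := 0) h k
    have e3 := DvN_sum (v := v) Finset.univ
      (f := fun l (p : E × G) => r (σ p.1, p.2) l • ψ p.1 ^ (l : ℕ)) (p := 0)
      (fun l => (hrσ l).fun_smul (fst_analyticAt (hψl l))) k
    have e4 := fun l : Fin d => DvN_smul (v := v) (h := fun p : E × G => r (σ p.1, p.2) l)
      (b := fun x => ψ x ^ (l : ℕ)) (p := 0) (hrσ l) (hψl l) k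
    have e5 := fun l : Fin d => DvN_base (v := v) (f := fun p => r p l) σ (p := 0) (hrl' l) k
    have e6 : ∀ l : Fin d, (Dv v)^[k] (fun p => r p l) =ᶠ[𝓝 0] fun p => (Dv v)^[k] r p l := fun l =>
      DvN_clm (v := v) hr (ContinuousLinearMap.proj (R := ℝ) (φ := fun _ : Fin d => ℝ) l) k
    have e6' : ∀ l : Fin d, ∀ᶠ x : E in 𝓝 0,
        (Dv v)^[k] (fun p => r p l) (σ x, 0) = (Dv v)^[k] r (σ x, 0) l := fun l =>
      hσ.eventually (slice_tendsto.eventually (e6 l))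
    filter_upwards [slice_tendsto.eventually e1, slice_tendsto.eventually e2,
      slice_tendsto.eventually e3, Filter.eventually_all.2 fun l => slice_tendsto.eventually (e4 l),
      Filter.eventually_all.2 fun l => slice_tendsto.eventually (e5 l),
      Filter.eventually_all.2 e6'] with x h1 h2 h3 h4 h5 h6
    refine h1.trans (h2.trans (h3.trans ?_))
    refine Finset.sum_congr rfl fun l _ => ?_
    rw [h4 l, h5 l, h6 l]; rfl
  | zero => exact ⟨_, .zero, .of_forall fun x => by simp⟩
  | add _ _ h1 h2 =>
    obtain ⟨B, hB, e⟩ := h1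
    obtain ⟨B', hB', e'⟩ := h2
    refine ⟨_, .add hB hB', ?_⟩
    filter_upwards [e, e'] with x h1 h2
    simp [h1, h2, add_mul, Finset.sum_add_distrib]
  | @smul c a hc _ h1 =>
    obtain ⟨B, hB, e⟩ := h1
    refine ⟨_, .smul (c := fun x => c (σ x)) ?_ hB, ?_⟩
    · exact AnalyticAt.fun_comp (g := c) (f := fun x => σ x) (by simpa using hc) (σ.analyticAt 0)
    · filter_upwards [e] with x h1
      simp [h1, Finset.mul_sum, mul_assoc]
  | congr _ h1 ih =>
    obtain ⟨B, hB, e⟩ := ih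
    refine ⟨B, hB, ?_⟩
    filter_upwards [e, hσ.eventually h1] with x h2 h3
    rw [h2, h3]

theorem Tens.self [FiniteDimensional ℝ G] (n : ℕ) : ∀ (E : Type) [NormedAddCommGroup E] [NormedSpace ℝ E]
    [FiniteDimensional ℝ E], Module.finrank ℝ E = n → ∀ (e : ℕ) (f : E × G → (Fin e → ℝ)),
    AnalyticAt ℝ f 0 → Tens f f := by
  induction n using Nat.strong_induction_on with
  | _ n IH =>
  intro E _ _ _ hE e
  induction e with
  | zero =>
    intro f hf
    refine .congr .zero (.of_forall fun p => ?_)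
    funext i; exact i.elim0
  | succ e ih =>
    intro f hf
    have hf0 : AnalyticAt ℝ (fun p => f p 0) 0 :=
      ((ContinuousLinearMap.proj (R := ℝ) (φ := fun _ : Fin (e + 1) => ℝ) 0).analyticAt _).fun_comp hf
    by_cases hz : ∀ᶠ p in 𝓝 0, f p 0 = 0
    · exact Tens.comp_zero ih hf hz
    obtain ⟨b, hb, hb0⟩ : ∃ b, TMod f b ∧ ¬ (fun x => b x 0) =ᶠ[𝓝 0] 0 := by
      by_contra hcon
      push Not at hcon
      refine hz (vanish_of_DvN hf0 fun v k => ?_)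
      filter_upwards [hcon _ (.gen k v), slice_tendsto.eventually (DvN_clm (v := v) hf
        (ContinuousLinearMap.proj (R := ℝ) (φ := fun _ : Fin (e + 1) => ℝ) 0) k)] with x h1 h2
      exact h2.trans h1
    have hba := hb.analyticAt hf
    have hb0a : AnalyticAt ℝ (fun x => b x 0) 0 :=
      ((ContinuousLinearMap.proj (R := ℝ) (φ := fun _ : Fin (e + 1) => ℝ) 0).analyticAt _).fun_comp hba
    by_cases hb00 : b 0 0 = 0
    swap
    · have hq : AnalyticAt ℝ (fun p : E × G => f p 0 / b p.1 0) 0 :=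
        hf0.fun_div (fst_analyticAt hb0a) hb00
      have ht : Tens f (fun p => (f p 0 / b p.1 0) • b p.1) := .of hq hb
      refine Tens.red hf ht .rfl (Tens.comp_zero ih (hf.fun_sub (ht.analyticAt hf)) ?_)
      have hne := eventually_fst (p := (0 : E × G)) (hb0a.continuousAt.eventually_ne hb00)
      filter_upwards [hne] with p hp
      simp [div_mul_cancel₀ _ hp]
    obtain ⟨w, hw⟩ := exists_direction hb0a hb0
    have hw0 : w ≠ 0 := by
      rintro rfl
      exact hw (.of_forall fun t => by simpa using hb00)
    obtain ⟨ψ, hψ⟩ := SeparatingDual.exists_eq_one (R := ℝ) hw0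
    let E' := LinearMap.ker (ψ : E →ₗ[ℝ] ℝ)
    have hE' : Module.finrank ℝ E' < n := by
      rw [← hE]
      refine Submodule.finrank_lt fun h => ?_
      have : w ∈ E' := h ▸ Submodule.mem_top
      rw [LinearMap.mem_ker] at this
      change ψ w = 0 at this
      rw [hψ] at this
      exact one_ne_zero this
    let σ : E →L[ℝ] E' := (ContinuousLinearMap.id ℝ E - ψ.smulRight w).codRestrict E' (fun x => by
      rw [LinearMap.mem_ker]
      simp [hψ])
    let Ψ : (E' × G) × ℝ →L[ℝ] E × G :=
      ((E'.subtypeL.comp ((ContinuousLinearMap.fst ℝ E' G).comp (ContinuousLinearMap.fst ℝ (E' × G) ℝ)))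
        + (ContinuousLinearMap.snd ℝ (E' × G) ℝ).smulRight w).prod
      ((ContinuousLinearMap.snd ℝ E' G).comp (ContinuousLinearMap.fst ℝ (E' × G) ℝ))
    let Φ : E × G →L[ℝ] (E' × G) × ℝ :=
      ((σ.comp (ContinuousLinearMap.fst ℝ E G)).prod (ContinuousLinearMap.snd ℝ E G)).prod
        (ψ.comp (ContinuousLinearMap.fst ℝ E G))
    have hΦ : ∀ p, Φ p = ((σ p.1, p.2), ψ p.1) := fun p => rfl
    have hΨΦ : ∀ p, Ψ (Φ p) = p := fun p => by
      ext <;> simp [Ψ, Φ, σ]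
    have hg : AnalyticAt ℝ (fun p => b (Ψ p).1 0) 0 :=
      AnalyticAt.fun_comp (g := fun q : E × G => b q.1 0) (f := fun p => Ψ p)
        (by simpa using fst_analyticAt hb0a) (Ψ.analyticAt 0)
    have hfΨ : AnalyticAt ℝ (fun p => f (Ψ p) 0) 0 :=
      AnalyticAt.fun_comp (g := fun q : E × G => f q 0) (f := fun p => Ψ p)
        (by simpa using hf0) (Ψ.analyticAt 0)
    obtain ⟨d, _, hdiv⟩ := weierstrass_division (fun p => b (Ψ p).1 0) hg (by simpa [Ψ] using hw)
    obtain ⟨q, r, hq, hr, hqr⟩ := hdiv _ hfΨ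
    have hΦt : Filter.Tendsto (fun p => Φ p) (𝓝 0) (𝓝 0) := by
      simpa using Φ.continuous.tendsto 0
    have hQ : AnalyticAt ℝ (fun p => q (Φ p)) 0 :=
      AnalyticAt.fun_comp (g := q) (f := fun p => Φ p) (by simpa using hq) (Φ.analyticAt 0)
    have ht1 : Tens f (fun p => q (Φ p) • b p.1) := .of hQ hb
    have hf' : AnalyticAt ℝ (fun p => f p - q (Φ p) • b p.1) 0 := hf.fun_sub (ht1.analyticAt hf)
    refine Tens.red hf ht1 .rfl ?_
    set f' : E × G → Fin (e + 1) → ℝ := fun p => f p - q (Φ p) • b p.1 with hf'def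
    let R : E' × G → (Fin d → ℝ) := fun p l => r l p
    have hR : AnalyticAt ℝ R 0 := AnalyticAt.pi hr
    have hf'0 : ∀ᶠ p : E × G in 𝓝 0, f' p 0 = ∑ l : Fin d, R (σ p.1, p.2) l * ψ p.1 ^ (l : ℕ) := by
      filter_upwards [hΦt.eventually hqr] with p hp
      rw [hΨΦ] at hp
      simp only [hf'def, Pi.sub_apply, Pi.smul_apply, smul_eq_mul, hp, R, hΦ]
      ring
    obtain ⟨κ, _, h, a, hh, ha, hsum⟩ := (IH _ hE' E' rfl d R hR).exists_sum
    choose B hB hB0 using fun k => TMod.lift hR hf' σ ψ hf'0 (ha k)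
    let σG : E × G →L[ℝ] E' × G :=
      (σ.comp (ContinuousLinearMap.fst ℝ E G)).prod (ContinuousLinearMap.snd ℝ E G)
    have hσG : ∀ p, σG p = (σ p.1, p.2) := fun p => rfl
    have hσGt : Filter.Tendsto (fun p => σG p) (𝓝 0) (𝓝 0) := by
      simpa using σG.continuous.tendsto 0
    have hH : ∀ k, AnalyticAt ℝ (fun p => h k (σG p)) 0 := fun k =>
      AnalyticAt.fun_comp (g := h k) (f := fun p => σG p) (by simpa using hh k) (σG.analyticAt 0)
    have ht2 : Tens f' (fun p => ∑ k, h k (σG p) • B k p.1) :=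
      Tens.sum _ fun k => .of (hH k) (hB k)
    refine Tens.red hf' ht2 .rfl (Tens.comp_zero ih (hf'.fun_sub (ht2.analyticAt hf')) ?_)
    have hB0' : ∀ᶠ p : E × G in 𝓝 0, ∀ k, B k p.1 0 = ∑ l : Fin d, a k (σ p.1) l * ψ p.1 ^ (l : ℕ) :=
      Filter.eventually_all.2 fun k => eventually_fst (p := (0 : E × G)) (hB0 k)
    filter_upwards [hf'0, hB0', hσGt.eventually hsum] with p h1 h2 h3
    rw [hσG] at h3
    simp only [Pi.sub_apply, h1, h3, Finset.sum_apply, Pi.smul_apply, smul_eq_mul, h2, hσG]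
    simp only [Finset.mul_sum, Finset.sum_mul]
    rw [Finset.sum_comm, sub_eq_zero]
    refine Finset.sum_congr rfl fun _ _ => Finset.sum_congr rfl fun _ _ => by ring

end ClaimB

section LemmaA

variable {E G : Type} [NormedAddCommGroup E] [NormedSpace ℝ E] [NormedAddCommGroup G]
  [NormedSpace ℝ G]

theorem TMod.nakayama {f : E × G → ℝ} {κ : Type} [Fintype κ] {h : κ → E × G → ℝ} {h' : E × G → ℝ}
    {a : κ → E → ℝ} {a' : E → ℝ} (hh : ∀ k, AnalyticAt ℝ (h k) 0) (hh' : AnalyticAt ℝ h' 0)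
    (ha : ∀ k, AnalyticAt ℝ (a k) 0) (ha' : AnalyticAt ℝ a' 0)
    (h0 : ∀ᶠ y in 𝓝 (0 : G), h' (0, y) = 0)
    (hf : f =ᶠ[𝓝 0] fun p => ∑ k, h k p • a k p.1 + h' p • a' p.1) {b : E → ℝ} (hb : TMod f b) :
    ∃ (α : κ → E → ℝ) (β : E → ℝ), (∀ k, AnalyticAt ℝ (α k) 0) ∧ AnalyticAt ℝ β 0 ∧ β 0 = 0 ∧
      ∀ᶠ x in 𝓝 0, b x = ∑ k, α k x * a k x + β x * a' x := by
  induction hb with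
  | gen k v =>
    refine ⟨fun i x => (Dv v)^[k] (h i) (x, 0), fun x => (Dv v)^[k] h' (x, 0),
      fun i => slice_analyticAt (DvN_analyticAt (hh i) k), slice_analyticAt (DvN_analyticAt hh' k),
      (DvN_fibre hh' h0 k).self_of_nhds, ?_⟩
    have hs : ∀ i, AnalyticAt ℝ (fun p : E × G => h i p • a i p.1) 0 := fun i =>
      (hh i).fun_smul (fst_analyticAt (ha i))
    have e1 := DvN_congr (v := v) hf k
    have e2 := DvN_add (v := v) (p := 0) (f := fun p : E × G => ∑ k, h k p • a k p.1)
      (g := fun p : E × G => h' p • a' p.1)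
      (Finset.analyticAt_fun_sum _ fun i _ => hs i) (hh'.fun_smul (fst_analyticAt ha')) k
    have e3 := DvN_sum (v := v) (p := 0) Finset.univ (f := fun i (p : E × G) => h i p • a i p.1) hs k
    have e4 := fun i => DvN_smul (v := v) (p := 0) (hh i) (ha i) k
    have e5 := DvN_smul (v := v) (p := 0) hh' ha' k
    filter_upwards [slice_tendsto.eventually e1, slice_tendsto.eventually e2,
      slice_tendsto.eventually e3, Filter.eventually_all.2 fun i => slice_tendsto.eventually (e4 i),
      slice_tendsto.eventually e5] with x h1 h2 h3 h4 h5
    rw [h1, h2, h3, h5]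
    simp only [h4]
    simp only [smul_eq_mul]
  | zero => exact ⟨fun _ _ => 0, fun _ => 0, fun _ => analyticAt_const, analyticAt_const, rfl,
      .of_forall fun x => by simp⟩
  | add _ _ h1 h2 =>
    obtain ⟨α, β, hα, hβ, hβ0, e⟩ := h1
    obtain ⟨α', β', hα', hβ', hβ0', e'⟩ := h2
    refine ⟨fun k x => α k x + α' k x, fun x => β x + β' x, fun k => (hα k).fun_add (hα' k),
      hβ.fun_add hβ', by simp [hβ0, hβ0'], ?_⟩
    filter_upwards [e, e'] with x h1 h2
    rw [h1, h2]
    simp only [add_mul, Finset.sum_add_distrib]; ring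
  | @smul c a hc _ h1 =>
    obtain ⟨α, β, hα, hβ, hβ0, e⟩ := h1
    refine ⟨fun k x => c x * α k x, fun x => c x * β x, fun k => hc.fun_mul (hα k),
      hc.fun_mul hβ, by simp [hβ0], ?_⟩
    filter_upwards [e] with x h1
    rw [h1]
    simp only [smul_eq_mul, mul_add, Finset.mul_sum, mul_assoc]
  | congr _ h1 ih =>
    obtain ⟨α, β, hα, hβ, hβ0, e⟩ := ih
    exact ⟨α, β, hα, hβ, hβ0, by filter_upwards [e, h1] with x h2 h3; rw [h3, h2]⟩

/-- Every analytic germ is a combination of germs which are independent on the central fibre. -/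
theorem lemmaA [FiniteDimensional ℝ E] [FiniteDimensional ℝ G] {f : E × G → ℝ}
    (hf : AnalyticAt ℝ f 0) :
    ∃ (κ : Type) (_ : Fintype κ) (h : κ → E × G → ℝ) (a : κ → E → ℝ),
      (∀ k, AnalyticAt ℝ (h k) 0) ∧ (∀ k, AnalyticAt ℝ (a k) 0) ∧
      (∀ᶠ p in 𝓝 0, f p = ∑ k, h k p * a k p.1) ∧
      ∀ c : κ → ℝ, (∀ᶠ y in 𝓝 (0 : G), ∑ k, c k * h k (0, y) = 0) → c = 0 := by
  classical
  let Q : ℕ → Prop := fun n => ∃ (κ : Type) (_ : Fintype κ) (h : κ → E × G → ℝ) (a : κ → E → ℝ),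
      Fintype.card κ = n ∧
      (∀ i, AnalyticAt ℝ (h i) 0) ∧ (∀ i, TMod f (a i)) ∧
      f =ᶠ[𝓝 0] fun p => ∑ i, h i p • a i p.1
  have hQ : ∃ n, Q n := by
    have hf1 : AnalyticAt ℝ (fun p (_ : Fin 1) => f p) 0 := AnalyticAt.pi fun _ => hf
    have h1 := (Tens.self _ E rfl 1 _ hf1).clm hf1
      (ContinuousLinearMap.proj (R := ℝ) (φ := fun _ : Fin 1 => ℝ) 0)
    obtain ⟨κ, i, h, a, hh, ha, e⟩ := h1.exists_sum
    exact ⟨_, κ, i, h, a, rfl, hh, ha, e⟩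
  obtain ⟨κ, _, h, a, hcard, hh, ha, e⟩ := Nat.find_spec hQ
  have hmin := fun m => Nat.find_min hQ (m := m)
  refine ⟨κ, inferInstance, h, a, hh, fun k => (ha k).analyticAt hf, e, fun c hc => ?_⟩
  funext j
  by_contra hj
  rw [Pi.zero_apply] at hj
  let γ : {k // k ≠ j} → ℝ := fun k => - c k / c j
  let h' : E × G → ℝ := fun p => h j p - ∑ k : {k // k ≠ j}, γ k * h k p
  have hh' : AnalyticAt ℝ h' 0 := (hh j).fun_sub
    (Finset.analyticAt_fun_sum _ fun k _ => analyticAt_const.fun_mul (hh k))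
  have h0 : ∀ᶠ y in 𝓝 (0 : G), h' (0, y) = 0 := by
    filter_upwards [hc] with y hy
    rw [Fintype.sum_eq_add_sum_subtype_ne _ j] at hy
    simp only [h', γ, neg_div, neg_mul, Finset.sum_neg_distrib, sub_neg_eq_add, div_mul_eq_mul_div]
    rw [← Finset.sum_div]
    field_simp
    linarith
  let a' : {k // k ≠ j} → E → ℝ := fun k x => a k x + γ k * a j x
  have ha' : ∀ k, TMod f (a' k) := fun k => .add (ha k) (.smul (c := fun _ => γ k) analyticAt_const (ha j))
  have e' : f =ᶠ[𝓝 0] fun p => ∑ k : {k // k ≠ j}, h k p • a' k p.1 + h' p • a j p.1 := by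
    filter_upwards [e] with p hp
    rw [hp, Fintype.sum_eq_add_sum_subtype_ne _ j]
    simp only [a', h', smul_eq_mul, mul_add, Finset.sum_add_distrib, sub_mul, Finset.sum_mul]
    have : ∀ k : {k // k ≠ j}, h k p * (γ k * a j p.1) = γ k * h k p * a j p.1 := fun k => by ring
    simp only [this]
    ring
  obtain ⟨α, β, hα, hβ, hβ0, eb⟩ := (ha j).nakayama (fun k : {k // k ≠ j} => hh k) hh'
    (fun k => (ha' k).analyticAt hf) ((ha j).analyticAt hf) h0 e'
  have hβ1 : (1 - β 0) ≠ 0 := by simp [hβ0]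
  have hβa : AnalyticAt ℝ (fun x => 1 - β x) 0 := analyticAt_const.fun_sub hβ
  refine hmin (Fintype.card {k // k ≠ j}) ?_ ⟨{k // k ≠ j}, inferInstance,
    fun k p => h k p + h' p * (α k p.1 / (1 - β p.1)), a', rfl, fun k => ?_, ha', ?_⟩
  · rw [← hcard]
    exact Fintype.card_subtype_lt (x := j) (by simp)
  · exact (hh k).fun_add (hh'.fun_mul (fst_analyticAt ((hα k).fun_div hβa hβ1)))
  · have ene := eventually_fst (p := (0 : E × G)) (hβa.continuousAt.eventually_ne hβ1)
    filter_upwards [e', eventually_fst (p := (0 : E × G)) eb, ene] with p h1 h2 h3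
    rw [h1]
    have h4 : a j p.1 = ∑ k, α k p.1 / (1 - β p.1) * a' k p.1 := by
      simp only [div_mul_eq_mul_div]
      rw [← Finset.sum_div]
      field_simp
      linarith
    rw [h4]
    simp only [smul_eq_mul, add_mul, Finset.sum_add_distrib, Finset.mul_sum, mul_assoc]

end LemmaA

section Tarski

open Polynomial

/-- integer valued sign -/
noncomputable def sg (x : ℝ) : ℤ := (SignType.sign x : ℤ)

theorem sg_mul (x y : ℝ) : sg (x * y) = sg x * sg y := by
  simp [sg, sign_mul]

theorem sg_zero : sg 0 = 0 := by simp [sg]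

theorem sg_pos {x : ℝ} (h : 0 < x) : sg x = 1 := by simp [sg, sign_pos h]

theorem sg_neg {x : ℝ} (h : x < 0) : sg x = -1 := by simp [sg, sign_neg h]

theorem sg_one : sg 1 = 1 := sg_pos one_pos

theorem sg_pow (x : ℝ) (n : ℕ) : sg (x ^ n) = sg x ^ n := by
  induction n with
  | zero => simp [sg_one]
  | succ n ih => rw [pow_succ, sg_mul, ih, pow_succ]

theorem sg_mul_self {x : ℝ} (h : x ≠ 0) : sg x * sg x = 1 := by
  rcases lt_or_gt_of_ne h with h | h
  · simp [sg_neg h]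
  · simp [sg_pos h]

theorem sg_opp (x : ℝ) : sg (-x) = - sg x := by
  rw [← neg_one_mul, sg_mul, sg_neg (by norm_num : (-1 : ℝ) < 0)]; ring

/-- sign on the right of a point -/
noncomputable def sp (h : ℝ[X]) (z : ℝ) : ℤ := sg (eval z (h /ₘ (X - C z) ^ rootMultiplicity z h))

theorem loc_eq {h k : ℝ[X]} {z : ℝ} {m : ℕ} (e : h = (X - C z) ^ m * k) (hk : eval z k ≠ 0) :
    rootMultiplicity z h = m ∧ sp h z = sg (eval z k) := by
  have hk0 : k ≠ 0 := by rintro rfl; simp at hk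
  have hm : rootMultiplicity z h = m := by
    rw [e, mul_comm, rootMultiplicity_mul_X_sub_C_pow hk0, rootMultiplicity_eq_zero hk, zero_add]
  refine ⟨hm, ?_⟩
  rw [sp, hm, e, mul_divByMonic_cancel_left _ ((monic_X_sub_C z).pow m)]

theorem exists_loc {h : ℝ[X]} (hh : h ≠ 0) (z : ℝ) :
    ∃ k, h = (X - C z) ^ rootMultiplicity z h * k ∧ eval z k ≠ 0 ∧ sp h z = sg (eval z k) :=
  ⟨_, (pow_mul_divByMonic_rootMultiplicity_eq h z).symm,
    eval_divByMonic_pow_rootMultiplicity_ne_zero z hh, rfl⟩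

theorem sp_mul {f g : ℝ[X]} (hf : f ≠ 0) (hg : g ≠ 0) (z : ℝ) :
    sp (f * g) z = sp f z * sp g z := by
  obtain ⟨k, e, hk, s⟩ := exists_loc hf z
  obtain ⟨l, e', hl, s'⟩ := exists_loc hg z
  have := (loc_eq (h := f * g) (k := k * l) (z := z)
    (m := rootMultiplicity z f + rootMultiplicity z g) (by
      conv_lhs => rw [e, e']
      ring) (by simp [hk, hl])).2
  rw [this, s, s', eval_mul, sg_mul]

/-- the sign at the far right -/
theorem sg_eq_lead {k : ℝ[X]} {z : ℝ} (hk : eval z k ≠ 0) (hz : ∀ w, z < w → eval w k ≠ 0) :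
    sg (eval z k) = sg k.leadingCoeff := by
  have key : ∀ k : ℝ[X], eval z k ≠ 0 → (∀ w, z < w → eval w k ≠ 0) → 0 < k.leadingCoeff →
      0 < eval z k := by
    intro k hk hz hl
    have hev : ∃ x, z < x ∧ 0 < eval x k := by
      by_cases hd : 0 < k.degree
      · have := tendsto_atTop_of_leadingCoeff_nonneg k hd hl.le
        obtain ⟨x, hx⟩ := ((this.eventually_gt_atTop 0).and (Filter.eventually_gt_atTop z)).exists
        exact ⟨x, hx.2, hx.1⟩
      · have := eq_C_of_degree_le_zero (not_lt.1 hd)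
        refine ⟨z + 1, by linarith, ?_⟩
        rw [this] at hl ⊢
        simpa using hl
    obtain ⟨x, hzx, hx⟩ := hev
    by_contra hneg
    have hneg' : eval z k < 0 := lt_of_le_of_ne (not_lt.1 hneg) hk
    have := intermediate_value_Ioo hzx.le (k.continuous.continuousOn (s := Icc z x))
    obtain ⟨w, hw, hw0⟩ := this ⟨hneg', hx⟩
    exact hz w hw.1 hw0
  have hk0 : k ≠ 0 := by rintro rfl; simp at hk
  rcases lt_or_gt_of_ne (leadingCoeff_ne_zero.2 hk0) with h | h
  · have := key (-k) (by simpa using hk) (by simpa using hz) (by simpa using h)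
    rw [eval_neg] at this
    rw [sg_neg h, sg_neg (by linarith)]
  · rw [sg_pos h, sg_pos (key k hk hz h)]

/-- twice the jump of the sign between the ends -/
noncomputable def ends (h : ℝ[X]) : ℤ := sg h.leadingCoeff * (1 - (-1) ^ h.natDegree)

theorem jump_sum (h : ℝ[X]) (hh : h ≠ 0) :
    2 * ∑ z ∈ h.roots.toFinset, (if Odd (rootMultiplicity z h) then sp h z else 0) = ends h := by
  induction hn : h.natDegree using Nat.strong_induction_on generalizing h with
  | _ n ih =>
  by_cases hr : h.roots.toFinset.Nonempty
  swap
  · rw [Finset.not_nonempty_iff_eq_empty] at hr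
    have hno : ∀ w, eval w h ≠ 0 := fun w hw => by
      have : w ∈ h.roots.toFinset := by simpa [hh] using hw
      rw [hr] at this; simp at this
    rw [hr, Finset.sum_empty, mul_zero]
    have h1 := sg_eq_lead (hno 0) (fun w _ => hno w)
    have h2 := sg_eq_lead (k := h.comp (-X)) (z := 0) (by simpa using hno 0)
      (fun w _ => by simpa using hno (-w))
    have hlc : (h.comp (-X)).leadingCoeff = h.leadingCoeff * (-1) ^ h.natDegree := by
      rw [leadingCoeff_comp (by simp)]; simp
    rw [hlc, sg_mul, sg_pow, sg_neg (by norm_num : (-1 : ℝ) < 0)] at h2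
    simp only [eval_comp, eval_neg, eval_X, neg_zero] at h2
    rw [ends]
    rw [h1] at h2
    linear_combination -h2
  · let z := h.roots.toFinset.max' hr
    have hz : z ∈ h.roots.toFinset := Finset.max'_mem _ hr
    have hzr : eval z h = 0 := by simpa [hh] using hz
    have hmax : ∀ w, eval w h = 0 → w ≤ z := fun w hw =>
      Finset.le_max' _ _ (by simpa [hh] using hw)
    obtain ⟨k, e, hk, s⟩ := exists_loc hh z
    set m := rootMultiplicity z h with hm
    have hmpos : 0 < m := (rootMultiplicity_pos hh).2 hzr
    have hk0 : k ≠ 0 := by rintro rfl; simp at hk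
    have hXm : ((X - C z) ^ m : ℝ[X]) ≠ 0 := pow_ne_zero _ (X_sub_C_ne_zero z)
    have hdeg : h.natDegree = m + k.natDegree := by
      rw [e, natDegree_mul hXm hk0, natDegree_pow, natDegree_X_sub_C, mul_one]
    have hlead : h.leadingCoeff = k.leadingCoeff := by
      rw [e, leadingCoeff_mul, leadingCoeff_pow, leadingCoeff_X_sub_C, one_pow, one_mul]
    have hkz : ∀ w, z < w → eval w k ≠ 0 := fun w hw h0 => by
      have : eval w h = 0 := by rw [e, eval_mul, h0, mul_zero]
      exact absurd (hmax w this) (not_le.2 hw)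
    have hroots : h.roots.toFinset = insert z k.roots.toFinset := by
      ext w
      simp only [Multiset.mem_toFinset, mem_roots hh, mem_roots hk0, Finset.mem_insert, IsRoot]
      conv_lhs => rw [e]
      simp [sub_eq_zero, hmpos.ne']
    have hznot : z ∉ k.roots.toFinset := by simpa [hk0] using hk
    have hIH := ih k.natDegree (by omega) k hk0 rfl
    rw [hroots, Finset.sum_insert hznot]
    have hterm : ∀ w ∈ k.roots.toFinset, (if Odd (rootMultiplicity w h) then sp h w else 0)
        = (-1) ^ m * (if Odd (rootMultiplicity w k) then sp k w else 0) := by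
      intro w hw
      have hw0 : eval w k = 0 := by simpa [hk0] using hw
      have hwz : w < z := by
        refine lt_of_le_of_ne (hmax w (by rw [e, eval_mul, hw0, mul_zero])) ?_
        rintro rfl
        exact hk hw0
      obtain ⟨l, e', hl, s'⟩ := exists_loc hk0 w
      have := loc_eq (h := h) (k := (X - C z) ^ m * l) (z := w) (m := rootMultiplicity w k) (by
        rw [e]
        conv_lhs => rw [e']
        ring) (by
          simp only [eval_mul, eval_pow, eval_sub, eval_X, eval_C]
          exact mul_ne_zero (pow_ne_zero _ (by linarith)) hl)
      rw [this.1, this.2, s']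
      simp only [eval_mul, eval_pow, eval_sub, eval_X, eval_C, sg_mul, sg_pow,
        sg_neg (sub_neg.2 hwz)]
      split_ifs <;> simp
    rw [Finset.sum_congr rfl hterm, ← Finset.mul_sum, s, sg_eq_lead hk hkz]
    rw [mul_add, mul_left_comm, hIH, ends, ends, hlead, hdeg, pow_add]
    rcases Nat.even_or_odd m with hm' | hm'
    · rw [if_neg (Nat.not_odd_iff_even.2 hm'), hm'.neg_one_pow]; ring
    · rw [if_pos hm', hm'.neg_one_pow]; ring

/-- Cauchy index of `g / f` -/
noncomputable def Ind (g f : ℝ[X]) : ℤ := by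
  classical
  exact ∑ z ∈ f.roots.toFinset,
    (if ¬ (X - C z) ^ rootMultiplicity z f ∣ g ∧ Odd (rootMultiplicity z f + rootMultiplicity z g)
      then sp f z * sp g z else 0)

theorem Ind_recip {f g : ℝ[X]} (hf : f ≠ 0) (hg : g ≠ 0) :
    2 * (Ind g f + Ind f g) = ends (f * g) := by
  classical
  have hfg := mul_ne_zero hf hg
  rw [← jump_sum _ hfg]
  congr 1
  have key : ∀ f g : ℝ[X], f ≠ 0 → g ≠ 0 → Ind g f = ∑ z ∈ (f * g).roots.toFinset,
    (if ¬ (X - C z) ^ rootMultiplicity z f ∣ g ∧ Odd (rootMultiplicity z f + rootMultiplicity z g)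
      then sp f z * sp g z else 0) := by
    intro f g hf hg
    rw [Ind]
    refine Finset.sum_subset ?_ ?_
    · intro z hz
      have : eval z f = 0 := by simpa [hf] using hz
      simp [hf, hg, this]
    · intro z _ hz
      have h0 : ¬ IsRoot f z := by simpa [hf] using hz
      simp [rootMultiplicity_eq_zero h0]
  rw [key f g hf hg, key g f hg hf, mul_comm g f, ← Finset.sum_add_distrib]
  refine Finset.sum_congr rfl fun z _ => ?_
  rw [rootMultiplicity_mul hfg, sp_mul hf hg, ← le_rootMultiplicity_iff hg,
    ← le_rootMultiplicity_iff hf, add_comm (rootMultiplicity z g), mul_comm (sp g z)]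
  by_cases ho : Odd (rootMultiplicity z f + rootMultiplicity z g)
  · have hne : rootMultiplicity z f ≠ rootMultiplicity z g := by
      intro h; rw [h] at ho
      exact Nat.not_odd_iff_even.2 ⟨_, rfl⟩ ho
    rcases lt_or_gt_of_ne hne with h | h
    · simp [ho, h, h.le]
    · simp [ho, h, h.le]
  · simp [ho]

theorem Ind_congr {f g q : ℝ[X]} (hf : f ≠ 0) {c : ℝ} (hc : 0 < c) :
    Ind (C c * g + q * f) f = Ind g f := by
  classical
  rw [Ind, Ind]
  refine Finset.sum_congr rfl fun z hz => ?_
  obtain ⟨v, e, hv, s⟩ := exists_loc hf z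
  set m := rootMultiplicity z f with hm
  have hu : IsUnit (C c : ℝ[X]) := isUnit_C.2 (isUnit_iff_ne_zero.2 hc.ne')
  have hdvd : (X - C z) ^ m ∣ C c * g + q * f ↔ (X - C z) ^ m ∣ g := by
    rw [dvd_add_left (Dvd.dvd.mul_left ⟨v, e⟩ q), hu.dvd_mul_left]
  by_cases h : (X - C z) ^ m ∣ g
  · rw [if_neg (fun h' => h'.1 (hdvd.2 h)), if_neg (fun h' => h'.1 h)]
  · have hg : g ≠ 0 := by rintro rfl; simp at h
    obtain ⟨u, e', hu', s'⟩ := exists_loc hg z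
    set j := rootMultiplicity z g with hj
    have hjm : j < m := by rwa [← le_rootMultiplicity_iff hg, not_le] at h
    have hval : eval z (C c * u + q * ((X - C z) ^ (m - j) * v)) = c * eval z u := by
      have : m - j ≠ 0 := by omega
      simp [this]
    have := loc_eq (h := C c * g + q * f) (k := C c * u + q * ((X - C z) ^ (m - j) * v)) (z := z)
      (m := j) (by
        conv_lhs => rw [e', e]
        have : m = j + (m - j) := by omega
        conv_lhs => rw [this, pow_add]
        ring) (by rw [hval]; exact mul_ne_zero hc.ne' hu')
    rw [this.1, this.2, hval, sg_mul, sg_pos hc, one_mul, ← s']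
    simp [h, hdvd]

theorem Ind_tarski {f Q : ℝ[X]} (hf : f ≠ 0) :
    Ind (derivative f * Q) f = ∑ z ∈ f.roots.toFinset, sg (eval z Q) := by
  classical
  rw [Ind]
  refine Finset.sum_congr rfl fun z hz => ?_
  have hz0 : eval z f = 0 := by simpa [hf] using hz
  obtain ⟨v, e, hv, s⟩ := exists_loc hf z
  set m := rootMultiplicity z f with hm
  have hmpos : 0 < m := (rootMultiplicity_pos hf).2 hz0
  obtain ⟨j, hj⟩ : ∃ j, m = j + 1 := ⟨m - 1, by omega⟩
  have hd : derivative f = (X - C z) ^ j * (((j : ℝ[X]) + 1) * v + (X - C z) * derivative v) := by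
    rw [e, hj, derivative_mul, derivative_X_sub_C_pow]
    simp; ring
  have hval : eval z (((j : ℝ[X]) + 1) * v + (X - C z) * derivative v) = (j + 1) * eval z v := by
    simp
  by_cases hQ : eval z Q = 0
  · rw [if_neg, hQ, sg_zero]
    rintro ⟨h, _⟩
    apply h
    obtain ⟨Q', hQ'⟩ := dvd_iff_isRoot.2 hQ
    rw [hd, hQ', hj, pow_succ]
    exact ⟨(((j : ℝ[X]) + 1) * v + (X - C z) * derivative v) * Q', by ring⟩
  · have hj1 : (0 : ℝ) < j + 1 := by positivity
    have := loc_eq (h := derivative f * Q)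
      (k := (((j : ℝ[X]) + 1) * v + (X - C z) * derivative v) * Q) (z := z) (m := j)
      (by rw [hd]; ring) (by
        rw [eval_mul, hval]; exact mul_ne_zero (mul_ne_zero hj1.ne' hv) hQ)
    rw [if_pos, this.2, s, eval_mul, hval, sg_mul, sg_mul, sg_pos hj1, one_mul, ← mul_assoc,
      sg_mul_self hv, one_mul]
    refine ⟨?_, ?_⟩
    · have hne : derivative f * Q ≠ 0 := by
        intro h0
        have h2 := this.2
        rw [h0] at h2
        have : sg (eval z ((((j : ℝ[X]) + 1) * v + (X - C z) * derivative v) * Q)) ≠ 0 := by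
          intro h3
          have h4 := sg_mul_self (x := eval z ((((j : ℝ[X]) + 1) * v + (X - C z) * derivative v) * Q))
            (by rw [eval_mul, hval]; exact mul_ne_zero (mul_ne_zero hj1.ne' hv) hQ)
          rw [h3] at h4; simp at h4
        apply this
        rw [← h2]; simp [sp, sg_zero]
      rw [← le_rootMultiplicity_iff hne, this.1]; omega
    · rw [this.1, hj]
      exact ⟨j, by ring⟩

end Tarski

section TarskiDet

open Polynomial

variable {Y : Type} (A : Subalgebra ℝ (Y → ℝ))

/-- evaluation at a parameter -/
def evA (y : Y) : A →+* ℝ := (Pi.evalRingHom (fun _ : Y => ℝ) y).comp A.val.toRingHom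

variable {A}

theorem evA_apply (y : Y) (a : A) : evA A y a = a.1 y := rfl

theorem map_eraseLead_of_zero {y : Y} {P : A[X]} (h : evA A y P.leadingCoeff = 0) :
    P.map (evA A y) = P.eraseLead.map (evA A y) := by
  have e := congrArg (Polynomial.map (evA A y)) (eraseLead_add_C_mul_X_pow P)
  rw [Polynomial.map_add, Polynomial.map_mul, map_C, h, C_0, zero_mul, add_zero] at e
  exact e.symm

theorem degree_le_of_lt_succ {R : Type} [CommRing R] {P : R[X]} {n : ℕ}
    (h : P.degree < (n + 1 : ℕ)) : P.degree ≤ n := by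
  rw [degree_lt_iff_coeff_zero] at h
  rw [degree_le_iff_coeff_zero]
  intro m hm
  exact h m (by exact_mod_cast hm)

theorem det_coe_zero (a : A) : DetBy (A : Set (Y → ℝ)) (fun y => evA A y a = 0) :=
  DetBy.eq_zero (A := (A : Set (Y → ℝ))) a.2

theorem det_lead (n : ℕ) : ∀ P : A[X], P.degree < n →
    DetBy (A : Set (Y → ℝ)) (fun y => (sg (P.map (evA A y)).leadingCoeff, (P.map (evA A y)).natDegree)) := by
  induction n with
  | zero =>
    intro P hP
    have : P = 0 := by
      rw [← degree_eq_bot]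
      simpa using hP
    subst this
    simpa using DetBy.const _
  | succ n ih =>
    intro P hP
    by_cases h0 : P = 0
    · subst h0
      simpa using DetBy.const _
    have hl : P.eraseLead.degree < n := lt_of_lt_of_le (degree_eraseLead_lt h0)
      (degree_le_of_lt_succ hP)
    refine (det_coe_zero P.leadingCoeff).ite (ih _ hl)
      ((DetBy.sign (A := (A : Set (Y → ℝ))) P.leadingCoeff.2).map
        (fun s => ((s : ℤ), P.natDegree))) ?_ ?_
    · intro y hy
      rw [map_eraseLead_of_zero hy]
    · intro y hy
      rw [leadingCoeff_map_of_leadingCoeff_ne_zero _ hy, natDegree_map_of_leadingCoeff_ne_zero _ hy]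
      rfl

theorem exists_nat_degree_lt (P : A[X]) : ∃ n : ℕ, P.degree < n :=
  ⟨P.natDegree + 1, by
    refine lt_of_le_of_lt degree_le_natDegree ?_
    exact_mod_cast Nat.lt_succ_self _⟩

theorem det_ends (P : A[X]) : DetBy (A : Set (Y → ℝ)) (fun y => ends (P.map (evA A y))) := by
  obtain ⟨n, hn⟩ := exists_nat_degree_lt P
  exact (det_lead n P hn).map (fun p => p.1 * (1 - (-1) ^ p.2))

theorem det_poly_zero (P : A[X]) : DetBy (A : Set (Y → ℝ)) (fun y => P.map (evA A y) = 0) := by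
  obtain ⟨n, hn⟩ := exists_nat_degree_lt P
  refine ((det_lead n P hn).map (fun p => p.1 = 0)).congr (fun y => ?_)
  rw [← leadingCoeff_eq_zero]
  refine propext ⟨fun h => by simp [h, sg_zero], fun h => ?_⟩
  by_contra h'
  have := sg_mul_self h'
  have h2 : sg (map (evA A y) P).leadingCoeff = 0 := h
  rw [h2] at this
  simp at this

theorem pseudo_rem {R : Type} [CommRing R] {g : R[X]} (hg : g ≠ 0) (N : ℕ) : ∀ f : R[X], f.degree < N →
    ∃ (k : ℕ) (q r : R[X]), C (g.leadingCoeff ^ k) * f = q * g + r ∧ r.degree < g.degree := by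
  induction N with
  | zero =>
    intro f hf
    have : f = 0 := by
      rw [← degree_eq_bot]
      simpa using hf
    exact ⟨0, 0, 0, by simp [this], by rw [degree_zero]; exact bot_lt_iff_ne_bot.2 (by simpa using hg)⟩
  | succ N ih =>
    intro f hf
    by_cases hd : f.degree < g.degree
    · exact ⟨0, 0, f, by simp, hd⟩
    have hfN : f.degree ≤ N := degree_le_of_lt_succ hf
    have hgN : g.natDegree ≤ N := natDegree_le_iff_degree_le.2 ((not_lt.1 hd).trans hfN)
    have hf1 : (C g.leadingCoeff * f - C (f.coeff N) * X ^ (N - g.natDegree) * g).degree < (N : WithBot ℕ) := by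
      rw [degree_lt_iff_coeff_zero]
      intro j hj
      have e1 : (C (f.coeff N) * X ^ (N - g.natDegree) * g).coeff j
          = f.coeff N * g.coeff (j - (N - g.natDegree)) := by
        rw [mul_assoc, coeff_C_mul, coeff_X_pow_mul', if_pos (by omega)]
      rw [coeff_sub, e1, coeff_C_mul]
      rcases hj.eq_or_lt with rfl | hj
      · rw [Nat.sub_sub_self hgN, coeff_natDegree]; ring
      · rw [coeff_eq_zero_of_degree_lt (lt_of_le_of_lt hfN (by exact_mod_cast hj)),
          coeff_eq_zero_of_natDegree_lt (by omega : g.natDegree < j - (N - g.natDegree))]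
        ring
    obtain ⟨k, q, r, e, hr⟩ := ih _ hf1
    refine ⟨k + 1, q + C (g.leadingCoeff ^ k) * (C (f.coeff N) * X ^ (N - g.natDegree)), r, ?_, hr⟩
    rw [pow_succ, C_mul]
    linear_combination e

theorem det_Ind (n : ℕ) : ∀ f g : A[X], g.degree < n →
    DetBy (A : Set (Y → ℝ)) (fun y => Ind (g.map (evA A y)) (f.map (evA A y))) := by
  have h00 : ∀ f : ℝ[X], Ind 0 f = 0 := fun f => by simp [Ind]
  induction n with
  | zero =>
    intro f g hg
    have : g = 0 := by
      rw [← degree_eq_bot]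
      simpa using hg
    subst this
    simpa [h00] using DetBy.const _
  | succ n ih =>
    intro f g hg
    by_cases h0 : g = 0
    · subst h0
      simpa [h00] using DetBy.const _
    have hgn : g.degree ≤ n := degree_le_of_lt_succ hg
    have hl : g.eraseLead.degree < n := lt_of_lt_of_le (degree_eraseLead_lt h0) hgn
    obtain ⟨N, hN⟩ := exists_nat_degree_lt f
    obtain ⟨k, q, r, e, hr⟩ := pseudo_rem h0 N f hN
    have hr' : (C (g.leadingCoeff ^ k) * r).degree < n := by
      refine lt_of_le_of_lt ?_ (hr.trans_le hgn)
      refine degree_le_iff_coeff_zero _ _ |>.2 fun m hm => ?_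
      rw [coeff_C_mul, coeff_eq_zero_of_degree_lt hm, mul_zero]
    have hdet : DetBy (A : Set (Y → ℝ)) (fun y =>
        (ends ((f * g).map (evA A y)) -
          2 * Ind ((C (g.leadingCoeff ^ k) * r).map (evA A y)) (g.map (evA A y))) / 2) :=
      (det_ends (f * g)).map₂ (ih g _ hr') (fun a b => (a - 2 * b) / 2)
    classical
    have hdet2 := (det_poly_zero f).map₂ hdet (fun p v => if p then 0 else v)
    refine (det_coe_zero g.leadingCoeff).ite (ih f _ hl) hdet2 ?_ ?_
    · intro y hy
      rw [map_eraseLead_of_zero hy]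
    · intro y hy
      by_cases hf : f.map (evA A y) = 0
      · simp [hf, Ind]
      · rw [if_neg hf]
        have hgy : g.map (evA A y) ≠ 0 := fun h => by
          have := leadingCoeff_map_of_leadingCoeff_ne_zero _ hy
          rw [h, leadingCoeff_zero] at this
          exact hy this.symm
        have hc : (0 : ℝ) < (evA A y g.leadingCoeff ^ k) ^ 2 := by positivity
        have e1 : (C (g.leadingCoeff ^ k) * r).map (evA A y)
            = C ((evA A y g.leadingCoeff ^ k) ^ 2) * f.map (evA A y)
              + (- (C (evA A y g.leadingCoeff ^ k) * q.map (evA A y))) * g.map (evA A y) := by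
          have e2 := congrArg (Polynomial.map (evA A y)) e
          simp only [Polynomial.map_add, Polynomial.map_mul, Polynomial.map_pow, C_pow, map_C] at e2 ⊢
          linear_combination (- C (evA A y g.leadingCoeff) ^ k) * e2
        rw [e1, Ind_congr hgy hc]
        have := Ind_recip hf hgy
        rw [Polynomial.map_mul, ← this]
        omega

theorem det_query (H : A[X]) (L : List (A[X] × SignType)) : ∀ Q : A[X],
    DetBy (A : Set (Y → ℝ)) (fun y => ∑ z ∈ (H.map (evA A y)).roots.toFinset,
      sg (eval z (Q.map (evA A y))) * (L.map (fun p =>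
        if SignType.sign (eval z (p.1.map (evA A y))) = p.2 then (1 : ℤ) else 0)).prod) := by
  induction L with
  | nil =>
    intro Q
    obtain ⟨n, hn⟩ := exists_nat_degree_lt (derivative H * Q)
    classical
    refine ((det_poly_zero H).map₂ (det_Ind n H _ hn) (fun p v => if p then 0 else v)).congr
      (fun y => ?_)
    by_cases hH : H.map (evA A y) = 0
    · simp [hH]
    · rw [if_neg hH, Polynomial.map_mul, ← derivative_map, Ind_tarski hH]
      simp
  | cons p L ih =>
    intro Q
    obtain ⟨p, σ⟩ := p
    obtain ⟨α, β, γ, key⟩ : ∃ α β γ : ℤ, ∀ (q v : ℝ),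
        2 * (sg q * (if SignType.sign v = σ then (1 : ℤ) else 0)) =
        α * sg q + β * sg (q * v) + γ * sg (q * v ^ 2) := by
      refine ⟨match σ with
        | SignType.zero => 2
        | SignType.pos => 0
        | SignType.neg => 0, match σ with
        | SignType.zero => 0
        | SignType.pos => 1
        | SignType.neg => -1, match σ with
        | SignType.zero => -2
        | SignType.pos => 1
        | SignType.neg => 1, fun q v => ?_⟩
      rcases lt_trichotomy v 0 with h | h | h
      · rw [sg_mul, sg_mul, sg_pow, sg_neg h, sign_neg h]
        cases σ <;> simp; omega
      · rw [sg_mul, sg_mul, sg_pow, h, sg_zero, sign_zero]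
        cases σ <;> simp
      · rw [sg_mul, sg_mul, sg_pow, sg_pos h, sign_pos h]
        cases σ <;> simp; omega
    refine (((ih Q).prodMk ((ih (Q * p)).prodMk (ih (Q * p ^ 2)))).map
      (fun t => (α * t.1 + β * t.2.1 + γ * t.2.2) / 2)).congr (fun y => ?_)
    simp only [Finset.mul_sum, ← Finset.sum_add_distrib]
    symm
    refine Int.ediv_eq_of_eq_mul_right (by norm_num) ?_
    rw [Finset.mul_sum]
    refine Finset.sum_congr rfl fun z _ => ?_
    simp only [List.map_cons, List.prod_cons, Polynomial.map_mul, Polynomial.map_pow, eval_mul,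
      eval_pow]
    have := key (eval z (Q.map (evA A y))) (eval z (p.map (evA A y)))
    linear_combination (- (L.map (fun p =>
        if SignType.sign (eval z (p.1.map (evA A y))) = p.2 then (1 : ℤ) else 0)).prod) * this

theorem det_exists_root (H : A[X]) (L : List (A[X] × SignType)) :
    DetBy (A : Set (Y → ℝ)) (fun y => ∃ z, z ∈ (H.map (evA A y)).roots.toFinset ∧
      ∀ p ∈ L, SignType.sign (eval z (p.1.map (evA A y))) = p.2) := by
  refine ((det_query H L 1).map (fun n => n ≠ 0)).congr (fun y => ?_)
  have h1 : ∀ z, sg (eval z ((1 : A[X]).map (evA A y))) = 1 := fun z => by simp [sg_one]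
  simp only [h1, one_mul]
  have h2 : ∀ z, 0 ≤ (L.map (fun p =>
        if SignType.sign (eval z (p.1.map (evA A y))) = p.2 then (1 : ℤ) else 0)).prod := fun z => by
    refine List.prod_nonneg fun a ha => ?_
    obtain ⟨p, _, rfl⟩ := List.mem_map.1 ha
    split_ifs <;> simp
  have h3 : ∀ z, (L.map (fun p =>
        if SignType.sign (eval z (p.1.map (evA A y))) = p.2 then (1 : ℤ) else 0)).prod ≠ 0 ↔
      ∀ p ∈ L, SignType.sign (eval z (p.1.map (evA A y))) = p.2 := fun z => by
    rw [Ne, List.prod_eq_zero_iff]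
    simp only [List.mem_map, not_exists, not_and]
    refine forall₂_congr fun p _ => ?_
    split_ifs with h <;> simp [h]
  rw [Ne, Finset.sum_eq_zero_iff_of_nonneg (fun z _ => h2 z)]
  push Not
  simp only [h3]

theorem rolle_aux {ι : Type} {R : ℝ[X]} (hR : R ≠ 0) (P : ι → ℝ[X]) (hP : ∀ i, P i ∣ R) {δ : ℝ}
    (h1 : eval δ R = 0) (h2 : eval (-δ) R = 0) {z : ℝ} (hz : |z| < δ) :
    ∃ w, |w| < δ ∧ eval w (R * derivative R) = 0 ∧
      ∀ i, SignType.sign (eval w (P i)) = SignType.sign (eval z (P i)) := by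
  by_cases hz0 : eval z R = 0
  · exact ⟨z, hz, by simp [hz0], fun i => rfl⟩
  rw [abs_lt] at hz
  classical
  let sl := R.roots.toFinset.filter (· < z)
  let sr := R.roots.toFinset.filter (z < ·)
  have hsl : sl.Nonempty := ⟨-δ, by simp [sl, hR, h2, hz.1]⟩
  have hsr : sr.Nonempty := ⟨δ, by simp [sr, hR, h1, hz.2]⟩
  let a := sl.max' hsl
  let b := sr.min' hsr
  have ha : eval a R = 0 ∧ a < z := by
    have : a ∈ sl := sl.max'_mem hsl
    simpa [sl, hR] using this
  have hb : eval b R = 0 ∧ z < b := by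
    have : b ∈ sr := sr.min'_mem hsr
    simpa [sr, hR] using this
  have haδ : -δ ≤ a := sl.le_max' _ (by simp [sl, hR, h2, hz.1])
  have hbδ : b ≤ δ := sr.min'_le _ (by simp [sr, hR, h1, hz.2])
  have hno : ∀ w ∈ Ioo a b, eval w R ≠ 0 := by
    intro w hw h0
    rcases lt_trichotomy w z with h | h | h
    · exact absurd (sl.le_max' w (by simp [sl, hR, h0, h])) (not_le.2 hw.1)
    · exact hz0 (h ▸ h0)
    · exact absurd (sr.min'_le w (by simp [sr, hR, h0, h])) (not_le.2 hw.2)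
  obtain ⟨w, hw, hw0⟩ := exists_deriv_eq_zero (f := fun x => eval x R) (ha.2.trans hb.2)
    R.continuous.continuousOn (by simp [ha.1, hb.1])
  rw [Polynomial.deriv] at hw0
  refine ⟨w, abs_lt.2 ⟨by linarith [hw.1], by linarith [hw.2]⟩, by simp [hw0], fun i => ?_⟩
  have hPno : ∀ x ∈ Ioo a b, eval x (P i) ≠ 0 := fun x hx h0 => by
    obtain ⟨S, hS⟩ := hP i
    exact hno x hx (by rw [hS, eval_mul, h0, zero_mul])
  have hzI : z ∈ Ioo a b := ⟨ha.2, hb.2⟩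
  have hconn : ∀ x ∈ Ioo a b, ∀ x' ∈ Ioo a b, eval x (P i) < 0 → 0 < eval x' (P i) → False := by
    intro x hx x' hx' h h'
    have := (isPreconnected_Ioo (a := a) (b := b)).intermediate_value hx hx'
      (P i).continuous.continuousOn
    obtain ⟨u, hu, hu0⟩ := this ⟨h.le, h'.le⟩
    exact hPno u hu hu0
  rcases lt_or_gt_of_ne (hPno w hw) with h | h <;> rcases lt_or_gt_of_ne (hPno z hzI) with h' | h'
  · rw [sign_neg h, sign_neg h']
  · exact (hconn _ hw _ hzI h h').elim
  · exact (hconn _ hzI _ hw h' h).elim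
  · rw [sign_pos h, sign_pos h']

/-- the set of sign vectors realized on `|z| < δ` by monic polynomials is determined by the
signs of finitely many members of the coefficient algebra. -/
theorem tarski {ι : Type} [Fintype ι] (P : ι → A[X]) (hP : ∀ i, (P i).Monic) {δ : ℝ} (hδ : 0 < δ) :
    DetBy (A : Set (Y → ℝ)) (fun y => {σ : ι → SignType | ∃ z : ℝ, |z| < δ ∧
      ∀ i, SignType.sign (eval z ((P i).map (evA A y))) = σ i}) := by
  let D : A[X] := X ^ 2 - C (algebraMap ℝ A (δ ^ 2))
  have hD : ∀ y, D.map (evA A y) = X ^ 2 - C (δ ^ 2) := fun y => by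
    simp only [D, Polynomial.map_sub, Polynomial.map_pow, map_X, map_C]
    rfl
  let R : A[X] := (∏ i, P i) * D
  let H : A[X] := R * derivative R
  have key : ∀ σ : ι → SignType, DetBy (A : Set (Y → ℝ)) (fun y => ∃ z : ℝ, |z| < δ ∧
      ∀ i, SignType.sign (eval z ((P i).map (evA A y))) = σ i) := by
    intro σ
    refine (det_exists_root H ((D, -1) :: (Finset.univ.toList.map fun i => (P i, σ i)))).congr
      (fun y => ?_)
    have hR : R.map (evA A y) = (∏ i, (P i).map (evA A y)) * (X ^ 2 - C (δ ^ 2)) := by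
      rw [← hD y, Polynomial.map_mul, Polynomial.map_prod]
    have hRm : (R.map (evA A y)).Monic := by
      rw [hR]
      exact (monic_prod_of_monic _ _ fun i _ => (hP i).map _).mul (monic_X_pow_sub_C _ (by norm_num))
    have hR1 : eval δ (R.map (evA A y)) = 0 := by rw [hR]; simp
    have hR2 : eval (-δ) (R.map (evA A y)) = 0 := by rw [hR]; simp
    have hH : H.map (evA A y) = R.map (evA A y) * derivative (R.map (evA A y)) := by
      rw [derivative_map, ← Polynomial.map_mul]
    have hd : derivative (R.map (evA A y)) ≠ 0 := by
      intro h0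
      have := derivative_eq_zero.1 h0
      rw [hRm.natDegree_eq_zero.1 this] at hR1
      simp at hR1
    have hH0 : H.map (evA A y) ≠ 0 := by
      rw [hH]; exact mul_ne_zero hRm.ne_zero hd
    have hδz : ∀ z : ℝ, SignType.sign (eval z (D.map (evA A y))) = -1 ↔ |z| < δ := by
      intro z
      rw [hD, sign_eq_neg_one_iff]
      simp only [eval_sub, eval_pow, eval_X, eval_C, sub_neg]
      rw [sq_lt_sq, abs_of_pos hδ]
    refine propext ⟨?_, ?_⟩
    · rintro ⟨z, hz, hσ⟩
      obtain ⟨w, hw, hw0, hs⟩ := rolle_aux hRm.ne_zero (fun i => (P i).map (evA A y)) (fun i => by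
        rw [hR]
        exact Dvd.dvd.mul_right (Finset.dvd_prod_of_mem _ (Finset.mem_univ i)) _) hR1 hR2 hz
      refine ⟨w, ?_, ?_⟩
      · rw [Multiset.mem_toFinset, mem_roots hH0, IsRoot, hH]
        exact hw0
      · intro p hp
        rcases List.mem_cons.1 hp with rfl | hp
        · exact (hδz w).2 hw
        · obtain ⟨i, _, rfl⟩ := List.mem_map.1 hp
          exact (hs i).trans (hσ i)
    · rintro ⟨z, _, h⟩
      refine ⟨z, (hδz z).1 (h _ List.mem_cons_self), fun i => h (P i, σ i) ?_⟩
      exact List.mem_cons_of_mem _ (List.mem_map.2 ⟨i, by simp, rfl⟩)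
  exact DetBy.pi key

end TarskiDet

/-! ### Local quantifier elimination: the regular case -/

theorem germ_mul_ne {E : Type} [NormedAddCommGroup E] [NormedSpace ℝ E] {f g : E → ℝ}
    (hg : AnalyticAt ℝ g 0)
    (hf0 : ¬ ∀ᶠ x in 𝓝 0, f x = 0) (hfa : AnalyticAt ℝ f 0) (hg0 : ¬ ∀ᶠ x in 𝓝 0, g x = 0) :
    ¬ ∀ᶠ x in 𝓝 0, f x * g x = 0 := by
  intro h
  obtain ⟨r, hr, hball⟩ := Metric.eventually_nhds_iff_ball.1
    (h.and (hg.eventually_analyticAt.and hfa.eventually_analyticAt))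
  have : ∃ x ∈ Metric.ball (0 : E) r, f x ≠ 0 := by
    by_contra hcon
    push Not at hcon
    exact hf0 (Filter.mem_of_superset (Metric.ball_mem_nhds 0 hr) hcon)
  obtain ⟨x, hx, hfx⟩ := this
  have hgz : g =ᶠ[𝓝 x] 0 := by
    have h1 : ∀ᶠ y in 𝓝 x, f y ≠ 0 := (hball x hx).2.2.continuousAt.eventually_ne hfx
    have h2 : ∀ᶠ y in 𝓝 x, y ∈ Metric.ball (0 : E) r := Metric.isOpen_ball.mem_nhds hx
    filter_upwards [h1, h2] with y hy hy2
    exact (mul_eq_zero.1 (hball y hy2).1).resolve_left hy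
  have := AnalyticOnNhd.eqOn_zero_of_preconnected_of_eventuallyEq_zero
    (f := g) (U := Metric.ball (0 : E) r) (fun y hy => (hball y hy).2.1)
    (convex_ball (0 : E) r).isPreconnected hx hgz
  exact hg0 (Filter.mem_of_superset (Metric.ball_mem_nhds 0 hr) this)

theorem germ_prod_ne {E : Type} [NormedAddCommGroup E] [NormedSpace ℝ E] {ι : Type} (s : Finset ι)
    {f : ι → E → ℝ} (hf : ∀ i, AnalyticAt ℝ (f i) 0) (h0 : ∀ i, ¬ ∀ᶠ x in 𝓝 0, f i x = 0) :
    ¬ ∀ᶠ x in 𝓝 0, ∏ i ∈ s, f i x = 0 := by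
  classical
  induction s using Finset.induction_on with
  | empty => simpa using (inferInstance : (𝓝 (0 : E)).NeBot).ne
  | insert a s ha ih =>
    simp only [Finset.prod_insert ha]
    exact germ_mul_ne (Finset.analyticAt_fun_prod _ fun i _ => hf i) (h0 a) (hf a) ih

/-- a common regular direction. -/
theorem exists_direction' {G : Type} [NormedAddCommGroup G] [NormedSpace ℝ G] [Nontrivial G]
    {ι : Type} [Fintype ι]
    {f : ι → G → ℝ} (hf : ∀ i, AnalyticAt ℝ (f i) 0) (h0 : ∀ i, ¬ ∀ᶠ x in 𝓝 0, f i x = 0) :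
    ∃ w : G, w ≠ 0 ∧ ∀ i, ¬ ∀ᶠ t in 𝓝 (0 : ℝ), f i (t • w) = 0 := by
  classical
  obtain ⟨w, hw⟩ := exists_direction (b := fun x => ∏ i, f i x)
    (Finset.analyticAt_fun_prod _ fun i _ => hf i) (germ_prod_ne Finset.univ hf h0)
  by_cases hw0 : w = 0
  · obtain ⟨w', hw'⟩ := exists_ne (0 : G)
    refine ⟨w', hw', fun i hi => hw (.of_forall fun t => ?_)⟩
    have := hi.self_of_nhds
    rw [zero_smul] at this
    simp only [hw0, smul_zero]
    exact Finset.prod_eq_zero (Finset.mem_univ i) this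
  · refine ⟨w, hw0, fun i hi => hw ?_⟩
    filter_upwards [hi] with t ht
    exact Finset.prod_eq_zero (Finset.mem_univ i) ht

/-- The algebra of functions analytic at `0`. -/
def anaAlg (Y : Type) [NormedAddCommGroup Y] [NormedSpace ℝ Y] : Subalgebra ℝ (Y → ℝ) where
  carrier := {f | AnalyticAt ℝ f 0}
  mul_mem' ha hb := ha.mul hb
  add_mem' ha hb := ha.add hb
  algebraMap_mem' r := analyticAt_const

/-- Local quantifier elimination over `G` at the origin, for a given family. -/
def LQEFor {μ ι G : Type} [Fintype μ] [NormedAddCommGroup G] [NormedSpace ℝ G]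
    (f : ι → (μ → ℝ) × G → ℝ) : Prop :=
  ∀ O ∈ 𝓝 (0 : (μ → ℝ) × G), ∃ W ∈ 𝓝 (0 : (μ → ℝ) × G), W ⊆ O ∧
    ∀ (X : Type) (D : Set (X → ℝ)), DClosed D → ∀ τ : μ → X → ℝ, (∀ i, τ i ∈ D) →
      ∀ P : (ι → SignType) → Prop,
        DetBy D (fun x => ∃ y : G, ((fun i => τ i x), y) ∈ W ∧
          P (fun i => SignType.sign (f i ((fun i => τ i x), y))))

def LQE (G : Type) [NormedAddCommGroup G] [NormedSpace ℝ G] : Prop :=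
  ∀ (μ ι : Type) [Fintype μ] [Fintype ι] (f : ι → (μ → ℝ) × G → ℝ),
    (∀ i, AnalyticAt ℝ (f i) 0) → LQEFor f

theorem lqe_reg {G : Type} [NormedAddCommGroup G] [NormedSpace ℝ G] [FiniteDimensional ℝ G]
    [Nontrivial G]
    (IH : ∀ (G' : Submodule ℝ G), G' ≠ ⊤ → LQE G')
    {μ ι : Type} [Fintype μ] [Fintype ι] (f : ι → (μ → ℝ) × G → ℝ)
    (hf : ∀ i, AnalyticAt ℝ (f i) 0) (hreg : ∀ i, ¬ ∀ᶠ y in 𝓝 (0 : G), f i (0, y) = 0) :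
    LQEFor f := by
  classical
  intro O hO
  have hfib : ∀ i, AnalyticAt ℝ (fun y : G => f i (0, y)) 0 := fun i =>
    AnalyticAt.fun_comp (g := f i) (f := fun y : G => ((0 : μ → ℝ), y)) (hf i)
      (analyticAt_const.prod analyticAt_id)
  obtain ⟨w, hw0, hw⟩ := exists_direction' hfib hreg
  obtain ⟨ψ, hψ⟩ := SeparatingDual.exists_eq_one (R := ℝ) hw0
  let G' : Submodule ℝ G := LinearMap.ker (ψ : G →ₗ[ℝ] ℝ)
  have hG' : G' ≠ ⊤ := by
    intro h
    have : w ∈ G' := h ▸ Submodule.mem_top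
    rw [LinearMap.mem_ker] at this
    change ψ w = 0 at this
    rw [hψ] at this
    exact one_ne_zero this
  let Y : Type := (μ → ℝ) × G'
  let Φ : Y × ℝ →L[ℝ] (μ → ℝ) × G :=
    ((ContinuousLinearMap.fst ℝ (μ → ℝ) G').comp (ContinuousLinearMap.fst ℝ Y ℝ)).prod
      ((G'.subtypeL.comp ((ContinuousLinearMap.snd ℝ (μ → ℝ) G').comp (ContinuousLinearMap.fst ℝ Y ℝ)))
        + (ContinuousLinearMap.snd ℝ Y ℝ).smulRight w)
  have hΦ : ∀ (u : μ → ℝ) (y : G') (z : ℝ), Φ ((u, y), z) = (u, (y : G) + z • w) := fun u y z => rfl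
  have hg : ∀ i, AnalyticAt ℝ (fun q : Y × ℝ => f i (Φ q)) 0 := fun i =>
    AnalyticAt.fun_comp (g := f i) (f := Φ) (by rw [map_zero]; exact hf i) (Φ.analyticAt 0)
  have hgr : ∀ i, ¬ ∀ᶠ z in 𝓝 (0 : ℝ), f i (Φ ((0 : Y), z)) = 0 := by
    intro i h
    apply hw i
    filter_upwards [h] with z hz
    have : Φ ((0 : Y), z) = (0, z • w) := by
      have := hΦ 0 0 z
      rw [Submodule.coe_zero, zero_add] at this
      exact this
    rwa [this] at hz
  choose d q r hq hq0 hr hprep using fun i => weierstrass_prep (fun p : Y × ℝ => f i (Φ p)) (hg i) (hgr i)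
  let A := anaAlg Y
  let rA : ∀ i, Fin (d i) → A := fun i j => ⟨r i j, hr i j⟩
  let Pl : ι → Polynomial A := fun i => Polynomial.X ^ (d i) +
    ∑ j, Polynomial.C (rA i j) * Polynomial.X ^ (j : ℕ)
  have hPl : ∀ i, (Pl i).Monic := by
    intro i
    refine Polynomial.monic_X_pow_add ?_
    refine lt_of_le_of_lt (Polynomial.degree_sum_le _ _) ?_
    refine (Finset.sup_lt_iff (WithBot.bot_lt_coe _)).2 fun j _ => ?_
    exact lt_of_le_of_lt (Polynomial.degree_C_mul_X_pow_le _ _) (by exact_mod_cast j.2)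
  have hev : ∀ i (y : Y) (z : ℝ), Polynomial.eval z ((Pl i).map (evA A y)) =
      z ^ d i + ∑ j, r i j y * z ^ (j : ℕ) := by
    intro i y z
    simp [Pl, Polynomial.eval_finsetSum, Polynomial.map_sum, evA_apply, rA]
  -- good neighbourhood
  have hgood : ∀ᶠ p in 𝓝 (0 : Y × ℝ), Φ p ∈ O ∧ ∀ i, SignType.sign (f i (Φ p)) =
      SignType.sign (q i 0) * SignType.sign (Polynomial.eval p.2 ((Pl i).map (evA A p.1))) := by
    have h1 : ∀ᶠ p in 𝓝 (0 : Y × ℝ), Φ p ∈ O := by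
      have := Φ.continuous.tendsto 0
      rw [map_zero] at this
      exact this hO
    have h2 : ∀ᶠ p in 𝓝 (0 : Y × ℝ), ∀ i, SignType.sign (q i p) = SignType.sign (q i 0) := by
      rw [Filter.eventually_all]
      intro i
      rcases lt_or_gt_of_ne (hq0 i) with h | h
      · filter_upwards [(hq i).continuousAt.eventually_lt_const h] with p hp
        rw [sign_neg hp, sign_neg h]
      · filter_upwards [(hq i).continuousAt.eventually_const_lt h] with p hp
        rw [sign_pos hp, sign_pos h]
    filter_upwards [h1, h2, Filter.eventually_all.2 hprep] with p hp1 hp2 hp3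
    refine ⟨hp1, fun i => ?_⟩
    have h4 := hp3 i
    rw [hev, ← h4, sign_mul, ← hp2 i]
    have h5 : SignType.sign (q i p) ≠ 0 := by
      rw [hp2 i]; simpa using hq0 i
    generalize SignType.sign (q i p) = s at h5
    generalize SignType.sign (f i (Φ p)) = s'
    revert s s'
    decide
  obtain ⟨N, hN, Z, hZ, hNZ⟩ := mem_nhds_prod_iff.1 (show _ ∈ 𝓝 ((0 : Y), (0 : ℝ)) from hgood)
  obtain ⟨δ, hδ, hδZ⟩ := Metric.mem_nhds_iff.1 hZ
  obtain ⟨κ, hκ, T, hTA, hT⟩ := (tarski Pl hPl hδ).exists_factor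
  haveI := Fintype.ofFinite κ
  obtain ⟨W', hW', hW'N, hdet⟩ := IH G' hG' μ κ T hTA N hN
  let Ψ : (μ → ℝ) × G → Y × ℝ := fun p =>
    ((p.1, ⟨p.2 - ψ p.2 • w, by
      rw [LinearMap.mem_ker]; change ψ _ = 0; rw [map_sub, map_smul, hψ]; simp⟩), ψ p.2)
  have hΦΨ : ∀ p, Φ (Ψ p) = p := by
    rintro ⟨u, y⟩
    change Φ ((u, _), _) = _
    rw [hΦ]; simp
  have hΨΦ : ∀ p, Ψ (Φ p) = p := by
    rintro ⟨⟨u, y⟩, z⟩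
    have hy : ψ (y : G) = 0 := y.2
    rw [hΦ]
    simp only [Ψ, map_add, map_smul, hy, hψ, smul_eq_mul, mul_one, zero_add, add_sub_cancel_right]
  have hΨc : Continuous Ψ := by
    refine Continuous.prodMk (Continuous.prodMk continuous_fst (Continuous.subtype_mk ?_ _)) ?_ <;>
    fun_prop
  have hΨ0 : Ψ 0 = 0 := by
    have := hΨΦ 0
    rwa [map_zero] at this
  refine ⟨Ψ ⁻¹' (W' ×ˢ Metric.ball 0 δ), ?_, ?_, ?_⟩
  · refine hΨc.continuousAt.preimage_mem_nhds ?_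
    rw [hΨ0]
    exact prod_mem_nhds hW' (Metric.ball_mem_nhds 0 hδ)
  · intro p hp
    have := (hNZ (show Ψ p ∈ N ×ˢ Z from ⟨hW'N hp.1, hδZ hp.2⟩)).1
    rwa [hΦΨ] at this
  intro X D hD τ hτ P
  let Q : Y → Prop := fun u => ∃ σ ∈ {σ : ι → SignType | ∃ z : ℝ, |z| < δ ∧
    ∀ i, SignType.sign (Polynomial.eval z ((Pl i).map (evA A u))) = σ i},
      P (fun i => SignType.sign (q i 0) * σ i)
  have hQ : ∀ u₁ u₂ : Y, (∀ k, SignType.sign (T k u₁) = SignType.sign (T k u₂)) → Q u₁ = Q u₂ := by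
    intro u₁ u₂ h
    simp only [Q, hT u₁ u₂ h]
  refine (hdet X D hD τ hτ (fun ρ => ∃ u : Y, (fun k => SignType.sign (T k u)) = ρ ∧ Q u)).congr ?_
  intro x
  refine propext ⟨?_, ?_⟩
  · rintro ⟨y, hy, hP⟩
    have hmem := hNZ (show Ψ _ ∈ N ×ˢ Z from ⟨hW'N hy.1, hδZ hy.2⟩)
    refine ⟨(Ψ ((fun i => τ i x), y)).1.2, hy.1, _, rfl, ?_⟩
    refine ⟨_, ⟨(Ψ ((fun i => τ i x), y)).2, by simpa using hy.2, fun i => rfl⟩, ?_⟩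
    convert hP using 2 with i
    have := hmem.2 i
    rw [hΦΨ] at this
    exact this.symm
  · rintro ⟨y', hy', u, hu, hQu⟩
    rw [hQ u _ (fun k => congrFun hu k)] at hQu
    obtain ⟨σ, ⟨z, hz, hσ⟩, hP⟩ := hQu
    refine ⟨(y' : G) + z • w, ?_, ?_⟩
    · rw [mem_preimage, ← hΦ, hΨΦ]
      exact ⟨hy', by simpa using hz⟩
    · convert hP using 2 with i
      have := (hNZ (show ((((fun i => τ i x), y'), z) : Y × ℝ) ∈ N ×ˢ Z from
        ⟨hW'N hy', hδZ (by simpa using hz)⟩)).2 i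
      rw [hΦ] at this
      rw [this, hσ]

/-! ### Local quantifier elimination: the general case -/

theorem DClosed.det_box {X : Type} {D : Set (X → ℝ)} (hD : DClosed D) {μ : Type} [Finite μ]
    {τ : μ → X → ℝ} (hτ : ∀ i, τ i ∈ D) {ε : ℝ} (hε : 0 ≤ ε) :
    DetBy D (fun x => ∀ i, |τ i x| ≤ ε) :=
  DetBy.forall_finite fun i => (hD.det_abs_le (hτ i) (hD.const ε)).congr fun x => by
    rw [abs_of_nonneg hε]

/-- clamping to a box. -/
noncomputable def clampTo (ε t : ℝ) : ℝ := if t ≤ ε then (if -ε ≤ t then t else 0) else 0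

theorem clampTo_abs {ε t : ℝ} (hε : 0 ≤ ε) : |clampTo ε t| ≤ ε := by
  unfold clampTo
  split_ifs with h1 h2
  · exact abs_le.2 ⟨h2, h1⟩
  · simpa
  · simpa

theorem clampTo_eq {ε t : ℝ} (h : |t| ≤ ε) : clampTo ε t = t := by
  unfold clampTo
  rw [if_pos (abs_le.1 h).2, if_pos (abs_le.1 h).1]

theorem DClosed.clamp {X : Type} {D : Set (X → ℝ)} (hD : DClosed D) {a : X → ℝ} (ha : a ∈ D) (ε : ℝ) :
    (fun x => clampTo ε (a x)) ∈ D :=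
  hD.ite_le ha (hD.const ε) (hD.ite_le (hD.const (-ε)) ha ha (hD.const 0)) (hD.const 0)

theorem exists_box {μ : Type} [Fintype μ] {p : (μ → ℝ) → Prop} (h : ∀ᶠ u in 𝓝 (0 : μ → ℝ), p u) :
    ∃ ε > 0, ∀ u : μ → ℝ, (∀ j, |u j| ≤ ε) → p u := by
  obtain ⟨r, hr, hb⟩ := Metric.nhds_basis_closedBall.mem_iff.1 h
  refine ⟨r, hr, fun u hu => hb ?_⟩
  rw [mem_closedBall_zero_iff, pi_norm_le_iff_of_nonneg hr.le]
  exact hu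

def RegLQE (G : Type) [NormedAddCommGroup G] [NormedSpace ℝ G] : Prop :=
  ∀ (μ ι : Type) [Fintype μ] [Fintype ι] (f : ι → (μ → ℝ) × G → ℝ),
    (∀ i, AnalyticAt ℝ (f i) 0) → (∀ i, ¬ ∀ᶠ y in 𝓝 (0 : G), f i (0, y) = 0) → LQEFor f

theorem regLQE_subsingleton (G : Type) [NormedAddCommGroup G] [NormedSpace ℝ G] [Subsingleton G] :
    RegLQE G := by
  intro μ ι _ _ f hf hreg O hO
  have h0 : ∀ i, f i 0 ≠ 0 := by
    intro i hi
    refine hreg i (.of_forall fun y => ?_)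
    rw [Subsingleton.elim y 0]; exact hi
  have hev : ∀ᶠ u in 𝓝 (0 : μ → ℝ), (u, (0 : G)) ∈ O ∧
      ∀ i, SignType.sign (f i (u, 0)) = SignType.sign (f i 0) := by
    have ht : Filter.Tendsto (fun u : μ → ℝ => (u, (0 : G))) (𝓝 0) (𝓝 0) := slice_tendsto
    refine (ht.eventually hO).and (Filter.eventually_all.2 fun i => ?_)
    refine ht.eventually (p := fun p => SignType.sign (f i p) = SignType.sign (f i 0)) ?_
    rcases lt_or_gt_of_ne (h0 i) with h | h
    · filter_upwards [(hf i).continuousAt.eventually_lt_const h] with p hp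
      rw [sign_neg hp, sign_neg h]
    · filter_upwards [(hf i).continuousAt.eventually_const_lt h] with p hp
      rw [sign_pos hp, sign_pos h]
  obtain ⟨ε, hε, hb⟩ := exists_box hev
  refine ⟨{p | ∀ j, |p.1 j| ≤ ε}, ?_, ?_, ?_⟩
  · filter_upwards [Metric.closedBall_mem_nhds (0 : (μ → ℝ) × G) hε] with p hp j
    rw [mem_closedBall_zero_iff] at hp
    exact (norm_le_pi_norm p.1 j).trans ((norm_fst_le p).trans hp)
  · rintro ⟨u, y⟩ hp
    rw [Subsingleton.elim y 0]
    exact (hb u hp).1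
  · intro X D hD τ hτ P
    refine ((hD.det_box hτ hε.le).and (DetBy.const (P fun i => SignType.sign (f i 0)))).congr ?_
    intro x
    refine propext ⟨?_, ?_⟩
    · rintro ⟨y, hy, hP⟩
      rw [Subsingleton.elim y 0] at hP
      refine ⟨hy, ?_⟩
      convert hP using 2 with i
      exact ((hb _ hy).2 i).symm
    · rintro ⟨hy, hP⟩
      refine ⟨0, hy, ?_⟩
      convert hP using 2 with i
      exact ((hb _ hy).2 i)

theorem lqe_gen {G : Type} [NormedAddCommGroup G] [NormedSpace ℝ G] [FiniteDimensional ℝ G]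
    (H : RegLQE G) : LQE G := by
  classical
  intro μ ι _ _ f hf O hO
  choose κ fκ h a hh ha hsum hind using fun i => lemmaA (hf i)
  let ν : Type := Σ i, κ i
  obtain ⟨ε, hε, hbox⟩ := exists_box (p := fun u => ∀ i k, AnalyticAt ℝ (a i k) u)
    (Filter.eventually_all.2 fun i => Filter.eventually_all.2 fun k => (ha i k).eventually_analyticAt)
  let F : (∀ i, Option (κ i)) → (ν → ℝ) → ι → ((μ ⊕ ν) → ℝ) × G → ℝ := fun c v0 i p =>
    if c i = none then 1 else
      ∑ k, (p.1 (Sum.inr ⟨i, k⟩) + v0 ⟨i, k⟩) * h i k ((fun j => p.1 (Sum.inl j)), p.2)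
  let vv : (∀ i, Option (κ i)) → (μ → ℝ) → ν → ℝ := fun c u s =>
    (c s.1).elim 0 (fun k0 => if |a s.1 s.2 u| ≤ |a s.1 k0 u| then a s.1 s.2 u / a s.1 k0 u else 0)
  let cc : (∀ i, Option (κ i)) → Set (ν → ℝ) := fun c =>
    {v | (∀ s, |v s| ≤ 1) ∧ ∀ i k0, c i = some k0 → v ⟨i, k0⟩ = 1}
  let Good : (∀ i, Option (κ i)) → (μ → ℝ) → Prop := fun c u => ∀ i,
    (c i = none → ∀ k, a i k u = 0) ∧
    ∀ k0, c i = some k0 → a i k0 u ≠ 0 ∧ ∀ k, |a i k u| ≤ |a i k0 u|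
  have hcomp : ∀ c, IsCompact (cc c) := by
    intro c
    refine IsCompact.of_isClosed_subset
      (isCompact_Icc (a := fun _ : ν => (-1 : ℝ)) (b := fun _ => (1 : ℝ))) ?_ ?_
    · have e : cc c = (⋂ s, {v : ν → ℝ | |v s| ≤ 1}) ∩
          ⋂ i, ⋂ k0, ⋂ (_ : c i = some k0), {v : ν → ℝ | v ⟨i, k0⟩ = 1} := by
        ext v; simp [cc]
      rw [e]
      refine IsClosed.inter (isClosed_iInter fun s => isClosed_le (by fun_prop) continuous_const)
        (isClosed_iInter fun i => isClosed_iInter fun k0 => isClosed_iInter fun _ =>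
          isClosed_eq (by fun_prop) continuous_const)
    · intro v hv
      exact ⟨fun s => (abs_le.1 (hv.1 s)).1, fun s => (abs_le.1 (hv.1 s)).2⟩
  let L : ((μ ⊕ ν) → ℝ) × G →L[ℝ] (μ → ℝ) × G :=
    ((ContinuousLinearMap.pi fun j => ContinuousLinearMap.proj (Sum.inl j)).comp
      (ContinuousLinearMap.fst ℝ _ _)).prod (ContinuousLinearMap.snd ℝ _ _)
  have hL : ∀ p, L p = ((fun j => p.1 (Sum.inl j)), p.2) := fun p => rfl
  have hFa : ∀ c v0 i, AnalyticAt ℝ (F c v0 i) 0 := by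
    intro c v0 i
    by_cases hc : c i = none
    · have : F c v0 i = fun _ => 1 := by funext p; simp [F, hc]
      rw [this]; exact analyticAt_const
    · have : F c v0 i = fun p => ∑ k, (p.1 (Sum.inr ⟨i, k⟩) + v0 ⟨i, k⟩) * h i k (L p) := by
        funext p; simp only [F, hc, if_false]; rfl
      rw [this]
      refine Finset.analyticAt_fun_sum _ fun k _ => AnalyticAt.fun_mul (AnalyticAt.fun_add
        (AnalyticAt.fun_comp (g := fun q : (μ ⊕ ν) → ℝ => q (Sum.inr ⟨i, k⟩)) (f := Prod.fst)
          (analyticAt_proj _ _) analyticAt_fst) analyticAt_const) ?_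
      exact AnalyticAt.fun_comp (g := h i k) (f := L) (by rw [map_zero]; exact hh i k) (L.analyticAt 0)
  have hFr : ∀ c (v0 : cc c) i, ¬ ∀ᶠ y in 𝓝 (0 : G), F c v0.1 i (0, y) = 0 := by
    intro c v0 i hev
    rcases hc : c i with _ | k0
    · have := hev.self_of_nhds
      simp [F, hc] at this
    · have := hind i (fun k => v0.1 ⟨i, k⟩) (by
        filter_upwards [hev] with y hy
        simp only [F, hc, reduceCtorEq, if_false, Pi.zero_apply, zero_add] at hy
        exact hy)
      have h1 := congrFun this k0
      have h2 := v0.2.2 i k0 hc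
      simp only [Pi.zero_apply] at h1
      rw [h2] at h1
      exact one_ne_zero h1
  have hO' : ∀ᶠ p in 𝓝 (0 : (μ → ℝ) × G), p ∈ O ∧ ∀ i, f i p = ∑ k, h i k p * a i k p.1 :=
    Filter.Eventually.and hO (Filter.eventually_all.2 hsum)
  have hLO : L ⁻¹' {p | p ∈ O ∧ ∀ i, f i p = ∑ k, h i k p * a i k p.1} ∈ 𝓝 0 := by
    refine L.continuous.continuousAt.preimage_mem_nhds ?_
    rw [map_zero]; exact hO'
  choose W hW hWO hdet using fun c (v0 : cc c) =>
    H (μ ⊕ ν) ι (F c v0.1) (hFa c v0.1) (hFr c v0) _ hLO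
  choose r hr hrW using fun c (v0 : cc c) => Metric.mem_nhds_iff.1 (hW c v0)
  choose t ht using fun c => (hcomp c).elim_nhds_subcover' (fun v hv => Metric.ball v (r c ⟨v, hv⟩))
    (fun v hv => Metric.ball_mem_nhds v (hr c ⟨v, hv⟩))
  let ww : (c : ∀ i, Option (κ i)) → (cc c) → (μ → ℝ) → (μ ⊕ ν) → ℝ := fun c v0 u =>
    Sum.elim u (fun s => vv c u s - v0.1 s)
  let WW : Set ((μ → ℝ) × G) := {p | (∀ j, |p.1 j| ≤ ε) ∧ ∃ c, Good c p.1 ∧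
    ∃ v0 ∈ t c, (ww c v0 p.1, p.2) ∈ W c v0}
  have hLww : ∀ c v0 u (y : G), L (ww c v0 u, y) = (u, y) := fun c v0 u y => rfl
  -- properties under `Good`
  have hvv : ∀ c u, Good c u → vv c u ∈ cc c := by
    intro c u hg
    refine ⟨fun s => ?_, fun i k0 hc => ?_⟩
    · rcases hc : c s.1 with _ | k0
      · simp [vv, hc]
      · simp only [vv, hc, Option.elim]
        split_ifs with h1
        · rw [abs_div]; exact div_le_one_of_le₀ h1 (abs_nonneg _)
        · simp
    · simp [vv, hc, div_self ((hg i).2 k0 hc).1]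
  have hex : ∀ u, ∃ c, Good c u := by
    intro u
    have : ∀ i, ∃ ci : Option (κ i), (ci = none → ∀ k, a i k u = 0) ∧
      ∀ k0, ci = some k0 → a i k0 u ≠ 0 ∧ ∀ k, |a i k u| ≤ |a i k0 u| := by
      intro i
      by_cases hall : ∀ k, a i k u = 0
      · exact ⟨none, fun _ => hall, fun k0 h => by simp at h⟩
      · push Not at hall
        obtain ⟨k1, hk1⟩ := hall
        obtain ⟨k0, -, hk0⟩ := Finset.exists_max_image Finset.univ (fun k => |a i k u|) ⟨k1, Finset.mem_univ _⟩
        refine ⟨some k0, fun h => by simp at h, fun k h => ?_⟩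
        obtain rfl := Option.some.inj h
        refine ⟨fun h0 => ?_, fun k => hk0 k (Finset.mem_univ _)⟩
        have := hk0 k1 (Finset.mem_univ _)
        rw [h0, abs_zero] at this
        exact hk1 (abs_eq_zero.1 (le_antisymm this (abs_nonneg _)))
    choose c hc using this
    exact ⟨c, hc⟩
  let sg : (∀ i, Option (κ i)) → (μ → ℝ) → ι → SignType := fun c u i =>
    (c i).elim 0 (fun k0 => SignType.sign (a i k0 u))
  have hsgn : ∀ c (v0 : cc c) u y, Good c u → (ww c v0 u, y) ∈ W c v0 → ∀ i,
      SignType.sign (f i (u, y)) = sg c u i * SignType.sign (F c v0.1 i (ww c v0 u, y)) := by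
    intro c v0 u y hg hmem i
    have h1 := (hWO c v0 hmem).2 i
    rw [hLww] at h1
    rw [h1]
    rcases hc : c i with _ | k0
    · simp only [sg, hc, Option.elim, zero_mul]
      rw [Finset.sum_eq_zero, sign_zero]
      intro k _
      rw [(hg i).1 hc k, mul_zero]
    · simp only [sg, hc, Option.elim, F, reduceCtorEq, if_false]
      rw [← sign_mul, Finset.mul_sum]
      congr 1
      refine Finset.sum_congr rfl fun k _ => ?_
      have h2 := (hg i).2 k0 hc
      have : ww c v0 u (Sum.inr ⟨i, k⟩) + v0.1 ⟨i, k⟩ = a i k u / a i k0 u := by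
        simp [ww, vv, hc, h2.2 k]
      rw [this]
      have h3 : (fun j => ww c v0 u (Sum.inl j)) = u := rfl
      rw [h3]
      have h4 := h2.1
      field_simp
  refine ⟨WW, ?_, ?_, ?_⟩
  · have h1 : ∀ᶠ p in 𝓝 (0 : (μ → ℝ) × G), ∀ c, ∀ v0 ∈ t c, ‖p‖ < r c v0 :=
      Filter.eventually_all.2 fun c => (Filter.eventually_all_finset _).2 fun v0 _ => by
        filter_upwards [Metric.ball_mem_nhds (0 : (μ → ℝ) × G) (hr c v0)] with p hp
        simpa using hp
    filter_upwards [h1, Metric.closedBall_mem_nhds (0 : (μ → ℝ) × G) hε] with p hp1 hp2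
    rw [mem_closedBall_zero_iff] at hp2
    refine ⟨fun j => (norm_le_pi_norm p.1 j).trans ((norm_fst_le p).trans hp2), ?_⟩
    obtain ⟨c, hc⟩ := hex p.1
    refine ⟨c, hc, ?_⟩
    have := ht c (hvv c p.1 hc)
    simp only [mem_iUnion] at this
    obtain ⟨v0, hv0, hv⟩ := this
    refine ⟨v0, hv0, hrW c v0 ?_⟩
    rw [mem_ball_zero_iff]
    have hp3 := hp1 c v0 hv0
    refine max_lt ?_ ((norm_snd_le p).trans_lt hp3)
    rw [pi_norm_lt_iff (hr c v0)]
    rintro (j | s)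
    · exact (norm_le_pi_norm p.1 j).trans_lt ((norm_fst_le p).trans_lt hp3)
    · rw [Metric.mem_ball, dist_pi_lt_iff (hr c v0)] at hv
      exact hv s
  · rintro ⟨u, y⟩ ⟨-, c, -, v0, -, hm⟩
    have := (hWO c v0 hm).1
    rwa [hLww] at this
  · intro X D hD τ hτ P
    let τ' : μ → X → ℝ := fun j x => clampTo ε (τ j x)
    have hτ' : ∀ j, τ' j ∈ D := fun j => hD.clamp (hτ j) ε
    have hab : ∀ x j, |τ' j x| ≤ ε := fun x j => clampTo_abs hε.le
    have haD : ∀ i k, (fun x => a i k (fun j => τ' j x)) ∈ D := by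
      intro i k
      refine hD.ana μ τ' (a i k) (Icc (fun _ => -ε) (fun _ => ε)) hτ' isCompact_Icc ?_ ?_
      · exact fun x => ⟨fun j => (abs_le.1 (hab x j)).1, fun j => (abs_le.1 (hab x j)).2⟩
      · exact fun u hu => hbox u (fun j => abs_le.2 ⟨hu.1 j, hu.2 j⟩) i k
    have hwD : ∀ c (v0 : cc c) s, (fun x => ww c v0 (fun j => τ' j x) s) ∈ D := by
      rintro c v0 (j | s)
      · exact hτ' j
      · refine hD.sub ?_ (hD.const _)
        rcases hc : c s.1 with _ | k0
        · simp only [vv, hc, Option.elim]; exact hD.const 0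
        · simp only [vv, hc, Option.elim]
          exact hD.div _ (haD _ _) _ (haD _ _)
    have hGD : ∀ c, DetBy D (fun x => Good c (fun j => τ' j x)) := by
      intro c
      refine DetBy.forall_finite fun i => ?_
      rcases hc : c i with _ | k0
      · refine (DetBy.forall_finite (fun k => DetBy.eq_zero (haD i k))).congr fun x => ?_
        simp
      · refine ((DetBy.eq_zero (haD i k0)).not.and
          (DetBy.forall_finite fun k => hD.det_abs_le (haD i k) (haD i k0))).congr fun x => ?_
        simp
    have hsD : ∀ c, DetBy D (fun x => sg c (fun j => τ' j x)) := by
      intro c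
      refine DetBy.pi fun i => ?_
      rcases hc : c i with _ | k0
      · exact DetBy.const 0
      · exact DetBy.sign (haD i k0)
    have key : DetBy D (fun x => (∀ j, |τ j x| ≤ ε) ∧ ∃ c, Good c (fun j => τ' j x) ∧
        ∃ v0 : t c, ∃ s : ι → SignType, s = sg c (fun j => τ' j x) ∧ ∃ y : G,
          (ww c v0.1 (fun j => τ' j x), y) ∈ W c v0.1 ∧
          P (fun i => s i * SignType.sign (F c v0.1.1 i (ww c v0.1 (fun j => τ' j x), y)))) := by
      refine (hD.det_box hτ hε.le).and (DetBy.exists_finite fun c => (hGD c).and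
        (DetBy.exists_finite fun v0 => DetBy.exists_finite fun s =>
          ((hsD c).map (fun s' => s = s')).and ?_))
      exact hdet c v0.1 X D hD (fun s x => ww c v0.1 (fun j => τ' j x) s) (hwD c v0.1)
        (fun σ => P (fun i => s i * σ i))
    refine key.congr fun x => propext ⟨?_, ?_⟩
    · rintro ⟨y, ⟨hb, c, hg, v0, hv0, hm⟩, hP⟩
      have e : (fun j => τ' j x) = fun j => τ j x := funext fun j => clampTo_eq (hb j)
      refine ⟨hb, c, by rw [e]; exact hg, ⟨v0, hv0⟩, _, rfl, y, by rw [e]; exact hm, ?_⟩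
      rw [e]
      convert hP using 2 with i
      exact (hsgn c v0 _ y hg hm i).symm
    · rintro ⟨hb, c, hg, v0, s, rfl, y, hm, hP⟩
      have e : (fun j => τ' j x) = fun j => τ j x := funext fun j => clampTo_eq (hb j)
      rw [e] at hg hm hP
      refine ⟨y, ⟨hb, c, hg, v0.1, v0.2, hm⟩, ?_⟩
      convert hP using 2 with i
      exact hsgn c v0.1 _ y hg hm i

theorem lqe_all (n : ℕ) : ∀ (G : Type) [NormedAddCommGroup G] [NormedSpace ℝ G]
    [FiniteDimensional ℝ G], Module.finrank ℝ G = n → LQE G := by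
  induction n using Nat.strong_induction_on with
  | _ n ih =>
    intro G _ _ _ hn
    apply lqe_gen
    rcases subsingleton_or_nontrivial G with hG | hG
    · exact regLQE_subsingleton G
    · intro μ ι _ _ f hf hreg
      refine lqe_reg (fun G' hG' => ?_) f hf hreg
      exact ih _ (hn ▸ Submodule.finrank_lt hG') G' rfl

/-! ### Semianalytic germs and bounded subanalytic sets -/

def SemiAt {E : Type} [NormedAddCommGroup E] [NormedSpace ℝ E] (B : Set E) (p : E) : Prop :=
  ∃ (ι : Type) (_ : Fintype ι) (f : ι → E → ℝ) (P : (ι → SignType) → Prop),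
    (∀ i, AnalyticAt ℝ (f i) p) ∧ ∀ᶠ q in 𝓝 p, (q ∈ B ↔ P (fun i => SignType.sign (f i q)))

namespace SemiAt

variable {E F : Type} [NormedAddCommGroup E] [NormedSpace ℝ E] [NormedAddCommGroup F] [NormedSpace ℝ F]
  {B C : Set E} {p : E}

theorem const {b : Prop} (h : ∀ᶠ q in 𝓝 p, (q ∈ B ↔ b)) : SemiAt B p :=
  ⟨Empty, inferInstance, fun i => i.elim, fun _ => b, fun i => i.elim, h⟩

theorem of_notMem (h : p ∉ closure B) : SemiAt B p := by
  refine const (b := False) ?_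
  filter_upwards [isClosed_closure.isOpen_compl.mem_nhds h] with q hq
  simp only [iff_false]
  exact fun hq' => hq (subset_closure hq')

theorem compl (h : SemiAt B p) : SemiAt Bᶜ p := by
  obtain ⟨ι, _, f, P, hf, h⟩ := h
  refine ⟨ι, inferInstance, f, fun σ => ¬ P σ, hf, ?_⟩
  filter_upwards [h] with q hq
  rw [mem_compl_iff, hq]

theorem inter (h : SemiAt B p) (h' : SemiAt C p) : SemiAt (B ∩ C) p := by
  obtain ⟨ι, _, f, P, hf, h⟩ := h
  obtain ⟨ι', _, f', P', hf', h'⟩ := h'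
  refine ⟨ι ⊕ ι', inferInstance, Sum.elim f f', fun σ => P (fun i => σ (Sum.inl i)) ∧
    P' (fun i => σ (Sum.inr i)), ?_, ?_⟩
  · rintro (i | i)
    · exact hf i
    · exact hf' i
  · filter_upwards [h, h'] with q hq hq'
    rw [mem_inter_iff, hq, hq']
    rfl

theorem union (h : SemiAt B p) (h' : SemiAt C p) : SemiAt (B ∪ C) p := by
  have := (h.compl.inter h'.compl).compl
  rwa [← compl_union, compl_compl] at this

theorem biInter {ι : Type} (s : Finset ι) {B : ι → Set E} (h : ∀ i, SemiAt (B i) p) :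
    SemiAt {x | ∀ i ∈ s, x ∈ B i} p := by
  classical
  induction s using Finset.induction_on with
  | empty => exact const (b := True) (.of_forall fun q => by simp)
  | insert a s ha ih =>
    have := (h a).inter ih
    convert this using 1
    ext x; simp

theorem sgn {f : E → ℝ} (hf : AnalyticAt ℝ f p) (P : SignType → Prop) :
    SemiAt {x | P (SignType.sign (f x))} p :=
  ⟨Unit, inferInstance, fun _ => f, fun σ => P (σ ()), fun _ => hf, .of_forall fun q => Iff.rfl⟩

theorem pos {f : E → ℝ} (hf : AnalyticAt ℝ f p) : SemiAt {x | 0 < f x} p := by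
  have := sgn hf (fun s => s = 1)
  simpa only [sign_eq_one_iff] using this

theorem zero {f : E → ℝ} (hf : AnalyticAt ℝ f p) : SemiAt {x | f x = 0} p := by
  have := sgn hf (fun s => s = 0)
  simpa only [sign_eq_zero_iff] using this

theorem nonneg {f : E → ℝ} (hf : AnalyticAt ℝ f p) : SemiAt {x | 0 ≤ f x} p := by
  have := (pos hf.neg).compl
  convert this using 1
  ext x; simp

theorem le {f g : E → ℝ} (hf : AnalyticAt ℝ f p) (hg : AnalyticAt ℝ g p) :
    SemiAt {x | f x ≤ g x} p := by
  have := nonneg (hg.sub hf)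
  convert this using 1
  ext x; simp

theorem lt {f g : E → ℝ} (hf : AnalyticAt ℝ f p) (hg : AnalyticAt ℝ g p) :
    SemiAt {x | f x < g x} p := by
  have := pos (hg.sub hf)
  convert this using 1
  ext x; simp

theorem eq {f g : E → ℝ} (hf : AnalyticAt ℝ f p) (hg : AnalyticAt ℝ g p) :
    SemiAt {x | f x = g x} p := by
  have := zero (hg.sub hf)
  convert this using 1
  ext x; simp [sub_eq_zero, eq_comm]

theorem eqv [FiniteDimensional ℝ F] {f g : E → F} (hf : AnalyticAt ℝ f p) (hg : AnalyticAt ℝ g p) :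
    SemiAt {x | f x = g x} p := by
  let b := Module.finBasis ℝ F
  have h1 : ∀ i, SemiAt {x | LinearMap.toContinuousLinearMap (b.coord i) (f x) =
      LinearMap.toContinuousLinearMap (b.coord i) (g x)} p := fun i =>
    eq (AnalyticAt.fun_comp (g := LinearMap.toContinuousLinearMap (b.coord i))
      (ContinuousLinearMap.analyticAt _ _) hf) (AnalyticAt.fun_comp
      (g := LinearMap.toContinuousLinearMap (b.coord i)) (ContinuousLinearMap.analyticAt _ _) hg)
  have := biInter Finset.univ h1
  convert this using 1
  ext x
  simp only [mem_ofPred_eq, Finset.mem_univ, true_imp_iff]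
  refine ⟨fun h i => by rw [h], fun h => b.ext_elem h⟩

theorem preimage {φ : E → F} {C : Set F} (hφ : AnalyticAt ℝ φ p) (h : SemiAt C (φ p)) :
    SemiAt (φ ⁻¹' C) p := by
  obtain ⟨ι, _, f, P, hf, h⟩ := h
  refine ⟨ι, inferInstance, fun i x => f i (φ x), P, fun i => AnalyticAt.fun_comp (g := f i) (hf i) hφ, ?_⟩
  filter_upwards [hφ.continuousAt.eventually h] with q hq
  exact hq

end SemiAt

/-- Quantifier elimination relative to a division closed class. -/
theorem qe {μ H : Type} [Fintype μ] [NormedAddCommGroup H] [NormedSpace ℝ H] [FiniteDimensional ℝ H]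
    {B : Set ((μ → ℝ) × H)} (hB : Bornology.IsBounded B) (hs : ∀ p ∈ closure B, SemiAt B p)
    {X : Type} {D : Set (X → ℝ)} (hD : DClosed D) {τ : μ → X → ℝ} (hτ : ∀ i, τ i ∈ D) :
    DetBy D (fun x => ∃ h, ((fun i => τ i x), h) ∈ B) := by
  have hloc : ∀ p ∈ closure B, ∃ W ∈ 𝓝 p, DetBy D (fun x => ∃ h, ((fun i => τ i x), h) ∈ B ∩ W) := by
    intro p hp
    obtain ⟨ι, _, f, P, hf, h⟩ := hs p hp
    have hf' : ∀ i, AnalyticAt ℝ (fun q => f i (p + q)) 0 := fun i =>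
      AnalyticAt.fun_comp (g := f i) (f := fun q => p + q) (by rw [add_zero]; exact hf i)
        (analyticAt_const.add analyticAt_id)
    have hc : Filter.Tendsto (fun q => p + q) (𝓝 0) (𝓝 p) := by
      have : Continuous (fun q => p + q) := by fun_prop
      simpa using this.tendsto 0
    obtain ⟨W, hW, hWO, hdet⟩ := lqe_all _ H rfl μ ι (fun i q => f i (p + q)) hf' _ (hc h)
    refine ⟨(fun q => q - p) ⁻¹' W, ?_, ?_⟩
    · have : Continuous (fun q => q - p) := by fun_prop
      exact this.continuousAt.preimage_mem_nhds (by simpa using hW)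
    have hd := hdet X D hD (fun i x => τ i x - p.1 i) (fun i => hD.sub (hτ i) (hD.const _)) P
    refine hd.congr fun x => propext ⟨?_, ?_⟩
    · rintro ⟨h, hhB, hhW⟩
      refine ⟨h - p.2, hhW, ?_⟩
      have h1 := hWO hhW
      have e : p + (((fun i => τ i x), h) - p) = ((fun i => τ i x), h) := add_sub_cancel _ _
      simp only [mem_preimage, mem_ofPred_eq, e] at h1
      have e2 : p + ((fun i => τ i x - p.1 i), h - p.2) = ((fun i => τ i x), h) := e
      beta_reduce
      rw [e2]
      exact h1.1 hhB
    · rintro ⟨y, hyW, hP⟩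
      have e2 : p + ((fun i => τ i x - p.1 i), y) = ((fun i => τ i x), p.2 + y) := by
        ext i
        · simp
        · rfl
      have h1 := hWO hyW
      simp only [mem_preimage, mem_ofPred_eq] at h1
      beta_reduce at hP
      rw [e2] at hP h1
      refine ⟨p.2 + y, h1.2 hP, ?_⟩
      have e3 : ((fun i => τ i x), p.2 + y) - p = ((fun i => τ i x - p.1 i), y) := by
        rw [← e2, add_sub_cancel_left]
      rw [mem_preimage, e3]
      exact hyW
  have hcomp : IsCompact (closure B) := hB.isCompact_closure
  choose W hW hdet using hloc
  obtain ⟨t, ht⟩ := hcomp.elim_nhds_subcover' W hW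
  have key : DetBy D (fun x => ∃ p : t, ∃ h, ((fun i => τ i x), h) ∈ B ∩ W p.1.1 p.1.2) :=
    DetBy.exists_finite fun p => hdet p.1.1 p.1.2
  refine key.congr fun x => propext ⟨?_, ?_⟩
  · rintro ⟨h, hh⟩
    have := ht (subset_closure hh)
    simp only [mem_iUnion] at this
    obtain ⟨p, hp, hpW⟩ := this
    exact ⟨⟨p, hp⟩, h, hh, hpW⟩
  · rintro ⟨p, h, hh⟩
    exact ⟨h, hh.1⟩

/-- bounded subanalytic sets -/
def SubA {E : Type} [NormedAddCommGroup E] [NormedSpace ℝ E] (A : Set E) : Prop :=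
  ∃ (H : Type) (_ : NormedAddCommGroup H) (_ : NormedSpace ℝ H) (_ : FiniteDimensional ℝ H)
    (B : Set (E × H)), Bornology.IsBounded B ∧ (∀ p ∈ closure B, SemiAt B p) ∧ Prod.fst '' B = A

namespace SubA

variable {E F : Type} [NormedAddCommGroup E] [NormedSpace ℝ E] [NormedAddCommGroup F] [NormedSpace ℝ F]
  {A A' : Set E} {p : E}

theorem bounded (h : SubA A) : Bornology.IsBounded A := by
  obtain ⟨H, _, _, _, B, hB, -, rfl⟩ := h
  exact hB.image_fst

theorem of_semi (hA : Bornology.IsBounded A) (h : ∀ p ∈ closure A, SemiAt A p) : SubA A := by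
  refine ⟨ℝ, inferInstance, inferInstance, inferInstance, A ×ˢ {0}, hA.prod Bornology.isBounded_singleton, ?_, ?_⟩
  · intro p hp
    rw [closure_prod_eq] at hp
    have h1 : SemiAt (Prod.fst ⁻¹' A : Set (E × ℝ)) p := SemiAt.preimage analyticAt_fst (h _ hp.1)
    have h2 : SemiAt {q : E × ℝ | q.2 = 0} p := SemiAt.zero analyticAt_snd
    exact h1.inter h2
  · exact fst_image_prod _ (singleton_nonempty _)

theorem inter_semi (h : SubA A) {C : Set E} (hC : ∀ p ∈ closure A, SemiAt C p) : SubA (A ∩ C) := by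
  obtain ⟨H, _, _, _, B, hB, hs, rfl⟩ := h
  refine ⟨H, inferInstance, inferInstance, inferInstance, B ∩ Prod.fst ⁻¹' C, hB.subset inter_subset_left,
    ?_, image_inter_preimage _ _ _⟩
  intro p hp
  have hp' : p ∈ closure B := closure_mono inter_subset_left hp
  refine (hs p hp').inter (SemiAt.preimage analyticAt_fst (hC _ ?_))
  exact image_closure_subset_closure_image continuous_fst ⟨p, hp', rfl⟩

theorem prod {A₂ : Set F} (h : SubA A) (h' : SubA A₂) : SubA (A ×ˢ A₂) := by
  obtain ⟨H, _, _, _, B, hB, hs, rfl⟩ := h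
  obtain ⟨H', _, _, _, B', hB', hs', rfl⟩ := h'
  let φ : (E × F) × (H × H') → E × H := fun q => (q.1.1, q.2.1)
  let φ' : (E × F) × (H × H') → F × H' := fun q => (q.1.2, q.2.2)
  have hφc : Continuous φ := by fun_prop
  have hφc' : Continuous φ' := by fun_prop
  have hφ : ∀ q, AnalyticAt ℝ φ q := fun q =>
    ((((ContinuousLinearMap.fst ℝ E F).comp (ContinuousLinearMap.fst ℝ (E × F) (H × H'))).prod
      ((ContinuousLinearMap.fst ℝ H H').comp (ContinuousLinearMap.snd ℝ (E × F) (H × H')))).analyticAt q)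
  have hφ' : ∀ q, AnalyticAt ℝ φ' q := fun q =>
    ((((ContinuousLinearMap.snd ℝ E F).comp (ContinuousLinearMap.fst ℝ (E × F) (H × H'))).prod
      ((ContinuousLinearMap.snd ℝ H H').comp (ContinuousLinearMap.snd ℝ (E × F) (H × H')))).analyticAt q)
  refine ⟨H × H', inferInstance, inferInstance, inferInstance, φ ⁻¹' B ∩ φ' ⁻¹' B', ?_, ?_, ?_⟩
  · refine ((hB.image_fst.prod hB'.image_fst).prod (hB.image_snd.prod hB'.image_snd)).subset ?_
    rintro ⟨⟨x, y⟩, h, h'⟩ ⟨h1, h2⟩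
    exact ⟨⟨⟨_, h1, rfl⟩, ⟨_, h2, rfl⟩⟩, ⟨⟨_, h1, rfl⟩, ⟨_, h2, rfl⟩⟩⟩
  · intro p hp
    refine SemiAt.inter (SemiAt.preimage (hφ p) (hs _ ?_)) (SemiAt.preimage (hφ' p) (hs' _ ?_))
    · exact closure_mono (image_subset_iff.2 inter_subset_left)
        (image_closure_subset_closure_image hφc ⟨p, hp, rfl⟩)
    · exact closure_mono (image_subset_iff.2 inter_subset_right)
        (image_closure_subset_closure_image hφc' ⟨p, hp, rfl⟩)
  · ext ⟨x, y⟩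
    constructor
    · rintro ⟨⟨⟨x', y'⟩, h, h'⟩, ⟨h1, h2⟩, e⟩
      obtain ⟨rfl, rfl⟩ := Prod.ext_iff.1 e
      exact ⟨⟨_, h1, rfl⟩, ⟨_, h2, rfl⟩⟩
    · rintro ⟨⟨⟨x', h⟩, h1, rfl⟩, ⟨⟨y', h'⟩, h2, rfl⟩⟩
      exact ⟨((x', y'), (h, h')), ⟨h1, h2⟩, rfl⟩

theorem image [FiniteDimensional ℝ E] [FiniteDimensional ℝ F] (h : SubA A) {φ : E → F}
    (hφ : ∀ p ∈ closure A, AnalyticAt ℝ φ p) :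
    SubA (φ '' A) := by
  have hbd := h.bounded
  obtain ⟨H, _, _, _, B, hB, hs, rfl⟩ := h
  let B' : Set (F × (E × H)) := {q | q.2 ∈ B ∧ q.1 = φ q.2.1}
  have hcl : ∀ p ∈ closure B', p.2 ∈ closure B := fun p hp =>
    closure_mono (image_subset_iff.2 fun q hq => hq.1)
      (image_closure_subset_closure_image continuous_snd ⟨p, hp, rfl⟩)
  have hcl' : ∀ p ∈ closure B, p.1 ∈ closure (Prod.fst '' B) := fun p hp =>
    image_closure_subset_closure_image continuous_fst ⟨p, hp, rfl⟩
  refine ⟨E × H, inferInstance, inferInstance, inferInstance, B', ?_, ?_, ?_⟩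
  · have hc : IsCompact (φ '' closure (Prod.fst '' B)) :=
      hbd.isCompact_closure.image_of_continuousOn fun x hx => (hφ x hx).continuousAt.continuousWithinAt
    refine (hc.isBounded.prod hB).subset ?_
    rintro ⟨y, x, h⟩ ⟨h1, h2⟩
    exact ⟨⟨x, subset_closure ⟨_, h1, rfl⟩, h2.symm⟩, h1⟩
  · intro p hp
    have h1 : SemiAt (Prod.snd ⁻¹' B : Set (F × (E × H))) p := SemiAt.preimage analyticAt_snd (hs _ (hcl p hp))
    refine h1.inter (SemiAt.eqv analyticAt_fst (AnalyticAt.fun_comp (g := φ)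
      (f := fun q : F × (E × H) => q.2.1) (hφ _ (hcl' _ (hcl p hp))) ?_))
    exact ((ContinuousLinearMap.fst ℝ E H).comp (ContinuousLinearMap.snd ℝ F (E × H))).analyticAt p
  · ext y
    constructor
    · rintro ⟨⟨y, x, h⟩, ⟨h1, h2⟩, rfl⟩
      exact ⟨x, ⟨_, h1, rfl⟩, h2.symm⟩
    · rintro ⟨_, ⟨⟨x, h⟩, h1, rfl⟩, rfl⟩
      exact ⟨(φ x, (x, h)), ⟨h1, rfl⟩, rfl⟩

theorem preimage [FiniteDimensional ℝ E] [FiniteDimensional ℝ F] {C : Set F} (h : SubA A) {φ : E → F}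
    (hφ : ∀ p ∈ closure A, AnalyticAt ℝ φ p) (hC : SubA C) : SubA (A ∩ φ ⁻¹' C) := by
  have h1 := (h.prod hC).inter_semi (C := {q : E × F | φ q.1 = q.2}) (by
    intro p hp
    rw [closure_prod_eq] at hp
    exact SemiAt.eqv (AnalyticAt.fun_comp (g := φ) (f := Prod.fst) (hφ _ hp.1) analyticAt_fst) analyticAt_snd)
  have h2 := h1.image (φ := Prod.fst) (fun p _ => analyticAt_fst)
  convert h2 using 1
  ext x
  constructor
  · rintro ⟨hx, hx'⟩
    exact ⟨(x, φ x), ⟨⟨hx, hx'⟩, rfl⟩, rfl⟩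
  · rintro ⟨⟨x, y⟩, ⟨⟨hx, hy⟩, e⟩, rfl⟩
    refine ⟨hx, ?_⟩
    simp only [mem_ofPred_eq] at e
    simp only [mem_preimage, e]
    exact hy

theorem inter [FiniteDimensional ℝ E] (h : SubA A) (h' : SubA A') : SubA (A ∩ A') :=
  h.preimage (φ := id) (fun _ _ => analyticAt_id) h'

theorem union (h : SubA A) (h' : SubA A') : SubA (A ∪ A') := by
  obtain ⟨H, _, _, _, B, hB, hs, rfl⟩ := h
  obtain ⟨H', _, _, _, B', hB', hs', rfl⟩ := h'
  let φ : E × (H × H') → E × H := fun q => (q.1, q.2.1)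
  let φ' : E × (H × H') → E × H' := fun q => (q.1, q.2.2)
  have hφ : ∀ q, AnalyticAt ℝ φ q := fun q =>
    (((ContinuousLinearMap.fst ℝ E (H × H')).prod
      ((ContinuousLinearMap.fst ℝ H H').comp (ContinuousLinearMap.snd ℝ E (H × H')))).analyticAt q)
  have hφ' : ∀ q, AnalyticAt ℝ φ' q := fun q =>
    (((ContinuousLinearMap.fst ℝ E (H × H')).prod
      ((ContinuousLinearMap.snd ℝ H H').comp (ContinuousLinearMap.snd ℝ E (H × H')))).analyticAt q)
  have hs : ∀ p, SemiAt B p := fun p => by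
    by_cases hp : p ∈ closure B
    · exact hs p hp
    · exact SemiAt.of_notMem hp
  have hs' : ∀ p, SemiAt B' p := fun p => by
    by_cases hp : p ∈ closure B'
    · exact hs' p hp
    · exact SemiAt.of_notMem hp
  have a1 : ∀ q, AnalyticAt ℝ (fun q : E × (H × H') => q.2.2) q := fun q =>
    ((ContinuousLinearMap.snd ℝ H H').comp (ContinuousLinearMap.snd ℝ E (H × H'))).analyticAt q
  have a2 : ∀ q, AnalyticAt ℝ (fun q : E × (H × H') => q.2.1) q := fun q =>
    ((ContinuousLinearMap.fst ℝ H H').comp (ContinuousLinearMap.snd ℝ E (H × H'))).analyticAt q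
  refine ⟨H × H', inferInstance, inferInstance, inferInstance,
    (φ ⁻¹' B ∩ {q | q.2.2 = 0}) ∪ (φ' ⁻¹' B' ∩ {q | q.2.1 = 0}), ?_, ?_, ?_⟩
  · refine Bornology.IsBounded.union
      ((hB.image_fst.prod (hB.image_snd.prod (Bornology.isBounded_singleton (x := (0 : H'))))).subset ?_)
      ((hB'.image_fst.prod ((Bornology.isBounded_singleton (x := (0 : H))).prod hB'.image_snd)).subset ?_)
    · rintro ⟨x, h, h'⟩ ⟨h1, h2⟩
      exact ⟨⟨_, h1, rfl⟩, ⟨_, h1, rfl⟩, h2⟩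
    · rintro ⟨x, h, h'⟩ ⟨h1, h2⟩
      exact ⟨⟨_, h1, rfl⟩, h2, ⟨_, h1, rfl⟩⟩
  · intro p _
    exact ((SemiAt.preimage (hφ p) (hs _)).inter (SemiAt.eqv (a1 p) analyticAt_const)).union
      ((SemiAt.preimage (hφ' p) (hs' _)).inter (SemiAt.eqv (a2 p) analyticAt_const))
  · ext x
    constructor
    · rintro ⟨⟨x, h, h'⟩, (⟨h1, -⟩ | ⟨h1, -⟩), rfl⟩
      · exact Or.inl ⟨_, h1, rfl⟩
      · exact Or.inr ⟨_, h1, rfl⟩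
    · rintro (⟨⟨x, h⟩, h1, rfl⟩ | ⟨⟨x, h⟩, h1, rfl⟩)
      · exact ⟨(x, h, 0), Or.inl ⟨h1, rfl⟩, rfl⟩
      · exact ⟨(x, 0, h), Or.inr ⟨h1, rfl⟩, rfl⟩

theorem det {μ : Type} [Fintype μ] {A : Set (μ → ℝ)} (h : SubA A)
    {X : Type} {D : Set (X → ℝ)} (hD : DClosed D) {τ : μ → X → ℝ} (hτ : ∀ i, τ i ∈ D) :
    DetBy D (fun x => (fun i => τ i x) ∈ A) := by
  obtain ⟨H, _, _, _, B, hB, hs, rfl⟩ := h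
  refine (qe hB hs hD hτ).congr fun x => propext ⟨?_, ?_⟩
  · rintro ⟨⟨u, h⟩, h1, e⟩
    simp only at e
    subst e
    exact ⟨h, h1⟩
  · rintro ⟨h, h1⟩
    exact ⟨_, h1, rfl⟩

end SubA

/-! ### The complement theorem -/

section compl

variable {E : Type} [NormedAddCommGroup E] [NormedSpace ℝ E] [FiniteDimensional ℝ E] {Q : Set E}

/-- graph of a vector valued function on `Q` -/
def subGraph {F : Type} (Q : Set E) (τ : Q → F) : Set (E × F) := range fun x : Q => (x.1, τ x)

theorem mem_subGraph {F : Type} {τ : Q → F} {x : E} {v : F} :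
    (x, v) ∈ subGraph Q τ ↔ ∃ h : x ∈ Q, τ ⟨x, h⟩ = v := by
  constructor
  · rintro ⟨⟨y, hy⟩, e⟩
    obtain ⟨rfl, rfl⟩ := Prod.ext_iff.1 e
    exact ⟨hy, rfl⟩
  · rintro ⟨h, rfl⟩
    exact ⟨⟨x, h⟩, rfl⟩

/-- functions with bounded subanalytic graph -/
def subFun (Q : Set E) : Set (Q → ℝ) := {τ | SubA (subGraph Q τ)}

theorem subFun_bdd {τ : Q → ℝ} (h : τ ∈ subFun Q) : ∃ C : ℝ, ∀ x, |τ x| ≤ C := by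
  have h1 : Bornology.IsBounded (Prod.snd '' subGraph Q τ) := h.bounded.image_snd
  obtain ⟨C, hC⟩ := h1.exists_norm_le
  exact ⟨C, fun x => hC _ ⟨_, ⟨x, rfl⟩, rfl⟩⟩

theorem SubA.Icc {κ : Type} [Fintype κ] (C : ℝ) :
    SubA (Set.Icc (fun _ : κ => -C) (fun _ => C)) := by
  refine SubA.of_semi (Metric.isBounded_Icc _ _) fun p _ => ?_
  have h1 : ∀ i : κ, SemiAt {v : κ → ℝ | v i ≤ C} p := fun i =>
    SemiAt.le (analyticAt_proj i p) analyticAt_const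
  have h2 : ∀ i : κ, SemiAt {v : κ → ℝ | -C ≤ v i} p := fun i =>
    SemiAt.le analyticAt_const (analyticAt_proj i p)
  have := (SemiAt.biInter Finset.univ h2).inter (SemiAt.biInter Finset.univ h1)
  convert this using 1
  ext v
  simp [Pi.le_def]

theorem subFun_tuple (hQ : SubA Q) {κ : Type} [Fintype κ] {τ : κ → Q → ℝ} (hτ : ∀ i, τ i ∈ subFun Q) :
    SubA (subGraph Q (fun x i => τ i x)) := by
  classical
  choose C hC using fun i => subFun_bdd (hτ i)
  have hle : ∀ i x, |τ i x| ≤ ∑ i, |C i| := fun i x =>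
    ((hC i x).trans (le_abs_self _)).trans
      (Finset.single_le_sum (f := fun i => |C i|) (fun _ _ => abs_nonneg _) (Finset.mem_univ i))
  have key : ∀ s : Finset κ, SubA {q : E × (κ → ℝ) | q ∈ Q ×ˢ Set.Icc (fun _ : κ => -∑ i, |C i|)
      (fun _ => ∑ i, |C i|) ∧ ∀ i ∈ s, (q.1, q.2 i) ∈ subGraph Q (τ i)} := by
    intro s
    induction s using Finset.induction_on with
    | empty =>
      have := hQ.prod (SubA.Icc (κ := κ) (∑ i, |C i|))
      convert this using 1
      ext q; simp
    | insert a s ha ih =>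
      have := ih.preimage (φ := fun q : E × (κ → ℝ) => (q.1, q.2 a)) (fun p _ =>
        analyticAt_fst.prod (AnalyticAt.fun_comp (g := fun v : κ → ℝ => v a) (f := Prod.snd)
          (analyticAt_proj a _) analyticAt_snd)) (hτ a)
      convert this using 1
      ext q
      simp only [Finset.mem_insert, forall_eq_or_imp, mem_inter_iff, mem_preimage, mem_ofPred_eq]
      tauto
  convert key Finset.univ using 1
  ext ⟨x, v⟩
  simp only [mem_subGraph, Finset.mem_univ, true_imp_iff, mem_ofPred_eq, mem_prod]
  constructor
  · rintro ⟨h, rfl⟩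
    exact ⟨⟨h, fun i => (abs_le.1 (hle i _)).1, fun i => (abs_le.1 (hle i _)).2⟩, fun i => ⟨h, rfl⟩⟩
  · rintro ⟨⟨h, -⟩, h2⟩
    exact ⟨h, funext fun i => (h2 i).2⟩

theorem analyticAt_snd_proj {κ : Type} [Fintype κ] (i : κ) (p : E × (κ → ℝ)) :
    AnalyticAt ℝ (fun q : E × (κ → ℝ) => q.2 i) p :=
  AnalyticAt.fun_comp (g := fun v : κ → ℝ => v i) (f := Prod.snd) (analyticAt_proj i _) analyticAt_snd

theorem subFun_dclosed (hQ : SubA Q) : DClosed (subFun Q) where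
  bdd a ha := subFun_bdd ha
  ana κ _ τ g K hτ hK hmem hg := by
    have h1 := (subFun_tuple hQ hτ).image (φ := fun q : E × (κ → ℝ) => (q.1, g q.2)) (by
      intro p hp
      refine analyticAt_fst.prod (AnalyticAt.fun_comp (g := g) (f := Prod.snd) (hg _ ?_) analyticAt_snd)
      have h2 : p.2 ∈ closure K := closure_mono (image_subset_iff.2 (by rintro _ ⟨x, rfl⟩; exact hmem x))
        (image_closure_subset_closure_image continuous_snd ⟨p, hp, rfl⟩)
      rwa [hK.isClosed.closure_eq] at h2)
    change SubA _
    convert h1 using 1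
    rw [subGraph, subGraph, ← range_comp]
    rfl
  ite a ha b hb c hc := by
    let τ : Fin 3 → Q → ℝ := ![a, b, c]
    have hτ : ∀ i, τ i ∈ subFun Q := by
      intro i; fin_cases i
      · exact ha
      · exact hb
      · exact hc
    have h0 := subFun_tuple hQ hτ
    have h1 := (h0.inter_semi (C := {q | 0 < q.2 0}) (fun p _ => SemiAt.pos (analyticAt_snd_proj _ _))).image
      (φ := fun q => (q.1, q.2 1)) (fun p _ => analyticAt_fst.prod (analyticAt_snd_proj _ _))
    have h2 := (h0.inter_semi (C := {q | 0 < q.2 0}ᶜ)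
      (fun p _ => (SemiAt.pos (analyticAt_snd_proj _ _)).compl)).image
      (φ := fun q => (q.1, q.2 2)) (fun p _ => analyticAt_fst.prod (analyticAt_snd_proj _ _))
    change SubA _
    convert h1.union h2 using 1
    ext ⟨x, v⟩
    constructor
    · rintro ⟨y, e⟩
      by_cases hy : 0 < a y
      · exact Or.inl ⟨_, ⟨⟨y, rfl⟩, hy⟩, by rw [← e]; simp [τ, hy]⟩
      · exact Or.inr ⟨_, ⟨⟨y, rfl⟩, hy⟩, by rw [← e]; simp [τ, hy]⟩
    · rintro (⟨_, ⟨⟨y, rfl⟩, hy⟩, e⟩ | ⟨_, ⟨⟨y, rfl⟩, hy⟩, e⟩)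
      · replace hy : 0 < a y := hy
        exact ⟨y, by rw [← e]; simp [τ, hy]⟩
      · replace hy : ¬ 0 < a y := hy
        exact ⟨y, by rw [← e]; simp [τ, hy]⟩
  div a ha b hb := by
    let τ : Fin 2 → Q → ℝ := ![a, b]
    have hτ : ∀ i, τ i ∈ subFun Q := by
      intro i; fin_cases i
      · exact ha
      · exact hb
    have h0 := subFun_tuple hQ hτ
    have hI : SubA (Set.Icc (-1 : ℝ) 1) := SubA.of_semi (Metric.isBounded_Icc _ _) fun p _ =>
      (SemiAt.le analyticAt_const analyticAt_id).inter (SemiAt.le analyticAt_id analyticAt_const)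
    have hG : ∀ p : E × (Fin 2 → ℝ), SemiAt {q : E × (Fin 2 → ℝ) | q.2 0 ^ 2 ≤ q.2 1 ^ 2 ∧ q.2 1 ≠ 0} p :=
      fun p => (SemiAt.le ((analyticAt_snd_proj _ _).fun_pow 2) ((analyticAt_snd_proj _ _).fun_pow 2)).inter
        (SemiAt.zero (analyticAt_snd_proj _ _)).compl
    have aE : ∀ p : (E × (Fin 2 → ℝ)) × ℝ, AnalyticAt ℝ (fun q : (E × (Fin 2 → ℝ)) × ℝ => q.1.1) p :=
      fun p => AnalyticAt.fun_comp (g := Prod.fst) (f := Prod.fst) analyticAt_fst analyticAt_fst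
    have aV : ∀ i (p : (E × (Fin 2 → ℝ)) × ℝ), AnalyticAt ℝ (fun q : (E × (Fin 2 → ℝ)) × ℝ => q.1.2 i) p :=
      fun i p => AnalyticAt.fun_comp (g := fun q : E × (Fin 2 → ℝ) => q.2 i) (f := Prod.fst)
        (analyticAt_snd_proj _ _) analyticAt_fst
    have h1 := (((h0.inter_semi (fun p _ => hG p)).prod hI).inter_semi
      (C := {q | q.1.2 0 = q.2 * q.1.2 1}) (fun p _ => SemiAt.eq (aV _ _)
        (analyticAt_snd.mul (aV _ _)))).image (φ := fun q => (q.1.1, q.2))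
      (fun p _ => (aE p).prod analyticAt_snd)
    have h2 := (h0.inter_semi (fun p _ => (hG p).compl)).image
      (φ := fun q => (q.1, (0 : ℝ))) (fun p _ => analyticAt_fst.prod analyticAt_const)
    change SubA _
    convert h1.union h2 using 1
    ext ⟨x, v⟩
    constructor
    · rintro ⟨y, e⟩
      obtain ⟨rfl, rfl⟩ := Prod.ext_iff.1 e
      by_cases hy : a y ^ 2 ≤ b y ^ 2 ∧ b y ≠ 0
      · have h3 : |a y| ≤ |b y| := sq_le_sq.1 hy.1
        refine Or.inl ⟨((y.1, fun i => τ i y), a y / b y), ⟨⟨⟨⟨y, rfl⟩, hy⟩, ?_⟩, ?_⟩, ?_⟩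
        · have : |a y / b y| ≤ 1 := by
            rw [abs_div]; exact div_le_one_of_le₀ h3 (abs_nonneg _)
          exact abs_le.1 this
        · change a y = a y / b y * b y
          rw [div_mul_cancel₀ _ hy.2]
        · simp [h3]
      · refine Or.inr ⟨_, ⟨⟨y, rfl⟩, hy⟩, ?_⟩
        have : (if |a y| ≤ |b y| then a y / b y else 0) = 0 := by
          split_ifs with h3
          · by_cases h4 : b y = 0
            · simp [h4]
            · exact absurd ⟨sq_le_sq.2 h3, h4⟩ hy
          · rfl
        simp [this]
    · rintro (⟨⟨_, w⟩, ⟨⟨⟨⟨y, rfl⟩, hy⟩, hw⟩, hww⟩, e⟩ | ⟨_, ⟨⟨y, rfl⟩, hy⟩, e⟩)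
      · replace hy : a y ^ 2 ≤ b y ^ 2 ∧ b y ≠ 0 := hy
        replace hww : a y = w * b y := hww
        refine ⟨y, ?_⟩
        rw [← e]
        simp only [if_pos (sq_le_sq.1 hy.1)]
        rw [hww, mul_div_cancel_right₀ _ hy.2]
      · replace hy : ¬ (a y ^ 2 ≤ b y ^ 2 ∧ b y ≠ 0) := hy
        refine ⟨y, ?_⟩
        rw [← e]
        have : (if |a y| ≤ |b y| then a y / b y else 0) = 0 := by
          split_ifs with h3
          · by_cases h4 : b y = 0
            · simp [h4]
            · exact absurd ⟨sq_le_sq.2 h3, h4⟩ hy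
          · rfl
        simp [this]

end compl

theorem SubA.diff_aux {μ : Type} [Fintype μ] {Q A : Set (μ → ℝ)} (hQ : SubA Q) (hA : SubA A) :
    SubA (Q \ A) := by
  classical
  have hD := subFun_dclosed hQ
  have hτ : ∀ i, (fun x : Q => x.1 i) ∈ subFun Q := by
    intro i
    have := hQ.image (φ := fun x => (x, x i)) (fun p _ => analyticAt_id.prod (analyticAt_proj i p))
    change SubA _
    convert this using 1
    ext ⟨x, v⟩
    rw [mem_subGraph]
    constructor
    · rintro ⟨h, rfl⟩
      exact ⟨x, h, rfl⟩
    · rintro ⟨y, hy, e⟩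
      obtain ⟨rfl, rfl⟩ := Prod.ext_iff.1 e
      exact ⟨hy, rfl⟩
  obtain ⟨κ, _, T, hT, hdet⟩ := (hA.det hD hτ).exists_factor
  have := Fintype.ofFinite κ
  have h1 := (subFun_tuple hQ hT).inter_semi
    (C := {q | ¬ ∃ x : Q, (∀ i, SignType.sign (T i x) = SignType.sign (q.2 i)) ∧ x.1 ∈ A}) (by
      intro p _
      exact ⟨κ, inferInstance, fun i q => q.2 i,
        fun σ => ¬ ∃ x : Q, (∀ i, SignType.sign (T i x) = σ i) ∧ x.1 ∈ A,
        fun i => analyticAt_snd_proj i p, .of_forall fun q => Iff.rfl⟩)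
  have h2 := h1.image (φ := Prod.fst) (fun p _ => analyticAt_fst)
  convert h2 using 1
  ext x
  constructor
  · rintro ⟨hx, hxA⟩
    refine ⟨_, ⟨⟨⟨x, hx⟩, rfl⟩, ?_⟩, rfl⟩
    rintro ⟨y, hy, hyA⟩
    have := hdet y ⟨x, hx⟩ hy
    exact hxA ((iff_of_eq this).1 hyA)
  · rintro ⟨_, ⟨⟨y, rfl⟩, hn⟩, rfl⟩
    exact ⟨y.2, fun hyA => hn ⟨y, fun i => rfl, hyA⟩⟩

theorem SubA.diff {E : Type} [NormedAddCommGroup E] [NormedSpace ℝ E] [FiniteDimensional ℝ E]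
    {Q A : Set E} (hQ : SubA Q) (hA : SubA A) : SubA (Q \ A) := by
  let e : E ≃L[ℝ] (Fin (Module.finrank ℝ E) → ℝ) :=
    (Module.finBasis ℝ E).equivFun.toContinuousLinearEquiv
  have he : ∀ p, AnalyticAt ℝ e p := fun p => e.toContinuousLinearMap.analyticAt p
  have he' : ∀ p, AnalyticAt ℝ e.symm p := fun p => e.symm.toContinuousLinearMap.analyticAt p
  have := (SubA.diff_aux (hQ.image (φ := e) fun p _ => he p) (hA.image (φ := e) fun p _ => he p)).image
    (φ := e.symm) (fun p _ => he' p)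
  convert this using 1
  rw [← image_diff e.injective, ← image_comp]
  simp

/-! ### Flat germs of functions of two variables -/

theorem weier_mono_deg {d D : ℕ} {u : ℝ → ℝ} (hu : ContinuousAt u 0) 
    (h : ∀ z : ℝ, z ^ D = z ^ d * u z) : d ≤ D := by
  by_contra hlt
  push Not at hlt
  have h1 : ∀ᶠ z in 𝓝[≠] (0 : ℝ), z ^ (d - D) * u z = 1 := by
    filter_upwards [self_mem_nhdsWithin] with z hz
    have h2 := h z
    have h3 : z ^ d = z ^ D * z ^ (d - D) := by rw [← pow_add]; congr 1; omega
    rw [h3, mul_assoc] at h2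
    have h4 : z ^ D ≠ 0 := pow_ne_zero _ hz
    exact (mul_right_eq_self₀.1 h2.symm).resolve_right h4
  have h2 : Filter.Tendsto (fun z : ℝ => z ^ (d - D) * u z) (𝓝[≠] 0) (𝓝 (0 ^ (d - D) * u 0)) :=
    ((continuousAt_id.pow _).mul hu).tendsto.mono_left nhdsWithin_le_nhds
  rw [zero_pow (by omega), zero_mul] at h2
  have h3 := h2.congr' h1
  exact zero_ne_one (tendsto_nhds_unique h3 tendsto_const_nhds)

theorem flat_nf {P : ℝ × ℝ → ℝ} (hP : AnalyticAt ℝ P 0) (hne : ¬ ∀ᶠ p in 𝓝 0, P p = 0) :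
    ∃ (b j : ℕ) (E : ℝ × ℝ → ℝ), AnalyticAt ℝ E 0 ∧ E 0 ≠ 0 ∧
      ∀ᶠ p in 𝓝 (0 : ℝ × ℝ), P (p.1, p.1 ^ (b + 1) * p.2) = p.1 ^ (b + (b + 1) * j) * p.2 ^ j * E p := by
  classical
  obtain ⟨w, hw⟩ := exists_direction hP hne
  have hPw : AnalyticAt ℝ (fun τ : ℝ => P (τ • w)) 0 :=
    AnalyticAt.fun_comp (g := P) (f := fun τ : ℝ => τ • w) (by rw [zero_smul]; exact hP)
      (analyticAt_id.smul analyticAt_const)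
  obtain ⟨k, g, hg, hg0, hk⟩ := hPw.exists_eventuallyEq_pow_smul_nonzero_iff.2 hw
  let D := k + 1
  obtain ⟨d, ⟨u, hu, hu0, hud⟩, hdiv⟩ := weierstrass_division (P := ℝ) (fun p => p.2 ^ D)
    (analyticAt_snd.fun_pow D) (fun h => by
      have h1 : ∀ᶠ z in 𝓝[≠] (0 : ℝ), False := by
        filter_upwards [h.filter_mono nhdsWithin_le_nhds, self_mem_nhdsWithin] with z hz hz'
        exact hz' (pow_eq_zero_iff (by omega)|>.1 hz)
      simp only [Filter.eventually_false_iff_eq_bot] at h1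
      exact (inferInstance : (𝓝[≠] (0 : ℝ)).NeBot).ne h1)
  have hdD : d ≤ D := weier_mono_deg hu hud
  obtain ⟨q, r, hq, hr, heq⟩ := hdiv P hP
  have hex : ∃ n : ℕ, ∃ h : n < d, ¬ ∀ᶠ t in 𝓝 (0 : ℝ), r ⟨n, h⟩ t = 0 := by
    by_contra hcon
    push Not at hcon
    have h1 : Filter.Tendsto (fun τ : ℝ => τ • w) (𝓝 0) (𝓝 0) := by
      have : Continuous (fun τ : ℝ => τ • w) := by fun_prop
      simpa using this.tendsto 0
    have h2 : ∀ᶠ τ in 𝓝[≠] (0 : ℝ), g τ = τ * (w.2 ^ D * q (τ • w)) := by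
      have h3 : ∀ᶠ τ in 𝓝 (0 : ℝ), ∀ j, r j (τ • w).1 = 0 := by
        have h4 : Filter.Tendsto (fun τ : ℝ => (τ • w).1) (𝓝 0) (𝓝 0) :=
          (continuous_fst.tendsto (0 : ℝ × ℝ)).comp h1
        exact Filter.eventually_all.2 fun j => h4.eventually (hcon j.1 j.2)
      filter_upwards [self_mem_nhdsWithin, nhdsWithin_le_nhds h3, nhdsWithin_le_nhds hk,
        nhdsWithin_le_nhds (h1.eventually heq)] with τ h0 h3 h4 h5
      simp only [h3, zero_mul, Finset.sum_const_zero, add_zero] at h5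
      rw [h4] at h5
      have hw2 : (τ • w).2 = τ * w.2 := rfl
      rw [hw2] at h5
      simp only [sub_zero, smul_eq_mul] at h5
      have h6 : τ ^ k ≠ 0 := pow_ne_zero _ h0
      apply mul_left_cancel₀ h6
      rw [h5]; simp only [D]; ring
    have h3 : Filter.Tendsto (fun τ : ℝ => τ * (w.2 ^ D * q (τ • w))) (𝓝[≠] 0) (𝓝 0) := by
      have h4 : Filter.Tendsto (fun τ : ℝ => τ * (w.2 ^ D * q (τ • w))) (𝓝 0) (𝓝 (0 * (w.2 ^ D * q 0))) :=
        Filter.tendsto_id.mul (tendsto_const_nhds.mul (hq.continuousAt.tendsto.comp h1))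
      rw [zero_mul] at h4
      exact h4.mono_left nhdsWithin_le_nhds
    have h4 := hg.continuousAt.tendsto.mono_left (nhdsWithin_le_nhds (s := {0}ᶜ))
    exact hg0 (tendsto_nhds_unique h4 (h3.congr' (h2.mono fun _ h => h.symm)))
  let j := Nat.find hex
  obtain ⟨hjd, hj⟩ : ∃ h : j < d, ¬ ∀ᶠ t in 𝓝 (0 : ℝ), r ⟨j, h⟩ t = 0 := Nat.find_spec hex
  have hlow : ∀ i : Fin d, i.1 < j → ∀ᶠ t in 𝓝 (0 : ℝ), r i t = 0 := by
    intro i hi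
    have := Nat.find_min hex hi
    push Not at this
    exact this i.2
  obtain ⟨b, c, hc, hc0, hb⟩ := (hr ⟨j, hjd⟩).exists_eventuallyEq_pow_smul_nonzero_iff.2 hj
  let Q : ℝ × ℝ → ℝ := fun p => (∑ i : Fin d, if j < i.1 then r i p.1 * p.2 ^ (i.1 - j - 1) else 0) +
    p.2 ^ (D - j - 1) * q p
  have hfst : ∀ i, AnalyticAt ℝ (fun p : ℝ × ℝ => r i p.1) 0 := fun i =>
    AnalyticAt.fun_comp (g := r i) (f := Prod.fst) (hr i) analyticAt_fst
  have hQ : AnalyticAt ℝ Q 0 := by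
    refine AnalyticAt.fun_add (Finset.analyticAt_fun_sum _ fun i _ => ?_)
      (AnalyticAt.fun_mul (analyticAt_snd.fun_pow _) hq)
    split_ifs
    · exact (hfst i).fun_mul (analyticAt_snd.fun_pow _)
    · exact analyticAt_const
  have hPQ : ∀ᶠ p in 𝓝 (0 : ℝ × ℝ), P p = p.2 ^ j * (p.1 ^ b * c p.1 + p.2 * Q p) := by
    have ht : Filter.Tendsto (Prod.fst : ℝ × ℝ → ℝ) (𝓝 0) (𝓝 0) := continuous_fst.tendsto (0 : ℝ × ℝ)
    have h1 : ∀ᶠ p in 𝓝 (0 : ℝ × ℝ), ∀ i : Fin d, i.1 < j → r i p.1 = 0 :=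
      Filter.eventually_all.2 fun i => by
        by_cases hi : i.1 < j
        · filter_upwards [ht.eventually (hlow i hi)] with p hp _ using hp
        · exact .of_forall fun p h => absurd h hi
    filter_upwards [heq, h1, ht.eventually hb] with p hp h1 h2
    rw [hp]
    simp only [sub_zero, smul_eq_mul] at h2
    have h3 : ∀ i : Fin d, r i p.1 * p.2 ^ (i : ℕ) = p.2 ^ j * ((if i = ⟨j, hjd⟩ then p.1 ^ b * c p.1 else 0) +
        p.2 * if j < i.1 then r i p.1 * p.2 ^ (i.1 - j - 1) else 0) := by
      intro i
      rcases lt_trichotomy i.1 j with h | h | h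
      · have : i ≠ ⟨j, hjd⟩ := fun h' => by rw [h'] at h; simp at h
        simp [h1 i h, this, not_lt.2 h.le]
      · have : i = ⟨j, hjd⟩ := Fin.ext h
        subst this
        simp [h2]; ring
      · have : i ≠ ⟨j, hjd⟩ := fun h' => by rw [h'] at h; simp at h
        rw [if_neg this, if_pos h]
        have h4 : p.2 ^ (i : ℕ) = p.2 ^ j * p.2 * p.2 ^ (i.1 - j - 1) := by
          rw [mul_assoc, ← pow_succ', ← pow_add]; congr 1; omega
        rw [h4]; ring
    rw [Finset.sum_congr rfl fun i _ => h3 i, ← Finset.mul_sum, Finset.sum_add_distrib, ← Finset.mul_sum,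
      Finset.sum_ite_eq' Finset.univ (⟨j, hjd⟩ : Fin d) (fun _ => p.1 ^ b * c p.1), if_pos (Finset.mem_univ _)]
    have h5 : p.2 ^ D = p.2 ^ j * p.2 * p.2 ^ (D - j - 1) := by
      rw [mul_assoc, ← pow_succ', ← pow_add]; congr 1; omega
    rw [h5]
    simp only [Q]
    ring
  let φ : ℝ × ℝ → ℝ × ℝ := fun p => (p.1, p.1 ^ (b + 1) * p.2)
  have hφ : AnalyticAt ℝ φ 0 := analyticAt_fst.prod ((analyticAt_fst.fun_pow _).fun_mul analyticAt_snd)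
  have hφ0 : φ 0 = 0 := by simp [φ]
  refine ⟨b, j, fun p => c p.1 + p.1 * p.2 * Q (φ p), ?_, ?_, ?_⟩
  · refine AnalyticAt.fun_add (AnalyticAt.fun_comp (g := c) (f := Prod.fst) hc analyticAt_fst)
      (AnalyticAt.fun_mul (analyticAt_fst.fun_mul analyticAt_snd) ?_)
    exact AnalyticAt.fun_comp (g := Q) (f := φ) (by rw [hφ0]; exact hQ) hφ
  · simpa using hc0
  · have := hφ.continuousAt.tendsto
    rw [hφ0] at this
    filter_upwards [this.eventually hPQ] with p hp
    change P (φ p) = _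
    rw [hp]
    simp only [φ, mul_pow, ← pow_mul]
    ring

/-! ### The class of flat functions -/

def flatR (n : ℕ) : Set (ℝ × ℝ) := {x | 0 < x.1 ∧ x.1 < 1 / ((n : ℝ) + 1) ∧ 0 < x.2 ∧ x.2 < x.1 ^ n}

def flatF : Filter (ℝ × ℝ) := ⨅ n, Filter.principal (flatR n)

theorem flatR_anti : Antitone flatR := by
  intro n m hnm x hx
  have h1 : (1 : ℝ) / ((m : ℝ) + 1) ≤ 1 / ((n : ℝ) + 1) := by
    apply one_div_le_one_div_of_le (by positivity)
    have : (n : ℝ) ≤ m := by exact_mod_cast hnm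
    linarith
  have h2 : (1 : ℝ) / ((m : ℝ) + 1) ≤ 1 := by
    rw [div_le_one (by positivity)]
    have : (0 : ℝ) ≤ m := by positivity
    linarith
  refine ⟨hx.1, hx.2.1.trans_le h1, hx.2.2.1, hx.2.2.2.trans_le ?_⟩
  exact pow_le_pow_of_le_one hx.1.le (hx.2.1.le.trans h2) hnm

theorem flatF_basis : flatF.HasBasis (fun _ : ℕ => True) flatR :=
  Filter.hasBasis_iInf_principal (flatR_anti.directed_ge)

theorem flatF_mem (n : ℕ) : ∀ᶠ x in flatF, x ∈ flatR n := flatF_basis.mem_of_mem trivial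

theorem flatR_nonempty (n : ℕ) : (flatR n).Nonempty := by
  have h : (0 : ℝ) < 1 / ((n : ℝ) + 1) := by positivity
  refine ⟨(1 / ((n : ℝ) + 1) / 2, (1 / ((n : ℝ) + 1) / 2) ^ n / 2), ?_, ?_, ?_, ?_⟩
  · positivity
  · exact half_lt_self h
  · positivity
  · exact half_lt_self (by positivity)

instance flatF_neBot : flatF.NeBot :=
  flatF_basis.neBot_iff.2 fun {n} _ => flatR_nonempty n

theorem flat_pos : ∀ᶠ x in flatF, 0 < x.1 ∧ 0 < x.2 :=
  (flatF_mem 0).mono fun _ h => ⟨h.1, h.2.2.1⟩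

theorem flat_fst : Filter.Tendsto Prod.fst flatF (𝓝 (0 : ℝ)) := by
  rw [Metric.tendsto_nhds]
  intro ε hε
  obtain ⟨n, hn⟩ := exists_nat_one_div_lt hε
  filter_upwards [flatF_mem n] with x hx
  rw [Real.dist_eq, sub_zero, abs_of_pos hx.1]
  exact hx.2.1.trans hn

theorem flat_snd (M : ℕ) : Filter.Tendsto (fun x : ℝ × ℝ => x.2 / x.1 ^ M) flatF (𝓝 (0 : ℝ)) := by
  refine squeeze_zero' ?_ ?_ flat_fst
  · filter_upwards [flat_pos] with x hx
    have := hx.1; have := hx.2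
    positivity
  · filter_upwards [flatF_mem (M + 1)] with x hx
    have := hx.1
    rw [div_le_iff₀ (by positivity), ← pow_succ']
    exact hx.2.2.2.le

theorem flat_tendsto (M : ℕ) :
    Filter.Tendsto (fun x : ℝ × ℝ => (x.1, x.2 / x.1 ^ M)) flatF (𝓝 (0 : ℝ × ℝ)) :=
  flat_fst.prodMk_nhds (flat_snd M)

def FlatAt (M : ℕ) (τ : ℝ × ℝ → ℝ) : Prop :=
  ∃ P : ℝ × ℝ → ℝ, AnalyticAt ℝ P 0 ∧ ∀ᶠ x in flatF, τ x = P (x.1, x.2 / x.1 ^ M)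

theorem flat_shear (k : ℕ) : AnalyticAt ℝ (fun p : ℝ × ℝ => (p.1, p.1 ^ k * p.2)) 0 :=
  analyticAt_fst.prod ((analyticAt_fst.fun_pow _).fun_mul analyticAt_snd)

theorem flat_shear_comp (k : ℕ) {P : ℝ × ℝ → ℝ} (hP : AnalyticAt ℝ P 0) :
    AnalyticAt ℝ (fun p : ℝ × ℝ => P (p.1, p.1 ^ k * p.2)) 0 :=
  AnalyticAt.fun_comp (g := P) (f := fun p : ℝ × ℝ => (p.1, p.1 ^ k * p.2)) (by simpa [Prod.mk_zero_zero] using hP)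
    (flat_shear k)

theorem flat_shear_eq {t s : ℝ} (ht : 0 < t) (M k : ℕ) : s / t ^ M = t ^ k * (s / t ^ (M + k)) := by
  have := ht.ne'
  rw [pow_add]
  field_simp

theorem FlatAt.raise {M : ℕ} {τ : ℝ × ℝ → ℝ} (h : FlatAt M τ) (k : ℕ) : FlatAt (M + k) τ := by
  obtain ⟨P, hP, he⟩ := h
  refine ⟨_, flat_shear_comp k hP, ?_⟩
  filter_upwards [he, flat_pos] with x hx h0
  rw [hx, flat_shear_eq h0.1 M k]

theorem FlatAt.mono {M M' : ℕ} {τ : ℝ × ℝ → ℝ} (h : FlatAt M τ) (hM : M ≤ M') : FlatAt M' τ := by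
  obtain ⟨k, rfl⟩ := Nat.exists_eq_add_of_le hM
  exact h.raise k

theorem FlatAt.nf {M : ℕ} {τ : ℝ × ℝ → ℝ} (h : FlatAt M τ) :
    (∀ᶠ x in flatF, τ x = 0) ∨ ∃ N₀ : ℕ, ∀ N, N₀ ≤ N → ∃ (a j : ℕ) (E : ℝ × ℝ → ℝ),
      AnalyticAt ℝ E 0 ∧ E 0 ≠ 0 ∧ ∀ᶠ x in flatF,
        τ x = x.1 ^ a * (x.2 / x.1 ^ N) ^ j * E (x.1, x.2 / x.1 ^ N) := by
  obtain ⟨P, hP, he⟩ := h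
  by_cases hz : ∀ᶠ p in 𝓝 0, P p = 0
  · left
    filter_upwards [he, (flat_tendsto M).eventually hz] with x hx h2
    rw [hx, h2]
  · right
    obtain ⟨b, j, E, hE, hE0, hb⟩ := flat_nf hP hz
    refine ⟨M + (b + 1), fun N hN => ?_⟩
    obtain ⟨k, rfl⟩ := Nat.exists_eq_add_of_le hN
    refine ⟨b + (b + 1) * j + k * j, j, _, flat_shear_comp k hE, by simpa [Prod.mk_zero_zero] using hE0, ?_⟩
    filter_upwards [he, flat_pos, (flat_tendsto (M + (b + 1))).eventually hb] with x hx h0 h1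
    rw [hx, flat_shear_eq h0.1 M (b + 1), h1, flat_shear_eq h0.1 (M + (b + 1)) k]
    rw [mul_pow, ← pow_mul, pow_add _ _ (k * j)]
    ring

theorem FlatAt.sgn {M : ℕ} {τ : ℝ × ℝ → ℝ} (h : FlatAt M τ) :
    ∃ σ : SignType, ∀ᶠ x in flatF, SignType.sign (τ x) = σ := by
  rcases h.nf with h | ⟨N, h⟩
  · exact ⟨0, h.mono fun x hx => by rw [hx, sign_zero]⟩
  · obtain ⟨a, j, E, hE, hE0, h⟩ := h N le_rfl
    have h2 := hE.continuousAt.tendsto.comp (flat_tendsto N)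
    rcases lt_or_gt_of_ne hE0 with h0 | h0
    · refine ⟨-1, ?_⟩
      filter_upwards [h, h2.eventually (gt_mem_nhds h0), flat_pos] with x hx hs hp
      have h3 := hp.1
      have h4 := hp.2
      rw [hx, sign_eq_neg_one_iff]
      exact mul_neg_of_pos_of_neg (by positivity) hs
    · refine ⟨1, ?_⟩
      filter_upwards [h, h2.eventually (lt_mem_nhds h0), flat_pos] with x hx hs hp
      have h3 := hp.1
      have h4 := hp.2
      rw [hx, sign_eq_one_iff]
      exact mul_pos (by positivity) hs

def flatD : Set (ℝ × ℝ → ℝ) := {τ | (∃ C : ℝ, ∀ x, |τ x| ≤ C) ∧ ∃ M, FlatAt M τ}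

theorem flatD_ana (κ : Type) [Fintype κ] (τ : κ → ℝ × ℝ → ℝ) (g : (κ → ℝ) → ℝ) (K : Set (κ → ℝ))
    (hτ : ∀ i, τ i ∈ flatD) (hK : IsCompact K) (hx : ∀ x, (fun i => τ i x) ∈ K)
    (hg : AnalyticOnNhd ℝ g K) : (fun x => g (fun i => τ i x)) ∈ flatD := by
  constructor
  · obtain ⟨C, hC⟩ := hK.exists_bound_of_continuousOn hg.continuousOn
    exact ⟨C, fun x => hC _ (hx x)⟩
  · choose M hM using fun i => (hτ i).2
    have h1 : ∀ i, FlatAt (∑ i, M i) (τ i) := fun i =>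
      (hM i).mono (Finset.single_le_sum (fun _ _ => Nat.zero_le _) (Finset.mem_univ i))
    choose P hP he using h1
    have h2 : ∀ᶠ x in flatF, ∀ i, τ i x = P i (x.1, x.2 / x.1 ^ (∑ i, M i)) :=
      Filter.eventually_all.2 he
    have h3 : Filter.Tendsto (fun x => (fun i => τ i x)) flatF (𝓝 (fun i => P i 0)) := by
      rw [tendsto_pi_nhds]
      intro i
      exact ((hP i).continuousAt.tendsto.comp (flat_tendsto _)).congr'
        ((he i).mono fun x h => h.symm)
    have h4 : (fun i => P i 0) ∈ K := hK.isClosed.mem_of_tendsto h3 (.of_forall hx)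
    refine ⟨∑ i, M i, fun p => g (fun i => P i p), ?_, ?_⟩
    · exact AnalyticAt.fun_comp (g := g) (f := fun p => (fun i => P i p)) (hg _ h4)
        (AnalyticAt.pi hP)
    · filter_upwards [h2] with x hx
      congr 1
      exact funext hx

theorem flatAt_div {a b : ℝ × ℝ → ℝ} {M M' : ℕ} (ha : FlatAt M a) (hb : FlatAt M' b)
    (hab : ∀ᶠ x in flatF, |a x| ≤ |b x|) : ∃ N, FlatAt N (fun x => a x / b x) := by
  have hzero : (∀ᶠ x in flatF, a x / b x = 0) → ∃ N, FlatAt N (fun x => a x / b x) := fun h =>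
    ⟨0, fun _ => 0, analyticAt_const, h⟩
  rcases ha.nf with h | ⟨N₁, h1⟩
  · exact hzero (h.mono fun x h => by rw [h, zero_div])
  rcases hb.nf with h | ⟨N₂, h2⟩
  · exact hzero (h.mono fun x h => by rw [h, div_zero])
  obtain ⟨α, j, E, hE, hE0, he⟩ := h1 (max N₁ N₂) (le_max_left _ _)
  obtain ⟨β, k, F, hF, hF0, hf⟩ := h2 (max N₁ N₂) (le_max_right _ _)
  set N := max N₁ N₂
  have tE := (hE.continuousAt.tendsto.comp (flat_tendsto N)).abs
  have tF := (hF.continuousAt.tendsto.comp (flat_tendsto N)).abs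
  have hw : ∀ᶠ x : ℝ × ℝ in flatF, 0 < x.1 ∧ 0 < x.2 / x.1 ^ N := by
    filter_upwards [flat_pos] with x hx
    have := hx.1; have := hx.2
    exact ⟨hx.1, by positivity⟩
  have key : ∀ᶠ x : ℝ × ℝ in flatF, x.1 ^ α * (x.2 / x.1 ^ N) ^ j * |E (x.1, x.2 / x.1 ^ N)| ≤
      x.1 ^ β * (x.2 / x.1 ^ N) ^ k * |F (x.1, x.2 / x.1 ^ N)| := by
    filter_upwards [hab, he, hf, hw] with x h1 h2 h3 h4
    have h5 := h4.1
    have h6 := h4.2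
    have h7 : 0 < x.1 ^ α * (x.2 / x.1 ^ N) ^ j := by positivity
    have h8 : 0 < x.1 ^ β * (x.2 / x.1 ^ N) ^ k := by positivity
    rwa [h2, h3, abs_mul, abs_mul (_ * _), abs_of_pos h7, abs_of_pos h8] at h1
  -- a vanishing upper bound for `E` is impossible
  have imp : ∀ z : ℝ × ℝ → ℝ, Filter.Tendsto z flatF (𝓝 0) →
      (∀ᶠ x : ℝ × ℝ in flatF, |E (x.1, x.2 / x.1 ^ N)| ≤ z x * |F (x.1, x.2 / x.1 ^ N)|) → False := by
    intro z hz hle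
    have h1 := hz.mul tF
    rw [zero_mul] at h1
    exact absurd (le_of_tendsto_of_tendsto tE h1 hle) (not_le.2 (abs_pos.2 hE0))
  rcases lt_trichotomy j k with hjk | hjk | hjk
  · exfalso
    obtain ⟨l, rfl⟩ := Nat.exists_eq_add_of_le (Nat.succ_le_of_lt hjk)
    refine imp (fun x => x.2 / x.1 ^ (N + α) * (x.1 ^ β * (x.2 / x.1 ^ N) ^ l)) ?_ ?_
    · have := (flat_snd (N + α)).mul ((flat_fst.pow β).mul ((flat_snd N).pow l))
      rwa [zero_mul] at this
    · filter_upwards [key, hw] with x h1 h2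
      have h3 := h2.1
      have h4 := h2.2
      have h5 : x.2 / x.1 ^ N = x.1 ^ α * (x.2 / x.1 ^ (N + α)) := flat_shear_eq h3 N α
      generalize |E (x.1, x.2 / x.1 ^ N)| = e at *
      generalize |F (x.1, x.2 / x.1 ^ N)| = f at *
      generalize x.2 / x.1 ^ (N + α) = v at *
      generalize x.2 / x.1 ^ N = w at *
      have h6 : 0 < x.1 ^ α * w ^ j := by positivity
      refine le_of_mul_le_mul_left ?_ h6
      calc _ ≤ _ := h1
        _ = x.1 ^ β * (w ^ j * w * w ^ l) * f := by rw [Nat.succ_eq_add_one, pow_add, pow_succ]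
        _ = x.1 ^ β * (w ^ j * (x.1 ^ α * v) * w ^ l) * f := by rw [← h5]
        _ = _ := by ring
  · subst hjk
    by_cases hαβ : α < β
    · exfalso
      obtain ⟨l, rfl⟩ := Nat.exists_eq_add_of_le (Nat.succ_le_of_lt hαβ)
      refine imp (fun x => x.1 ^ (l + 1)) ?_ ?_
      · have := flat_fst.pow (l + 1)
        rwa [zero_pow (by omega)] at this
      · filter_upwards [key, hw] with x h1 h2
        have h3 := h2.1
        have h4 := h2.2
        generalize |E (x.1, x.2 / x.1 ^ N)| = e at *
        generalize |F (x.1, x.2 / x.1 ^ N)| = f at *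
        generalize x.2 / x.1 ^ N = w at *
        have h6 : 0 < x.1 ^ α * w ^ j := by positivity
        refine le_of_mul_le_mul_left ?_ h6
        calc _ ≤ _ := h1
          _ = _ := by rw [Nat.succ_eq_add_one]; ring
    · push Not at hαβ
      obtain ⟨l, rfl⟩ := Nat.exists_eq_add_of_le hαβ
      refine ⟨N, fun p => p.1 ^ l * E p / F p, ?_, ?_⟩
      · exact AnalyticAt.fun_div ((analyticAt_fst.fun_pow l).fun_mul hE) hF hF0
      · filter_upwards [he, hf, hw] with x h1 h2 h3
        have h4 := h3.1.ne'
        have h5 := h3.2.ne'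
        rw [h1, h2]
        generalize E (x.1, x.2 / x.1 ^ N) = e at *
        generalize F (x.1, x.2 / x.1 ^ N) = f at *
        generalize x.2 / x.1 ^ N = w at *
        rw [show x.1 ^ (β + l) * w ^ j * e = (x.1 ^ β * w ^ j) * (x.1 ^ l * e) by ring]
        exact mul_div_mul_left _ _ (by positivity)
  · obtain ⟨l, rfl⟩ := Nat.exists_eq_add_of_le (Nat.succ_le_of_lt hjk)
    refine ⟨N + β, fun p => p.1 ^ (α + β * l) * p.2 ^ (l + 1) * E (p.1, p.1 ^ β * p.2) /
      F (p.1, p.1 ^ β * p.2), ?_, ?_⟩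
    · refine AnalyticAt.fun_div (((analyticAt_fst.fun_pow _).fun_mul (analyticAt_snd.fun_pow _)).fun_mul
        (flat_shear_comp β hE)) (flat_shear_comp β hF) (by simpa [Prod.mk_zero_zero] using hF0)
    · filter_upwards [he, hf, hw] with x h1 h2 h3
      have h4 := h3.1.ne'
      have h5 := h3.2.ne'
      have h6 : x.2 / x.1 ^ N = x.1 ^ β * (x.2 / x.1 ^ (N + β)) := flat_shear_eq h3.1 N β
      rw [h1, h2]
      rw [← h6]
      generalize E (x.1, x.2 / x.1 ^ N) = e at *
      generalize F (x.1, x.2 / x.1 ^ N) = f at *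
      generalize x.2 / x.1 ^ (N + β) = v at *
      generalize x.2 / x.1 ^ N = w at *
      rw [show x.1 ^ α * w ^ (k.succ + l) * e = (x.1 ^ β * w ^ k) * (x.1 ^ (α + β * l) * v ^ (l + 1) * e) by
        rw [show w ^ (k.succ + l) = w ^ k * w ^ (l + 1) by rw [← pow_add]; congr 1; omega]
        nth_rewrite 2 [h6]
        rw [mul_pow, ← pow_mul, pow_add]
        ring]
      exact mul_div_mul_left _ _ (by positivity)

theorem flatAt_congr {M : ℕ} {τ τ' : ℝ × ℝ → ℝ} (h : FlatAt M τ) (e : ∀ᶠ x in flatF, τ' x = τ x) :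
    FlatAt M τ' := by
  obtain ⟨P, hP, h⟩ := h
  exact ⟨P, hP, by filter_upwards [h, e] with x h1 h2 using h2.trans h1⟩

theorem flat_sq_sub {a b : ℝ × ℝ → ℝ} {M M' : ℕ} (ha : FlatAt M a) (hb : FlatAt M' b) :
    FlatAt (max M M') (fun x => b x ^ 2 - a x ^ 2) := by
  obtain ⟨P, hP, h⟩ := ha.mono (le_max_left M M')
  obtain ⟨Q, hQ, h'⟩ := hb.mono (le_max_right M M')
  refine ⟨fun p => Q p ^ 2 - P p ^ 2, (hQ.fun_pow 2).fun_sub (hP.fun_pow 2), ?_⟩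
  filter_upwards [h, h'] with x h1 h2
  rw [h1, h2]

theorem flatD_dclosed : DClosed flatD where
  bdd := fun a ha => ha.1
  ana := flatD_ana
  ite := by
    rintro a ⟨-, M, ha⟩ b ⟨⟨B, hB⟩, M₁, hb⟩ c ⟨⟨C, hC⟩, M₂, hc⟩
    refine ⟨⟨max B C, fun x => ?_⟩, ?_⟩
    · beta_reduce
      split_ifs
      · exact (hB x).trans (le_max_left _ _)
      · exact (hC x).trans (le_max_right _ _)
    · obtain ⟨σ, hσ⟩ := ha.sgn
      by_cases h : σ = 1
      · refine ⟨M₁, flatAt_congr hb (hσ.mono fun x hx => ?_)⟩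
        rw [h, sign_eq_one_iff] at hx
        rw [if_pos hx]
      · refine ⟨M₂, flatAt_congr hc (hσ.mono fun x hx => ?_)⟩
        beta_reduce
        rw [if_neg]
        intro h'
        exact h (hx.symm.trans (sign_eq_one_iff.2 h'))
  div := by
    rintro a ⟨-, M, ha⟩ b ⟨-, M₁, hb⟩
    refine ⟨⟨1, fun x => ?_⟩, ?_⟩
    · beta_reduce
      split_ifs with h
      · rw [abs_div]
        exact div_le_one_of_le₀ h (abs_nonneg _)
      · simp
    · obtain ⟨σ, hσ⟩ := (flat_sq_sub ha hb).sgn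
      by_cases h : σ = -1
      · refine ⟨0, fun _ => 0, analyticAt_const, hσ.mono fun x hx => ?_⟩
        rw [h, sign_eq_neg_one_iff] at hx
        beta_reduce
        rw [if_neg]
        intro h'
        have := sq_le_sq.2 h'
        linarith
      · have h1 : ∀ᶠ x in flatF, |a x| ≤ |b x| := hσ.mono fun x hx => by
          rw [← sq_le_sq]
          by_contra hcon
          push Not at hcon
          exact h (hx.symm.trans (sign_eq_neg_one_iff.2 (by linarith)))
        obtain ⟨N, hN⟩ := flatAt_div ha hb h1
        exact ⟨N, flatAt_congr hN (h1.mono fun x hx => by rw [if_pos hx])⟩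

theorem flat_clamp_fst : (fun x : ℝ × ℝ => clampTo 1 x.1) ∈ flatD := by
  refine ⟨⟨1, fun x => clampTo_abs zero_le_one⟩, 0, fun p => p.1, analyticAt_fst, ?_⟩
  filter_upwards [flatF_mem 0] with x hx
  exact clampTo_eq (by rw [abs_of_pos hx.1]; have := hx.2.1; norm_num at this; exact this.le)

theorem flat_clamp_snd : (fun x : ℝ × ℝ => clampTo 1 x.2) ∈ flatD := by
  refine ⟨⟨1, fun x => clampTo_abs zero_le_one⟩, 0, fun p => p.2, analyticAt_snd, ?_⟩
  filter_upwards [flatF_mem 0] with x hx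
  rw [pow_zero, div_one]
  exact clampTo_eq (by rw [abs_of_pos hx.2.2.1]; have := hx.2.2.2; norm_num at this; exact this.le)

theorem flat_det {S : ℝ × ℝ → Prop} (h : DetBy flatD S) :
    (∀ᶠ x in flatF, S x) ∨ (∀ᶠ x in flatF, ¬ S x) := by
  obtain ⟨κ, _, T, hT, h⟩ := h.exists_factor
  choose M hM using fun i => (hT i).2
  choose σ hσ using fun i => (hM i).sgn
  have h1 : ∀ᶠ x in flatF, ∀ i, SignType.sign (T i x) = σ i := Filter.eventually_all.2 hσ
  obtain ⟨x₀, hx₀⟩ := h1.exists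
  by_cases h0 : S x₀
  · left
    filter_upwards [h1] with x hx
    rw [h x x₀ fun i => (hx i).trans (hx₀ i).symm]
    exact h0
  · right
    filter_upwards [h1] with x hx
    rw [h x x₀ fun i => (hx i).trans (hx₀ i).symm]
    exact h0

/-! ### The Lojasiewicz inequality -/

theorem semiAt_ball {E : Type} [NormedAddCommGroup E] [InnerProductSpace ℝ E] {F : Type}
    [NormedAddCommGroup F] [NormedSpace ℝ F] {f : F → E} {p : F} (hf : AnalyticAt ℝ f p) :
    AnalyticAt ℝ (fun x => ‖f x‖ ^ 2) p := by
  have h : AnalyticAt ℝ (fun v : E => ‖v‖ ^ 2) (f p) :=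
    (contDiff_norm_sq (n := ⊤) ℝ (E := E)).contDiffAt.analyticAt
  exact AnalyticAt.fun_comp (g := fun v : E => ‖v‖ ^ 2) h hf

theorem semiAt_closedBall {E : Type} [NormedAddCommGroup E] [InnerProductSpace ℝ E] (c : E) {r : ℝ}
    (hr : 0 ≤ r) (p : E) : SemiAt (Metric.closedBall c r) p := by
  have h : SemiAt {x : E | ‖x - c‖ ^ 2 ≤ r ^ 2} p :=
    SemiAt.le (semiAt_ball (analyticAt_id.fun_sub analyticAt_const)) analyticAt_const
  convert h using 1
  ext x
  rw [Metric.mem_closedBall, dist_eq_norm]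
  exact (sq_le_sq₀ (norm_nonneg _) hr).symm

theorem subA_closedBall {E : Type} [NormedAddCommGroup E] [InnerProductSpace ℝ E] (c : E) {r : ℝ}
    (hr : 0 ≤ r) : SubA (Metric.closedBall c r) :=
  SubA.of_semi Metric.isBounded_closedBall fun p _ => semiAt_closedBall c hr p

theorem semiAt_of_semianalytic {E : Type} [NormedAddCommGroup E] [NormedSpace ℝ E] {B : Set E}
    (h : Semianalytic B) (p : E) : SemiAt B p := by
  obtain ⟨U, hU, k, q, f, g, hf, hg, he⟩ := h p
  refine ⟨(Fin k × Fin q) ⊕ (Fin k × Fin q), inferInstance,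
    Sum.elim (fun i => f i.1 i.2) (fun i => g i.1 i.2),
    fun σ => ∃ i, ∀ j, σ (Sum.inl (i, j)) = 0 ∧ σ (Sum.inr (i, j)) = 1, ?_, ?_⟩
  · rintro (i | i)
    · exact hf _ _ p (mem_of_mem_nhds hU)
    · exact hg _ _ p (mem_of_mem_nhds hU)
  · filter_upwards [hU] with x hx
    have h1 : x ∈ B ↔ x ∈ B ∩ U := ⟨fun h => ⟨h, hx⟩, fun h => h.1⟩
    rw [h1, he]
    simp only [Sum.elim_inl, Sum.elim_inr, sign_eq_zero_iff, sign_eq_one_iff]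
    constructor
    · rintro ⟨h2, -⟩
      obtain ⟨i, hi⟩ := mem_iUnion.1 h2
      exact ⟨i, fun j => mem_iInter.1 hi j⟩
    · rintro ⟨i, hi⟩
      exact ⟨mem_iUnion.2 ⟨i, mem_iInter.2 fun j => hi j⟩, hx⟩

theorem loj {E F : Type} [NormedAddCommGroup E] [InnerProductSpace ℝ E] [FiniteDimensional ℝ E]
    [NormedAddCommGroup F] [InnerProductSpace ℝ F] [FiniteDimensional ℝ F]
    {f : E → F} (hf : ∀ p, AnalyticAt ℝ f p) {Q : Set E} {Z : Set F} (hQ : SubA Q) (hQc : IsCompact Q)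
    (hZ : SubA Z) (hZc : IsCompact Z) :
    ∃ n : ℕ, 0 < n ∧ ∀ t s : ℝ, (t, s) ∈ flatR n → ∀ x ∈ Q, (∀ x' ∈ Q ∩ f ⁻¹' Z, t ≤ dist x x') →
      ∀ y ∈ Z, s < dist y (f x) := by
  let T : Set ℝ := Metric.closedBall 0 1
  have hT : SubA T := subA_closedBall 0 zero_le_one
  let W := Q ∩ f ⁻¹' Z
  have hW : SubA W := hQ.preimage (fun p _ => hf p) hZ
  let A₁ : Set ((ℝ × E) × E) := (T ×ˢ Q) ×ˢ W ∩ {q | ‖q.1.2 - q.2‖ ^ 2 < q.1.1 ^ 2}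
  have hA₁ : SubA A₁ := ((hT.prod hQ).prod hW).inter_semi fun p _ => by
    refine SemiAt.lt (semiAt_ball ?_) ?_
    · exact ((ContinuousLinearMap.snd ℝ ℝ E).comp (ContinuousLinearMap.fst ℝ (ℝ × E) E) -
        ContinuousLinearMap.snd ℝ (ℝ × E) E).analyticAt p
    · exact (((ContinuousLinearMap.fst ℝ ℝ E).comp (ContinuousLinearMap.fst ℝ (ℝ × E) E)).analyticAt
        p).fun_pow 2
  let C₁ : Set (ℝ × E) := (T ×ˢ Q) \ (Prod.fst '' A₁)
  have hC₁ : SubA C₁ := (hT.prod hQ).diff (hA₁.image fun p _ => analyticAt_fst)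
  let A₂ : Set (((ℝ × E) × ℝ) × F) := (C₁ ×ˢ T) ×ˢ Z ∩ {q | ‖q.2 - f q.1.1.2‖ ^ 2 ≤ q.1.2 ^ 2}
  have hA₂ : SubA A₂ := ((hC₁.prod hT).prod hZ).inter_semi fun p _ => by
    refine SemiAt.le (semiAt_ball (AnalyticAt.fun_sub analyticAt_snd ?_)) ?_
    · exact AnalyticAt.fun_comp (g := f) (f := fun q : ((ℝ × E) × ℝ) × F => q.1.1.2) (hf _)
        (((ContinuousLinearMap.snd ℝ ℝ E).comp ((ContinuousLinearMap.fst ℝ (ℝ × E) ℝ).comp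
          (ContinuousLinearMap.fst ℝ ((ℝ × E) × ℝ) F))).analyticAt p)
    · exact (((ContinuousLinearMap.snd ℝ (ℝ × E) ℝ).comp
          (ContinuousLinearMap.fst ℝ ((ℝ × E) × ℝ) F)).analyticAt p).fun_pow 2
  let φ : ((ℝ × E) × ℝ) × F → Bool → ℝ := fun q i => bif i then q.1.2 else q.1.1.1
  have hS : SubA (φ '' A₂) := hA₂.image fun p _ => by
    refine AnalyticAt.pi fun i => ?_
    cases i
    · exact ((ContinuousLinearMap.fst ℝ ℝ E).comp ((ContinuousLinearMap.fst ℝ (ℝ × E) ℝ).comp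
          (ContinuousLinearMap.fst ℝ ((ℝ × E) × ℝ) F))).analyticAt p
    · exact ((ContinuousLinearMap.snd ℝ (ℝ × E) ℝ).comp
          (ContinuousLinearMap.fst ℝ ((ℝ × E) × ℝ) F)).analyticAt p
  let S : ℝ → ℝ → Prop := fun t s => ∃ x ∈ Q, (∀ x' ∈ W, t ≤ dist x x') ∧ ∃ y ∈ Z, dist y (f x) ≤ s
  have hdet := hS.det flatD_dclosed
    (τ := fun i x => bif i then clampTo 1 x.2 else clampTo 1 x.1) (by
      intro i
      cases i
      · exact flat_clamp_fst
      · exact flat_clamp_snd)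
  have hiff : ∀ n, ∀ x ∈ flatR n, (((fun i => bif i then clampTo 1 x.2 else clampTo 1 x.1) : Bool → ℝ) ∈
      φ '' A₂ ↔ S x.1 x.2) := by
    rintro n ⟨t, s⟩ hx
    have hx0 := flatR_anti (Nat.zero_le n) hx
    obtain ⟨ht0, ht1, hs0, hs1⟩ := hx0
    norm_num at ht1 hs1
    dsimp only at ht0 hs0 ⊢
    have htT : t ∈ T := by
      rw [Metric.mem_closedBall, Real.dist_eq, sub_zero, abs_of_pos ht0]; exact ht1.le
    have hsT : s ∈ T := by
      rw [Metric.mem_closedBall, Real.dist_eq, sub_zero, abs_of_pos hs0]; exact hs1.le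
    rw [clampTo_eq (t := t) (by rw [abs_of_pos ht0]; exact ht1.le),
      clampTo_eq (t := s) (by rw [abs_of_pos hs0]; exact hs1.le)]
    have hC : ∀ x, (t, x) ∈ C₁ ↔ x ∈ Q ∧ ∀ x' ∈ W, t ≤ dist x x' := by
      intro x
      constructor
      · rintro ⟨⟨-, h1⟩, h2⟩
        refine ⟨h1, fun x' hx' => ?_⟩
        by_contra hcon
        push Not at hcon
        refine h2 ⟨((t, x), x'), ⟨⟨⟨htT, h1⟩, hx'⟩, ?_⟩, rfl⟩
        rw [dist_eq_norm] at hcon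
        exact (sq_lt_sq₀ (norm_nonneg _) ht0.le).2 hcon
      · rintro ⟨h1, h2⟩
        refine ⟨⟨htT, h1⟩, ?_⟩
        rintro ⟨⟨⟨t', x₁⟩, x'⟩, ⟨⟨-, h3⟩, h4⟩, h5⟩
        obtain ⟨rfl, rfl⟩ := Prod.mk.inj h5
        have h6 := (sq_lt_sq₀ (norm_nonneg _) ht0.le).1 h4
        rw [← dist_eq_norm] at h6
        exact absurd (h2 x' h3) (not_le.2 h6)
    constructor
    · rintro ⟨⟨⟨⟨t', x⟩, s'⟩, y⟩, ⟨⟨⟨h1, -⟩, h2⟩, h3⟩, h4⟩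
      have e1 : t' = t := congrFun h4 false
      have e2 : s' = s := congrFun h4 true
      subst e1 e2
      obtain ⟨h5, h6⟩ := (hC x).1 h1
      refine ⟨x, h5, h6, y, h2, ?_⟩
      rw [dist_eq_norm]
      exact (sq_le_sq₀ (norm_nonneg _) hs0.le).1 h3
    · rintro ⟨x, h1, h2, y, h3, h4⟩
      refine ⟨(((t, x), s), y), ⟨⟨⟨(hC x).2 ⟨h1, h2⟩, hsT⟩, h3⟩, ?_⟩, rfl⟩
      rw [dist_eq_norm] at h4
      exact (sq_le_sq₀ (norm_nonneg _) hs0.le).2 h4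
  rcases flat_det hdet with h | h
  · exfalso
    obtain ⟨n, -, hn⟩ := flatF_basis.mem_iff.1 h
    obtain ⟨⟨t, s₀⟩, hts⟩ := flatR_nonempty n
    have hS' : ∀ s, 0 < s → s < t ^ n → S t s := fun s h0 h1 =>
      (hiff n (t, s) ⟨hts.1, hts.2.1, h0, h1⟩).1 (hn ⟨hts.1, hts.2.1, h0, h1⟩)
    let Q' : Set E := Q ∩ ⋂ x' ∈ W, {x | t ≤ dist x x'}
    have hQ' : IsCompact Q' := hQc.inter_right (isClosed_biInter fun x' _ =>
      isClosed_le continuous_const (continuous_id.dist continuous_const))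
    have hmem : ∀ x, x ∈ Q' ↔ x ∈ Q ∧ ∀ x' ∈ W, t ≤ dist x x' := fun x => by
      simp only [Q', mem_inter_iff, mem_iInter]; rfl
    obtain ⟨x₁, hx₁, hx₁', y₁, hy₁, -⟩ := hS' s₀ hts.2.2.1 hts.2.2.2
    have hfc : Continuous f := continuous_iff_continuousAt.2 fun p => (hf p).continuousAt
    obtain ⟨x₀, hx₀, hmin⟩ := hQ'.exists_isMinOn ⟨x₁, (hmem x₁).2 ⟨hx₁, hx₁'⟩⟩
      ((Metric.continuous_infDist_pt Z).comp hfc).continuousOn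
    have h0 : Metric.infDist (f x₀) Z = 0 := by
      by_contra hcon
      have hpos : 0 < Metric.infDist (f x₀) Z := lt_of_le_of_ne Metric.infDist_nonneg (Ne.symm hcon)
      have ht : 0 < t ^ n := pow_pos hts.1 n
      obtain ⟨x, h1, h2, y, h3, h4⟩ := hS' (min (Metric.infDist (f x₀) Z) (t ^ n) / 2)
        (by positivity) (lt_of_lt_of_le (half_lt_self (by positivity)) (min_le_right _ _))
      have h5 : Metric.infDist (f x₀) Z ≤ Metric.infDist (f x) Z := hmin ((hmem x).2 ⟨h1, h2⟩)
      have h6 : Metric.infDist (f x) Z ≤ dist (f x) y := Metric.infDist_le_dist_of_mem h3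
      rw [dist_comm] at h6
      have h7 := min_le_left (Metric.infDist (f x₀) Z) (t ^ n)
      linarith
    have h1 : f x₀ ∈ Z := (hZc.isClosed.mem_iff_infDist_zero ⟨y₁, hy₁⟩).2 h0
    have h2 := ((hmem x₀).1 hx₀).2 x₀ ⟨((hmem x₀).1 hx₀).1, h1⟩
    rw [dist_self] at h2
    exact absurd hts.1 (not_lt.2 h2)
  · obtain ⟨n, -, hn⟩ := flatF_basis.mem_iff.1 h
    refine ⟨n + 1, Nat.succ_pos n, fun t s hts x hx hx' y hy => ?_⟩
    by_contra hcon
    push Not at hcon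
    have h1 := flatR_anti (Nat.le_succ n) hts
    exact hn h1 ((hiff n (t, s) h1).2 ⟨x, hx, hx', y, hy, hcon⟩)

theorem polyGrowth_main {E F : Type} [NormedAddCommGroup E] [InnerProductSpace ℝ E]
    [FiniteDimensional ℝ E] [NormedAddCommGroup F] [InnerProductSpace ℝ F] [FiniteDimensional ℝ F]
    {f : E → F} (hf : ∀ p, AnalyticAt ℝ f p) {V : Set F} (hVo : IsOpen V) (hVs : Subanalytic V)
    {ψ : F → ℂ} (p : E) (hg : HasPolyGrowthAt ψ V (f p)) :
    HasPolyGrowthAt (ψ ∘ f) (f ⁻¹' V) p := by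
  have : ProperSpace E := FiniteDimensional.proper ℝ E
  have : ProperSpace F := FiniteDimensional.proper ℝ F
  have hfc : Continuous f := continuous_iff_continuousAt.2 fun p => (hf p).continuousAt
  by_cases hp : f p ∈ V
  · obtain ⟨r, hr, hrV⟩ := Metric.nhds_basis_closedBall.mem_iff.1 ((hVo.preimage hfc).mem_nhds hp)
    refine ⟨Metric.closedBall p r, isCompact_closedBall p r, Metric.closedBall_mem_nhds p hr, 1,
      one_pos, 0, fun x _ => ?_⟩
    rw [diff_eq_empty.2 hrV, Metric.infDist_empty]
    simp
  obtain ⟨K', hK'c, hK', N, hN, C, hC⟩ := hg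
  obtain ⟨U₀, hU₀, m, B, hB, hBc, hBe⟩ := hVs (f p)
  obtain ⟨ρ, hρ, hρU⟩ := Metric.nhds_basis_closedBall.mem_iff.1 (Filter.inter_mem hU₀ hK')
  let Z : Set F := Metric.closedBall (f p) ρ \ V
  have hZ : SubA Z := by
    have h1 : SubA (Prod.fst '' B) := ⟨Fin m → ℝ, inferInstance, inferInstance, inferInstance, B,
      hBc.isBounded.subset subset_closure, fun q _ => semiAt_of_semianalytic hB q, rfl⟩
    have h2 := (subA_closedBall (f p) hρ.le).diff
      (h1.inter_semi (C := Metric.closedBall (f p) ρ) fun q _ => semiAt_closedBall (f p) hρ.le q)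
    convert h2 using 1
    ext y
    constructor
    · rintro ⟨hy1, hy2⟩
      refine ⟨hy1, fun h => hy2 ?_⟩
      have : y ∈ V ∩ U₀ := by rw [hBe]; exact ⟨h.1, (hρU hy1).1⟩
      exact this.1
    · rintro ⟨hy1, hy2⟩
      refine ⟨hy1, fun h => hy2 ?_⟩
      have : y ∈ Prod.fst '' B ∩ U₀ := by rw [← hBe]; exact ⟨h, (hρU hy1).1⟩
      exact ⟨this.1, hy1⟩
  have hZc : IsCompact Z := (isCompact_closedBall _ _).diff hVo
  obtain ⟨r, hr, hrf⟩ := Metric.nhds_basis_closedBall.mem_iff.1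
    (hfc.continuousAt.preimage_mem_nhds (Metric.ball_mem_nhds (f p) (half_pos hρ)))
  obtain ⟨n, hn, hloj⟩ := loj hf (subA_closedBall p hr.le) (isCompact_closedBall p r) hZ hZc
  have hWeq : Metric.closedBall p r ∩ f ⁻¹' Z = Metric.closedBall p r \ f ⁻¹' V := by
    ext x
    constructor
    · rintro ⟨h1, h2⟩
      exact ⟨h1, h2.2⟩
    · rintro ⟨h1, h2⟩
      refine ⟨h1, ?_, h2⟩
      have : f x ∈ Metric.ball (f p) (ρ / 2) := hrf h1
      exact Metric.closedBall_subset_closedBall (by linarith) (Metric.ball_subset_closedBall this)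
  rw [hWeq] at hloj
  let c : ℝ := 1 / (((n : ℝ) + 1) * (r + 1))
  have hc : 0 < c := by positivity
  let κ : ℝ := min 1 ρ
  have hκ : 0 < κ := lt_min one_pos hρ
  let b : ℝ := (κ * (c ^ n / 2)) ^ N
  have hb : 0 < b := by positivity
  refine ⟨Metric.closedBall p r, isCompact_closedBall p r, Metric.closedBall_mem_nhds p hr, n * N,
    Nat.mul_pos hn hN, |C| / b, ?_⟩
  rintro x ⟨hx, hxV⟩
  set δ := Metric.infDist x (Metric.closedBall p r \ f ⁻¹' V) with hδ
  have hδ0 : 0 ≤ δ := Metric.infDist_nonneg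
  have hpW : p ∈ Metric.closedBall p r \ f ⁻¹' V := ⟨Metric.mem_closedBall_self hr.le, hp⟩
  have hδr : δ ≤ r := (Metric.infDist_le_dist_of_mem hpW).trans hx
  rcases hδ0.eq_or_lt with h0 | h0
  · rw [← h0, zero_pow (Nat.mul_pos hn hN).ne', zero_mul]
    positivity
  have hcle : c ≤ 1 := by
    rw [div_le_one (by positivity)]
    have : (0 : ℝ) ≤ n := by positivity
    nlinarith
  have ht0 : 0 < c * δ := by positivity
  have ht1 : c * δ < 1 / ((n : ℝ) + 1) := by
    have : c * (r + 1) = 1 / ((n : ℝ) + 1) := by simp only [c]; field_simp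
    rw [← this]
    exact mul_lt_mul_of_pos_left (by linarith) hc
  have htδ : c * δ ≤ δ := mul_le_of_le_one_left hδ0 hcle
  have hflat : (c * δ, (c * δ) ^ n / 2) ∈ flatR n :=
    ⟨ht0, ht1, by positivity, half_lt_self (by positivity)⟩
  have hdist := hloj _ _ hflat x hx fun x' hx' => htδ.trans (Metric.infDist_le_dist_of_mem hx')
  have ht2 : (c * δ) ^ n ≤ 1 := by
    refine pow_le_one₀ ht0.le (ht1.le.trans ?_)
    rw [div_le_one (by positivity)]
    have : (0 : ℝ) ≤ n := by positivity
    linarith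
  have hfx : f x ∈ Metric.ball (f p) (ρ / 2) := hrf hx
  have hfx' : f x ∈ Metric.closedBall (f p) ρ :=
    Metric.closedBall_subset_closedBall (by linarith) (Metric.ball_subset_closedBall hfx)
  have hD : κ * ((c * δ) ^ n / 2) ≤ Metric.infDist (f x) (K' \ V) := by
    have hne : (K' \ V).Nonempty := ⟨f p, mem_of_mem_nhds hK', hp⟩
    refine (Metric.le_infDist hne).2 fun y hy => ?_
    by_cases hyb : y ∈ Metric.closedBall (f p) ρ
    · have h1 := hdist y ⟨hyb, hy.2⟩
      rw [dist_comm]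
      refine le_trans ?_ h1.le
      exact mul_le_of_le_one_left (by positivity) (min_le_left _ _)
    · rw [Metric.mem_closedBall, not_le] at hyb
      rw [Metric.mem_ball] at hfx
      have h1 := dist_triangle y (f x) (f p)
      rw [dist_comm y (f x)] at h1
      have h2 : κ * ((c * δ) ^ n / 2) ≤ ρ * (1 / 2) :=
        mul_le_mul (min_le_right _ _) (by linarith) (by positivity) hρ.le
      linarith
  have hfin := hC (f x) ⟨(hρU hfx').2, hxV⟩
  rw [le_div_iff₀ hb]
  have h1 : δ ^ (n * N) * b = (κ * ((c * δ) ^ n / 2)) ^ N := by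
    simp only [b, pow_mul]
    rw [← mul_pow, mul_pow c δ n]
    congr 1
    ring
  calc δ ^ (n * N) * ‖(ψ ∘ f) x‖ * b = (δ ^ (n * N) * b) * ‖ψ (f x)‖ := by
        simp only [Function.comp]; ring
    _ = (κ * ((c * δ) ^ n / 2)) ^ N * ‖ψ (f x)‖ := by rw [h1]
    _ ≤ Metric.infDist (f x) (K' \ V) ^ N * ‖ψ (f x)‖ := by gcongr
    _ ≤ C := hfin
    _ ≤ |C| := le_abs_self C

/-- **Invariance of polynomial growth under real-analytic pullback.**
Let `f : ℝᵐ → ℝⁿ` be real analytic, `V` a subanalytic open subset of `ℝⁿ` and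
`U = f⁻¹(V)`.  If the smooth function `ψ` has polynomial growth at every point
of `V`, then `ψ ∘ f` has polynomial growth at every point of `U`. -/
theorem hasPolyGrowthAt_comp {m n : ℕ}
    (f : EuclideanSpace ℝ (Fin m) → EuclideanSpace ℝ (Fin n))
    (hf : AnalyticOnNhd ℝ f Set.univ)
    (V : Set (EuclideanSpace ℝ (Fin n))) (hVo : IsOpen V) (hVs : Subanalytic V)
    (ψ : EuclideanSpace ℝ (Fin n) → ℂ) (hψ : ContDiffOn ℝ (⊤ : ℕ∞) ψ V)
    (hgrowth : ∀ p, HasPolyGrowthAt ψ V p) :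
    ∀ p, HasPolyGrowthAt (ψ ∘ f) (f ⁻¹' V) p := by
  exact fun p => polyGrowth_main (fun q => hf q (mem_univ q)) hVo hVs p (hgrowth (f p))
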